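/- arXiv:1808.07190 — 6 statements merged into one kernel-verified Lean document; each statement's English description precedes it below -/
import Mathlib

section
/- Let m ≥ 1 and N ≥ 2 be integers and let A be an m-dimensional matrix of order N^m. If A' is the m-dimensional matrix obtained from A by interchanging two of its 1-layers (i.e., by swapping two values j₁ ≠ j₂ of the first index l₁), then det A' = (−1)^{m−1} det A. -/
noncomputable section

/-- The (full signed) determinant of an `m`-dimensional matrix of order `N^m`:
`det A = ∑_{τ_2,…,τ_m ∈ S_N} (∏_{s=2}^m sgn τ_s) ∏_{k=1}^N a_{k τ_2(k) ⋯ τ_m(k)}`. -/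
def hyperDet {N : ℕ} : {m : ℕ} → ((Fin m → Fin N) → ℝ) → ℝ
  | 0, A => A finZeroElim
  | m + 1, A =>
      ∑ τ : Fin m → Equiv.Perm (Fin N),
        (∏ s, ((Equiv.Perm.sign (τ s) : ℤ) : ℝ)) *
          ∏ k : Fin N, A (Fin.cons k fun s => τ s k)

/-- Interchanging a pair of `1`-layers of an `m`-dimensional matrix (swapping the two
values `j₁ ≠ j₂` of the first index) multiplies the hyper determinant by `(-1)^(m-1)`. -/
theorem stmt0 (m N : ℕ) (hm : 1 ≤ m) (hN : 2 ≤ N)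
    (A A' : (Fin m → Fin N) → ℝ) (j₁ j₂ : Fin N) (hj : j₁ ≠ j₂)
    (hA' : ∀ l, A' l = A (Function.update l ⟨0, hm⟩ (Equiv.swap j₁ j₂ (l ⟨0, hm⟩)))) :
    hyperDet A' = (-1 : ℝ) ^ (m - 1) * hyperDet A := by
  obtain ⟨n, rfl⟩ : ∃ n, m = n + 1 := ⟨m - 1, by omega⟩
  have hA'_cons (k : Fin N) (v : Fin n → Fin N) :
      A' (Fin.cons k v) = A (Fin.cons (Equiv.swap j₁ j₂ k) v) := by
    rw [hA']
    congr 1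
    exact Fin.update_cons_zero (α := fun _ => Fin N) k v _
  simp only [hyperDet, Nat.add_sub_cancel, hA'_cons]
  rw [Finset.mul_sum]
  refine Fintype.sum_equiv
    (Equiv.piCongrRight fun _ : Fin n => Equiv.mulRight (Equiv.swap j₁ j₂)) _ _ fun τ => ?_
  have hprod : ∏ k, A (Fin.cons (Equiv.swap j₁ j₂ k) fun s => τ s k) =
      ∏ k, A (Fin.cons k fun s => (τ s * Equiv.swap j₁ j₂) k) :=
    Fintype.prod_equiv (Equiv.swap j₁ j₂) _ _ fun k => by simp
  rw [hprod, ← mul_assoc]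
  congr 1
  simp [Equiv.Perm.sign_mul, Equiv.Perm.sign_swap hj, Finset.prod_neg, ← mul_assoc, ← mul_pow]
end
end

section
/- Let m ≥ 1 and N ≥ 2 be integers, let A be an m-dimensional matrix of order N^m, and let 1 ≤ i < j ≤ m. If either m is even, or m is odd and 1 < i < j ≤ m, then det A^{T(i,j)} = det A. -/
noncomputable section

/-- Right translation of the family `τ`, with its `j`-th member replaced by the identity, by the
inverse of `τ j`. -/
def rebase {n N : ℕ} (j : Fin n) (τ : Fin n → Equiv.Perm (Fin N)) : Fin n → Equiv.Perm (Fin N) :=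
  fun s => Function.update τ j 1 s * (τ j)⁻¹

lemma rebase_involutive {n N : ℕ} (j : Fin n) :
    Function.Involutive (rebase (N := N) j) := by
  intro τ
  funext s
  by_cases h : s = j
  · subst h; simp [rebase]
  · simp [rebase, Function.update_of_ne h]

lemma prod_sign_rebase {n N : ℕ} (hn : Odd n) (j : Fin n) (τ : Fin n → Equiv.Perm (Fin N)) :
    ∏ s, Equiv.Perm.sign (rebase j τ s) = ∏ s, Equiv.Perm.sign (τ s) := by
  obtain ⟨c, rfl⟩ := hn
  have hpow : Equiv.Perm.sign (τ j) ^ (2 * c + 1) = Equiv.Perm.sign (τ j) := by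
    rw [pow_succ, pow_mul, Int.units_sq, one_pow, one_mul]
  simp only [rebase, map_mul, Equiv.Perm.sign_inv, Finset.prod_mul_distrib, Finset.prod_const,
    Finset.card_univ, Fintype.card_fin, hpow]
  rw [← Finset.prod_erase_mul _ _ (Finset.mem_univ j),
    ← Finset.prod_erase_mul (a := j) _ (fun s => Equiv.Perm.sign (τ s)) (Finset.mem_univ j)]
  simp only [Function.update_self, map_one, mul_one]
  congr 1
  refine Finset.prod_congr rfl fun s hs => ?_
  rw [Function.update_of_ne (Finset.ne_of_mem_erase hs)]

lemma cons_comp_swap_succ {α : Type*} {n : ℕ} (x : α) (f : Fin n → α) (i j : Fin n) :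
    (Fin.cons x f : Fin (n + 1) → α) ∘ Equiv.swap i.succ j.succ =
      Fin.cons x (f ∘ Equiv.swap i j) := by
  funext t
  refine Fin.cases ?_ (fun s => ?_) t
  · rw [Function.comp_apply, Equiv.swap_apply_of_ne_of_ne (Fin.succ_ne_zero i).symm
      (Fin.succ_ne_zero j).symm, Fin.cons_zero, Fin.cons_zero]
  · rw [Function.comp_apply, ← (Fin.succ_injective n).map_swap, Fin.cons_succ, Fin.cons_succ,
      Function.comp_apply]

lemma cons_comp_swap_zero {n N : ℕ} (j : Fin n) (τ : Fin n → Equiv.Perm (Fin N)) (k : Fin N) :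
    (Fin.cons k (fun s => rebase j τ s k) : Fin (n + 1) → Fin N) ∘ Equiv.swap 0 j.succ =
      Fin.cons ((τ j)⁻¹ k) (fun s => τ s ((τ j)⁻¹ k)) := by
  funext t
  refine Fin.cases ?_ (fun s => ?_) t
  · simp [rebase]
  · by_cases h : s = j
    · subst h; simp
    · rw [Function.comp_apply, Equiv.swap_apply_of_ne_of_ne (Fin.succ_ne_zero s)
        ((Fin.succ_injective n).ne h)]
      simp [rebase, Function.update_of_ne h]

/-- Transposing two directions other than the first preserves the determinant. -/
lemma hyperDet_comp_swap_succ {n N : ℕ} (A : (Fin (n + 1) → Fin N) → ℝ) (i j : Fin n) :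
    hyperDet (fun l => A (l ∘ Equiv.swap i.succ j.succ)) = hyperDet A := by
  simp only [hyperDet, cons_comp_swap_succ]
  refine Fintype.sum_equiv ((Equiv.swap i j).arrowCongr (Equiv.refl _)) _ _ fun τ => ?_
  congr 1
  exact (Equiv.prod_comp (Equiv.swap i j)
    (fun s => ((Equiv.Perm.sign (τ s) : ℤ) : ℝ))).symm

/-- In even dimension, transposing the first direction with another one preserves the
determinant. -/
lemma hyperDet_comp_swap_zero {n N : ℕ} (hn : Odd n) (A : (Fin (n + 1) → Fin N) → ℝ)
    (j : Fin n) : hyperDet (fun l => A (l ∘ Equiv.swap 0 j.succ)) = hyperDet A := by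
  simp only [hyperDet]
  refine (Fintype.sum_equiv (rebase_involutive j).toPerm _ _ fun τ => ?_).symm
  simp only [Function.Involutive.coe_toPerm, cons_comp_swap_zero]
  congr 1
  · exact_mod_cast congrArg (fun u : ℤˣ => ((u : ℤ) : ℝ)) (prod_sign_rebase hn j τ).symm
  · exact (Equiv.prod_comp (τ j)⁻¹ (fun k => A (Fin.cons k fun s => τ s k))).symm

/-- If `m` is even, or `m` is odd and `1 < i` (in 0-indexed form: `0 < i`), then the
`(i,j)`-transposition of an `m`-dimensional matrix has the same hyper determinant. -/
theorem stmt2 (m N : ℕ) (hm : 1 ≤ m) (hN : 2 ≤ N)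
    (A A' : (Fin m → Fin N) → ℝ) (i j : Fin m) (hij : i < j)
    (hcase : Even m ∨ (Odd m ∧ 0 < (i : ℕ)))
    (hA' : ∀ l, A' l = A (l ∘ Equiv.swap i j)) :
    hyperDet A' = hyperDet A := by
  obtain rfl : A' = fun l => A (l ∘ Equiv.swap i j) := funext hA'
  obtain _ | n := m
  · exact i.elim0
  obtain ⟨j, rfl⟩ := Fin.exists_succ_eq.2 (Fin.ne_zero_of_lt hij)
  by_cases hi : i = 0
  · subst hi
    have hn : Odd n := by
      rcases hcase with h | ⟨-, h⟩
      · exact Nat.not_even_iff_odd.1 (Nat.even_add_one.1 h)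
      · exact absurd h (lt_irrefl 0)
    exact hyperDet_comp_swap_zero hn A j
  · obtain ⟨i, rfl⟩ := Fin.exists_succ_eq.2 hi
    exact hyperDet_comp_swap_succ A i j
end
end

section
/- Let Ω ⊂ ℝ^N (N ≥ 2) be open, let m ≥ 1, n ≥ 1 and 1 ≤ r ≤ min{n,N} be integers, u ∈ C^m(Ω,ℝ^n), β ∈ I(r,n) and 𝛂 = (α^1,…,α^m) with α^j ∈ I(r,N). Then for every 1 ≤ i ≤ m the following pointwise identity holds on Ω: M^β_𝛂(D^m u) = ∑_{τ_1,…,τ_{i−1},τ_{i+1},…,τ_m ∈ S_r} (∏_{s ≠ i} sgn τ_s) · det( ∂_{α^i_b} v^a )_{1 ≤ a,b ≤ r}, where, for each choice of the permutations, v = (v^1,…,v^r) ∈ C^1(Ω,ℝ^r) is given by v^a = ∂_{α^1_{τ_1(a)}} ⋯ ∂_{α^{i−1}_{τ_{i−1}(a)}} ∂_{α^{i+1}_{τ_{i+1}(a)}} ⋯ ∂_{α^m_{τ_m(a)}} u^{β_a} for a = 1,…,r, and det(∂_{α^i_b} v^a) is the ordinary r×r determinant of the Jacobian minor of v with columns selected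 by α^i. -/
open MeasureTheory Filter Topology Real

noncomputable section

abbrev Euc (N : ℕ) := EuclideanSpace ℝ (Fin N)

/-- classical partial derivative `∂_i f`. -/
def pderiv' {N : ℕ} (i : Fin N) (f : Euc N → ℝ) : Euc N → ℝ :=
  fun x => fderiv ℝ f x (EuclideanSpace.single i 1)

/-- iterated partial derivative `∂_{l_1} ∂_{l_2} ⋯ f`. -/
def pderivList {N : ℕ} : List (Fin N) → (Euc N → ℝ) → Euc N → ℝ
  | [], f => f
  | i :: l, f => pderiv' i (pderivList l f)

/-- the `m`th-Jacobian `(β,α)`-minor `M^β_α(D^m u)` of `u : Ω → ℝ^n`, i.e. the hyper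
determinant of the `(m+1)`-dimensional matrix of order `r^{m+1}` with entries
`∂_{α^1_{l_1}} ⋯ ∂_{α^m_{l_m}} u^{β_{l_0}}`. -/
def jacMinor {N n : ℕ} (m r : ℕ) (β : Fin r → Fin n) (α : Fin m → Fin r → Fin N)
    (u : Euc N → Fin n → ℝ) (x : Euc N) : ℝ :=
  hyperDet (m := m + 1) fun l : Fin (m + 1) → Fin r =>
    pderivList (List.ofFn fun s : Fin m => α s (l s.succ)) (fun y => u y (β (l 0))) x

/-- the `m`th-Jacobian `α`-minor `M_α(D^m v)` of a scalar function `v`. -/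
def scalMinor {N : ℕ} (m r : ℕ) (α : Fin m → Fin r → Fin N)
    (v : Euc N → ℝ) (x : Euc N) : ℝ :=
  hyperDet (m := m) fun l : Fin m → Fin r =>
    pderivList (List.ofFn fun s : Fin m => α s (l s)) v x

/-- the integer Sobolev norm `‖u‖_{W^{k,p}(Ω)} = ∑_{j ≤ k} ‖D^j u‖_{L^p(Ω)}`. -/
def intSobNorm {N : ℕ} {F : Type*} [NormedAddCommGroup F] [NormedSpace ℝ F]
    (Ω : Set (Euc N)) (k : ℕ) (p : ℝ) (u : Euc N → F) : ℝ :=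
  ∑ j ∈ Finset.range (k + 1), (∫ x in Ω, ‖iteratedFDeriv ℝ j u x‖ ^ p) ^ (1 / p)

open Classical in
/-- the (possibly fractional) Sobolev norm `‖u‖_{W^{s,p}(Ω)}`: for integer `s` the usual
Sobolev norm, for non-integer `s` the `W^{[s],p}` norm plus the Gagliardo seminorm of
`D^{[s]} u` with fractional exponent `s - [s]`. -/
def sobNorm {N : ℕ} {F : Type*} [NormedAddCommGroup F] [NormedSpace ℝ F]
    (Ω : Set (Euc N)) (s p : ℝ) (u : Euc N → F) : ℝ :=
  if ∃ k : ℕ, s = k then intSobNorm Ω ⌊s⌋₊ p u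
  else
    intSobNorm Ω ⌊s⌋₊ p u +
      (∫ x in Ω, ∫ y in Ω,
          ‖iteratedFDeriv ℝ ⌊s⌋₊ u x - iteratedFDeriv ℝ ⌊s⌋₊ u y‖ ^ p /
            ‖x - y‖ ^ ((N : ℝ) + (s - ⌊s⌋₊) * p)) ^ (1 / p)

/-- `‖D^m ψ‖_{L^∞}`, the sup of the `m`-th derivatives of `ψ`. -/
def supDm {N : ℕ} (m : ℕ) (ψ : Euc N → ℝ) : ℝ := ⨆ x, ‖iteratedFDeriv ℝ m ψ x‖

/-- `ψ ∈ C_c^∞(Ω)`. -/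
def IsCinfc {N : ℕ} (Ω : Set (Euc N)) (ψ : Euc N → ℝ) : Prop :=
  ContDiff ℝ (⊤ : ℕ∞) ψ ∧ HasCompactSupport ψ ∧ tsupport ψ ⊆ Ω

/-- `Ω` is a smooth bounded open subset of `ℝ^N`. -/
def IsSmoothDomain {N : ℕ} (Ω : Set (Euc N)) : Prop :=
  IsOpen Ω ∧ Bornology.IsBounded Ω ∧
    ∃ f : Euc N → ℝ, ContDiff ℝ (⊤ : ℕ∞) f ∧ Ω = {x | f x < 0} ∧
      ∀ x ∈ frontier Ω, fderiv ℝ f x ≠ 0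

theorem ContDiffOn.pderiv' {N : ℕ} {Ω : Set (Euc N)} (hΩ : IsOpen Ω) {k : ℕ} {g : Euc N → ℝ}
    (hg : ContDiffOn ℝ (k + 1 : ℕ) g Ω) (i : Fin N) : ContDiffOn ℝ k (pderiv' i g) Ω :=
  (hg.fderiv_of_isOpen hΩ (by norm_cast)).clm_apply contDiffOn_const

theorem ContDiffOn.pderivList {N : ℕ} {Ω : Set (Euc N)} (hΩ : IsOpen Ω) {g : Euc N → ℝ}
    (l : List (Fin N)) {k : ℕ} (hg : ContDiffOn ℝ (k + l.length : ℕ) g Ω) :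
    ContDiffOn ℝ k (pderivList l g) Ω := by
  induction l generalizing k with
  | nil => simpa [_root_.pderivList] using hg
  | cons i l ih =>
    refine ContDiffOn.pderiv' hΩ (ih ?_) i
    convert hg using 2
    simp only [List.length_cons]
    omega

theorem pderiv'_congr {N : ℕ} {Ω : Set (Euc N)} (hΩ : IsOpen Ω) {f g : Euc N → ℝ}
    (h : Set.EqOn f g Ω) (i : Fin N) : Set.EqOn (pderiv' i f) (pderiv' i g) Ω := by
  intro x hx
  have hfg : f =ᶠ[𝓝 x] g := Filter.eventuallyEq_of_mem (hΩ.mem_nhds hx) h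
  simp only [pderiv', hfg.fderiv_eq]

theorem pderiv'_comm {N : ℕ} {f : Euc N → ℝ} {x : Euc N} (hf : ContDiffAt ℝ 2 f x)
    (i j : Fin N) : pderiv' i (pderiv' j f) x = pderiv' j (pderiv' i f) x := by
  have hd : DifferentiableAt ℝ (fderiv ℝ f) x :=
    (hf.fderiv_right (m := 1) (by norm_num)).differentiableAt (by norm_num)
  have key (v w : Euc N) :
      fderiv ℝ (fun y => fderiv ℝ f y w) x v = fderiv ℝ (fderiv ℝ f) x v w := by
    rw [fderiv_clm_apply hd (differentiableAt_const w)]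
    simp
  unfold pderiv'
  rw [key, key]
  exact hf.isSymmSndFDerivAt (by simp) _ _

/-- Iterated partial derivatives of a sufficiently smooth function do not depend on the order
of differentiation. -/
theorem pderivList_perm {N : ℕ} {Ω : Set (Euc N)} (hΩ : IsOpen Ω) {g : Euc N → ℝ}
    {l₁ l₂ : List (Fin N)} (h : l₁.Perm l₂) (hg : ContDiffOn ℝ l₁.length g Ω) :
    Set.EqOn (pderivList l₁ g) (pderivList l₂ g) Ω := by
  induction h with
  | nil => exact fun _ _ => rfl
  | cons i _ ih =>
    exact pderiv'_congr hΩ (ih (hg.of_le (by simp))) i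
  | swap i j l =>
    intro x hx
    refine pderiv'_comm ?_ _ _
    refine (ContDiffOn.pderivList hΩ l (k := 2) ?_).contDiffAt (hΩ.mem_nhds hx)
    convert hg using 2
    simp only [List.length_cons]
    omega
  | trans h₁ _ ih₁ ih₂ => exact (ih₁ hg).trans (ih₂ (h₁.length_eq ▸ hg))

/-- A sum over all families splits into a sum over the value at `i` and the families that are
trivial at `i`. -/
theorem sum_eq_sum_filter_sum_update {ι G M : Type*} [Fintype ι] [DecidableEq ι] [Fintype G]
    [DecidableEq G] [One G] [AddCommMonoid M] (i : ι) (F : (ι → G) → M) :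
    ∑ τ, F τ = ∑ τ ∈ Finset.univ.filter (fun τ : ι → G => τ i = 1),
      ∑ σ, F (Function.update τ i σ) := by
  rw [← Finset.sum_product']
  refine Finset.sum_nbij' (fun τ => (Function.update τ i 1, τ i))
    (fun p => Function.update p.1 i p.2) ?_ ?_ ?_ ?_ ?_
  · simp
  · simp
  · simp
  · rintro ⟨τ, σ⟩ h
    have h1 : τ i = 1 := by simpa using h
    simp [← h1]
  · simp

/-- Lemma 2.1: the `m`th-Jacobian `(β,α)`-minor of `u` is, for each `1 ≤ i ≤ m`, a sum
over the remaining permutations `τ_s` (`s ≠ i`) of the signed ordinary `r × r` minors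
`M^{0̄}_{α^i}(D v)` of the map `v = (v^1,…,v^r)`,
`v^a = ∂_{α^1_{τ_1(a)}} ⋯ ∂̂_i ⋯ ∂_{α^m_{τ_m(a)}} u^{β_a}`. -/
theorem stmt4 (N n m r : ℕ) (hN : 2 ≤ N) (hn : 1 ≤ n) (hm : 1 ≤ m)
    (hr1 : 1 ≤ r) (hrn : r ≤ n) (hrN : r ≤ N)
    (Ω : Set (Euc N)) (hΩ : IsOpen Ω)
    (u : Euc N → Fin n → ℝ) (hu : ContDiffOn ℝ m u Ω)
    (β : Fin r → Fin n) (hβ : StrictMono β)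
    (α : Fin m → Fin r → Fin N) (hα : ∀ j, StrictMono (α j))
    (i : Fin m) :
    ∀ x ∈ Ω,
      jacMinor m r β α u x =
        ∑ τ ∈ Finset.univ.filter (fun τ : Fin m → Equiv.Perm (Fin r) => τ i = 1),
          (∏ s ∈ Finset.univ.erase i, ((Equiv.Perm.sign (τ s) : ℤ) : ℝ)) *
            Matrix.det (Matrix.of fun a b : Fin r =>
              pderiv' (α i b)
                (pderivList ((List.ofFn fun s : Fin m => α s (τ s a)).eraseIdx i)
                  (fun y => u y (β a))) x) := by
  intro x hx
  simp only [jacMinor, hyperDet, Fin.cons_succ, Fin.cons_zero]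
  rw [sum_eq_sum_filter_sum_update i]
  refine Finset.sum_congr rfl fun τ _ => ?_
  rw [← Matrix.det_transpose, Matrix.det_apply', Finset.mul_sum]
  refine Finset.sum_congr rfl fun σ _ => ?_
  rw [← Finset.mul_prod_erase _ _ (Finset.mem_univ i), Function.update_self, ← mul_assoc,
    mul_comm (((Equiv.Perm.sign σ : ℤ) : ℝ))]
  congr 1
  · congr 1
    refine Finset.prod_congr rfl fun s hs => ?_
    rw [Function.update_of_ne (Finset.ne_of_mem_erase hs)]
  · refine Finset.prod_congr rfl fun a _ => ?_
    have hua : ContDiffOn ℝ m (fun y => u y (β a)) Ω := contDiffOn_pi.1 hu (β a)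
    have hperm : (List.ofFn fun s => α s (Function.update τ i σ s a)).Perm
        (α i (σ a) :: (List.ofFn fun s => α s (τ s a)).eraseIdx i) := by
      have hset : (List.ofFn fun s => α s (Function.update τ i σ s a)) =
          (List.ofFn fun s => α s (τ s a)).set i (α i (σ a)) := by
        refine List.ext_getElem (by simp) fun k hk _ => ?_
        simp only [List.getElem_ofFn, List.getElem_set]
        split_ifs with h
        · subst h
          simp
        · rw [Function.update_of_ne (fun h' => h (congrArg Fin.val h').symm)]
      rw [hset]
      exact List.set_perm_cons_eraseIdx (by simp) _
    exact pderivList_perm hΩ hperm (by simpa using hua) hx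
end
end

section
/- Let N ≥ 2, m ≥ 1 and 1 < r ≤ N be integers, let Ω ⊂ ℝ^N be a smooth bounded open set with (−8,8)^N ⊂ Ω, and let r < p < ∞ and 0 < s < m − m/r be real numbers. Then there exist a sequence {u_k} ⊂ C^m(Ω̄, ℝ^N) and a function ψ ∈ C_c^∞(Ω) such that ‖u_k‖_{W^{s,p}(Ω)} → 0 and ∫_Ω M^{α'}_{𝛂'}(D^m u_k) ψ dx → +∞ as k → ∞, where α' = (1,2,…,r) and 𝛂' = (α',…,α') (m copies). -/
open MeasureTheory Filter Topology Real

noncomputable section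

/-- Uniform control of the derivatives of a family oscillating at frequency `k + 1` on the ball
of radius `R`: the `j`-th derivative of the `k`-th member is `O((k + 1) ^ j)`. -/
def IsOscBounded {E F : Type*} [NormedAddCommGroup E] [NormedSpace ℝ E]
    [NormedAddCommGroup F] [NormedSpace ℝ F] (R : ℝ) (f : ℕ → E → F) : Prop :=
  (∀ k, ContDiff ℝ (⊤ : ℕ∞) (f k)) ∧
    ∀ j : ℕ, ∃ C : ℝ, 0 ≤ C ∧ ∀ (k : ℕ) (x : E), ‖x‖ ≤ R →
      ‖iteratedFDeriv ℝ j (f k) x‖ ≤ C * ((k : ℝ) + 1) ^ j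

namespace IsOscBounded

variable {E F G : Type*} [NormedAddCommGroup E] [NormedSpace ℝ E]
  [NormedAddCommGroup F] [NormedSpace ℝ F] [NormedAddCommGroup G] [NormedSpace ℝ G] {R : ℝ}

theorem mul {f g : ℕ → E → ℝ} (hf : IsOscBounded R f) (hg : IsOscBounded R g) :
    IsOscBounded R fun k x => f k x * g k x := by
  refine ⟨fun k => (hf.1 k).mul (hg.1 k), fun j => ?_⟩
  choose C hC0 hC using hf.2
  choose D hD0 hD using hg.2
  refine ⟨∑ i ∈ Finset.range (j + 1), (j.choose i : ℝ) * C i * D (j - i),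
    Finset.sum_nonneg fun i _ =>
      mul_nonneg (mul_nonneg (Nat.cast_nonneg _) (hC0 _)) (hD0 _), fun k x hx => ?_⟩
  refine (norm_iteratedFDeriv_mul_le (hf.1 k) (hg.1 k) x (n := j)
    (by exact_mod_cast le_top)).trans ?_
  rw [Finset.sum_mul]
  refine Finset.sum_le_sum fun i hi => ?_
  have hij : i + (j - i) = j := by
    have := Finset.mem_range.1 hi
    omega
  calc (j.choose i : ℝ) * ‖iteratedFDeriv ℝ i (f k) x‖ * ‖iteratedFDeriv ℝ (j - i) (g k) x‖
      ≤ (j.choose i : ℝ) * (C i * ((k : ℝ) + 1) ^ i) * (D (j - i) * ((k : ℝ) + 1) ^ (j - i)) := by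
        have hCi := hC0 i
        gcongr
        · exact hC i k x hx
        · exact hD (j - i) k x hx
    _ = (j.choose i : ℝ) * C i * D (j - i) * ((k : ℝ) + 1) ^ (i + (j - i)) := by
        rw [pow_add]; ring
    _ = _ := by rw [hij]

theorem of_contDiff [ProperSpace E] {f : E → F} (hf : ContDiff ℝ (⊤ : ℕ∞) f) :
    IsOscBounded R fun _ : ℕ => f := by
  refine ⟨fun _ => hf, fun j => ?_⟩
  have hc : Continuous (iteratedFDeriv ℝ j f) :=
    hf.continuous_iteratedFDeriv (by exact_mod_cast le_top)
  obtain ⟨C, hC⟩ := (isCompact_closedBall (0 : E) R).exists_bound_of_continuousOn hc.continuousOn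
  refine ⟨max C 0, le_max_right _ _, fun k x hx => ?_⟩
  have h1 : (1 : ℝ) ≤ ((k : ℝ) + 1) ^ j := one_le_pow₀ (by linarith [k.cast_nonneg (α := ℝ)])
  calc _ ≤ C := hC x (by simpa using hx)
    _ ≤ max C 0 := le_max_left _ _
    _ ≤ _ := le_mul_of_one_le_right (le_max_right _ _) h1

theorem prod [ProperSpace E] {ι : Type*} (t : Finset ι) {f : ι → ℕ → E → ℝ}
    (hf : ∀ i ∈ t, IsOscBounded R (f i)) : IsOscBounded R fun k x => ∏ i ∈ t, f i k x := by
  classical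
  induction t using Finset.induction_on with
  | empty => simpa using of_contDiff (contDiff_const (c := (1 : ℝ)))
  | insert a t ha ih =>
    simp only [Finset.prod_insert ha]
    exact (hf a (by simp)).mul (ih fun i hi => hf i (by simp [hi]))

theorem sum [ProperSpace E] {ι : Type*} (t : Finset ι) {f : ι → ℕ → E → F}
    (hf : ∀ i ∈ t, IsOscBounded R (f i)) : IsOscBounded R fun k x => ∑ i ∈ t, f i k x := by
  refine ⟨fun k => ContDiff.sum fun i hi => (hf i hi).1 k, fun j => ?_⟩
  have h : ∀ i, ∃ C : ℝ, 0 ≤ C ∧ (i ∈ t → ∀ (k : ℕ) (x : E), ‖x‖ ≤ R →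
      ‖iteratedFDeriv ℝ j (f i k) x‖ ≤ C * ((k : ℝ) + 1) ^ j) := by
    intro i
    by_cases hi : i ∈ t
    · obtain ⟨C, hC0, hC⟩ := (hf i hi).2 j
      exact ⟨C, hC0, fun _ => hC⟩
    · exact ⟨0, le_rfl, fun h => absurd h hi⟩
  choose C hC0 hC using h
  refine ⟨∑ i ∈ t, C i, Finset.sum_nonneg fun i _ => hC0 i, fun k x hx => ?_⟩
  rw [iteratedFDeriv_fun_sum_apply fun i hi =>
    (((hf i hi).1 k).of_le (by exact_mod_cast le_top)).contDiffAt, Finset.sum_mul]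
  exact (norm_sum_le _ _).trans (Finset.sum_le_sum fun i hi => hC i hi k x hx)

theorem clm_comp (L : F →L[ℝ] G) {f : ℕ → E → F} (hf : IsOscBounded R f) :
    IsOscBounded R fun k x => L (f k x) := by
  refine ⟨fun k => L.contDiff.comp (hf.1 k), fun j => ?_⟩
  obtain ⟨C, hC0, hC⟩ := hf.2 j
  refine ⟨‖L‖ * C, by positivity, fun k x hx => ?_⟩
  have := L.norm_iteratedFDeriv_comp_left (hf.1 k).contDiffAt (x := x) (n := j)
    (by exact_mod_cast le_top)
  refine this.trans ?_
  rw [mul_assoc]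
  gcongr
  exact hC k x hx

theorem sin_comp (L : E →L[ℝ] ℝ) (c : ℝ) :
    IsOscBounded R fun (k : ℕ) x => Real.sin (((k : ℝ) + 1) * L x + c) := by
  refine ⟨fun k => by fun_prop, fun j => ⟨‖L‖ ^ j, by positivity, fun k x _ => ?_⟩⟩
  have hs : ContDiff ℝ (⊤ : ℕ∞) fun t : ℝ => Real.sin (t + c) := by fun_prop
  have h := (((k : ℝ) + 1) • L).iteratedFDeriv_comp_right hs x (i := j)
    (by exact_mod_cast le_top)
  have hfun : (fun x => Real.sin (((k : ℝ) + 1) * L x + c)) =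
      (fun t : ℝ => Real.sin (t + c)) ∘ (((k : ℝ) + 1) • L) := by
    funext x; simp
  beta_reduce
  rw [hfun, h]
  refine (ContinuousMultilinearMap.norm_compContinuousLinearMap_le _ _).trans ?_
  rw [norm_iteratedFDeriv_eq_norm_iteratedDeriv, iteratedDeriv_comp_add_const]
  have hk : ‖(k : ℝ) + 1‖ = (k : ℝ) + 1 := Real.norm_of_nonneg (by positivity)
  simp only [Finset.prod_const, Finset.card_univ, Fintype.card_fin, norm_smul, hk]
  calc _ ≤ 1 * (((k : ℝ) + 1) * ‖L‖) ^ j := by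
        gcongr
        exact Real.abs_iteratedDeriv_sin_le_one _ _
    _ = _ := by rw [mul_pow]; ring

end IsOscBounded

theorem tendsto_natCast_add_one_rpow_zero {b : ℝ} (hb : b < 0) :
    Tendsto (fun k : ℕ => ((k : ℝ) + 1) ^ b) atTop (𝓝 0) := by
  have h := (tendsto_rpow_neg_atTop (neg_pos.2 hb)).comp
    (tendsto_atTop_add_const_right _ (1 : ℝ) (tendsto_natCast_atTop_atTop (R := ℝ)))
  simpa [Function.comp_def] using h

theorem IsOscBounded.norm_iteratedFDeriv_smul_le {E F : Type*} [NormedAddCommGroup E]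
    [NormedSpace ℝ E] [NormedAddCommGroup F] [NormedSpace ℝ F] {R : ℝ} {v : ℕ → E → F}
    (hv : IsOscBounded R v) (ρ : ℝ) (j : ℕ) :
    ∃ C : ℝ, 0 ≤ C ∧ ∀ (k : ℕ) (x : E), ‖x‖ ≤ R →
      ‖iteratedFDeriv ℝ j (fun y => ((k : ℝ) + 1) ^ (-ρ) • v k y) x‖ ≤
        C * ((k : ℝ) + 1) ^ ((j : ℝ) - ρ) := by
  obtain ⟨C, hC0, hC⟩ := hv.2 j
  refine ⟨C, hC0, fun k x hx => ?_⟩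
  have ha : (0 : ℝ) < (k : ℝ) + 1 := by positivity
  rw [iteratedFDeriv_const_smul_apply'
    (((hv.1 k).of_le (by exact_mod_cast le_top)).contDiffAt), norm_smul,
    Real.norm_of_nonneg (by positivity), sub_eq_neg_add, Real.rpow_add ha, Real.rpow_natCast]
  calc _ ≤ ((k : ℝ) + 1) ^ (-ρ) * (C * ((k : ℝ) + 1) ^ j) := by
        gcongr
        exact hC k x hx
    _ = _ := by ring

theorem min_one_le_rpow {t θ : ℝ} (ht : 0 ≤ t) (hθ0 : 0 ≤ θ) (hθ1 : θ ≤ 1) :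
    min 1 t ≤ t ^ θ := by
  rcases le_total 1 t with h | h
  · exact (min_le_left _ _).trans (Real.one_le_rpow h hθ0)
  · rcases ht.eq_or_lt with rfl | ht
    · simpa using Real.zero_rpow_nonneg θ
    · exact (min_le_right _ _).trans (by
        simpa using Real.rpow_le_rpow_of_exponent_ge ht h hθ1)

/-- Interpolation between the sup bound and the Lipschitz bound of the `j`-th derivative. -/
theorem IsOscBounded.norm_iteratedFDeriv_sub_le {E F : Type*} [NormedAddCommGroup E]
    [NormedSpace ℝ E] [NormedAddCommGroup F] [NormedSpace ℝ F] {R : ℝ} {v : ℕ → E → F}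
    (hv : IsOscBounded R v) (ρ : ℝ) (j : ℕ) {θ : ℝ} (hθ0 : 0 ≤ θ) (hθ1 : θ ≤ 1) :
    ∃ C : ℝ, 0 ≤ C ∧ ∀ (k : ℕ) (x y : E), ‖x‖ ≤ R → ‖y‖ ≤ R →
      ‖iteratedFDeriv ℝ j (fun z => ((k : ℝ) + 1) ^ (-ρ) • v k z) x -
        iteratedFDeriv ℝ j (fun z => ((k : ℝ) + 1) ^ (-ρ) • v k z) y‖ ≤
        C * ((k : ℝ) + 1) ^ ((j : ℝ) + θ - ρ) * ‖x - y‖ ^ θ := by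
  obtain ⟨C, hC0, hC⟩ := hv.norm_iteratedFDeriv_smul_le ρ j
  obtain ⟨D, hD0, hD⟩ := hv.norm_iteratedFDeriv_smul_le ρ (j + 1)
  refine ⟨max (2 * C) D, le_max_of_le_right hD0, fun k x y hx hy => ?_⟩
  set a : ℝ := (k : ℝ) + 1 with ha_def
  have ha : 0 < a := by positivity
  set w : E → F := fun z => a ^ (-ρ) • v k z
  have hw : ContDiff ℝ (⊤ : ℕ∞) w := (hv.1 k).const_smul _
  have hpow : a ^ (((j + 1 : ℕ) : ℝ) - ρ) = a ^ ((j : ℝ) - ρ) * a := by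
    rw [show (((j + 1 : ℕ) : ℝ) - ρ) = ((j : ℝ) - ρ) + 1 by push_cast; ring,
      Real.rpow_add ha, Real.rpow_one]
  have h1 : ‖iteratedFDeriv ℝ j w x - iteratedFDeriv ℝ j w y‖ ≤
      max (2 * C) D * a ^ ((j : ℝ) - ρ) := by
    calc _ ≤ ‖iteratedFDeriv ℝ j w x‖ + ‖iteratedFDeriv ℝ j w y‖ := norm_sub_le _ _
      _ ≤ C * a ^ ((j : ℝ) - ρ) + C * a ^ ((j : ℝ) - ρ) := add_le_add (hC k x hx) (hC k y hy)
      _ = 2 * C * a ^ ((j : ℝ) - ρ) := by ring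
      _ ≤ _ := by gcongr; exact le_max_left _ _
  have h2 : ‖iteratedFDeriv ℝ j w x - iteratedFDeriv ℝ j w y‖ ≤
      max (2 * C) D * a ^ ((j : ℝ) - ρ) * (a * ‖x - y‖) := by
    have hdiff : Differentiable ℝ (iteratedFDeriv ℝ j w) :=
      hw.differentiable_iteratedFDeriv (by exact_mod_cast ENat.natCast_lt_top j)
    have := (convex_closedBall (0 : E) R).norm_image_sub_le_of_norm_fderiv_le
      (f := iteratedFDeriv ℝ j w) (C := D * a ^ (((j + 1 : ℕ) : ℝ) - ρ))
      (fun z _ => hdiff z)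
      (fun z hz => by
        rw [norm_fderiv_iteratedFDeriv]
        exact hD k z (by simpa using hz))
      (x := y) (y := x) (by simpa using hy) (by simpa using hx)
    refine this.trans ?_
    rw [hpow]
    calc _ = D * a ^ ((j : ℝ) - ρ) * (a * ‖x - y‖) := by ring
      _ ≤ _ := by gcongr; exact le_max_right _ _
  have hM : 0 ≤ max (2 * C) D * a ^ ((j : ℝ) - ρ) :=
    mul_nonneg (le_max_of_le_right hD0) (by positivity)
  calc _ ≤ max (2 * C) D * a ^ ((j : ℝ) - ρ) * min 1 (a * ‖x - y‖) := by
        rw [mul_min_of_nonneg _ _ hM, mul_one]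
        exact le_min h1 h2
    _ ≤ max (2 * C) D * a ^ ((j : ℝ) - ρ) * (a * ‖x - y‖) ^ θ := by
        gcongr
        exact min_one_le_rpow (by positivity) hθ0 hθ1
    _ = _ := by
        rw [Real.mul_rpow ha.le (norm_nonneg _),
          show (j : ℝ) + θ - ρ = ((j : ℝ) - ρ) + θ by ring, Real.rpow_add ha]
        ring

theorem tendsto_intSobNorm_smul {N : ℕ} {F : Type*} [NormedAddCommGroup F] [NormedSpace ℝ F]
    {Ω : Set (Euc N)} {R : ℝ} (hΩR : Ω ⊆ Metric.closedBall 0 R) {n : ℕ} {p ρ : ℝ} (hp : 0 < p)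
    (hn : (n : ℝ) < ρ) {v : ℕ → Euc N → F} (hv : IsOscBounded R v) :
    Tendsto (fun k : ℕ => intSobNorm Ω n p fun x => ((k : ℝ) + 1) ^ (-ρ) • v k x)
      atTop (𝓝 0) := by
  have hvol : volume Ω < ⊤ :=
    (measure_mono hΩR).trans_lt measure_closedBall_lt_top
  rw [← Finset.sum_const_zero (s := Finset.range (n + 1))]
  refine tendsto_finsetSum _ fun j hj => ?_
  obtain ⟨C, hC0, hC⟩ := hv.norm_iteratedFDeriv_smul_le ρ j
  have hjn : (j : ℝ) - ρ < 0 := by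
    have : (j : ℝ) ≤ n := by exact_mod_cast Nat.lt_succ_iff.1 (Finset.mem_range.1 hj)
    linarith
  have hI : Tendsto (fun k : ℕ => ∫ x in Ω,
      ‖iteratedFDeriv ℝ j (fun y => ((k : ℝ) + 1) ^ (-ρ) • v k y) x‖ ^ p) atTop (𝓝 0) := by
    refine squeeze_zero_norm (a := fun k : ℕ =>
      (C * ((k : ℝ) + 1) ^ ((j : ℝ) - ρ)) ^ p * volume.real Ω) (fun k => ?_) ?_
    · refine norm_setIntegral_le_of_norm_le_const hvol fun x hx => ?_
      rw [Real.norm_of_nonneg (by positivity)]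
      gcongr
      exact hC k x (by simpa using hΩR hx)
    · have h := ((tendsto_natCast_add_one_rpow_zero hjn).const_mul C).rpow_const
        (p := p) (Or.inr hp.le)
      simpa [Real.zero_rpow hp.ne'] using h.mul_const (volume.real Ω)
  simpa [Real.zero_rpow (inv_pos.2 hp).ne'] using
    hI.rpow_const (p := 1 / p) (Or.inr (by positivity))

/-- The Riesz kernel `‖x - y‖ ^ (-α)` with `α < N` has uniformly bounded integrals over
bounded sets. -/
theorem exists_setIntegral_le_of_le_rpow {N : ℕ} (hN : 1 ≤ N) {Ω : Set (Euc N)} {R : ℝ}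
    (hΩ : MeasurableSet Ω) (hΩR : Ω ⊆ Metric.closedBall 0 R) {α : ℝ} (hα : α < N) :
    ∃ K : ℝ, 0 ≤ K ∧ ∀ (A : ℝ), 0 ≤ A → ∀ x ∈ Ω, ∀ f : Euc N → ℝ,
      (∀ y ∈ Ω, ‖f y‖ ≤ A * ‖x - y‖ ^ (-α)) → ‖∫ y in Ω, f y‖ ≤ A * K := by
  set B : Set (Euc N) := Metric.ball 0 (2 * R + 1)
  set g : Euc N → ℝ := B.indicator fun z => ‖z‖ ^ (-α)
  have hg : Integrable g := by
    refine IntegrableOn.integrable_indicator ?_ measurableSet_ball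
    refine integrableOn_ball_of_norm_le_rpow (α := α) (C := 1) (by simpa using hN)
      (by simpa using hα) (Eventually.of_forall fun x => ?_) ?_
    · rw [Real.norm_of_nonneg (by positivity), one_mul]
    · exact (measurable_norm.pow_const _).aestronglyMeasurable
  have hg0 : ∀ z, 0 ≤ g z := fun z => Set.indicator_nonneg (fun _ _ => by positivity) z
  refine ⟨∫ z, g z, integral_nonneg hg0, fun A hA x hx f hf => ?_⟩
  have hgx : Integrable fun y => A * g (x - y) := (hg.comp_sub_left x).const_mul A
  calc ‖∫ y in Ω, f y‖ ≤ ∫ y in Ω, A * g (x - y) := by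
        refine norm_integral_le_of_norm_le hgx.integrableOn
          (ae_restrict_of_forall_mem hΩ fun y hy => ?_)
        have hxy : x - y ∈ B := by
          have hx' : ‖x‖ ≤ R := by simpa using hΩR hx
          have hy' : ‖y‖ ≤ R := by simpa using hΩR hy
          have := norm_sub_le x y
          simp only [B, Metric.mem_ball, dist_zero_right]
          linarith
        simpa only [g, Set.indicator_of_mem hxy] using hf y hy
    _ ≤ ∫ y, A * g (x - y) :=
        setIntegral_le_integral hgx (Eventually.of_forall fun y => mul_nonneg hA (hg0 _))
    _ = A * ∫ z, g z := by
        rw [integral_const_mul, integral_sub_left_eq_self g volume x]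

theorem tendsto_sobNorm_smul {N : ℕ} (hN : 1 ≤ N) {F : Type*} [NormedAddCommGroup F]
    [NormedSpace ℝ F] {Ω : Set (Euc N)} {R : ℝ} (hΩ : MeasurableSet Ω)
    (hΩR : Ω ⊆ Metric.closedBall 0 R) {p s ρ : ℝ} (hp : 0 < p) (hs0 : 0 ≤ s) (hsρ : s < ρ)
    {v : ℕ → Euc N → F} (hv : IsOscBounded R v) :
    Tendsto (fun k : ℕ => sobNorm Ω s p fun x => ((k : ℝ) + 1) ^ (-ρ) • v k x)
      atTop (𝓝 0) := by
  have hfl : (⌊s⌋₊ : ℝ) ≤ s := Nat.floor_le hs0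
  have hfl' : s < (⌊s⌋₊ : ℝ) + 1 := Nat.lt_floor_add_one s
  have hI := tendsto_intSobNorm_smul hΩR hp (hfl.trans_lt hsρ) hv
  unfold sobNorm
  split_ifs with hk
  · exact hI
  rw [← add_zero (0 : ℝ)]
  refine hI.add ?_
  have hvol : volume Ω < ⊤ :=
    (measure_mono hΩR).trans_lt measure_closedBall_lt_top
  set n := ⌊s⌋₊
  obtain ⟨θ, hθs, hθ1, hθρ⟩ : ∃ θ : ℝ, s - n < θ ∧ θ ≤ 1 ∧ n + θ < ρ :=
    ⟨min 1 (s - n + (ρ - s) / 2), lt_min (by linarith) (by linarith), min_le_left _ _, by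
      linarith [min_le_right (1 : ℝ) (s - n + (ρ - s) / 2)]⟩
  have hθ0 : 0 ≤ θ := by linarith
  obtain ⟨C, hC0, hC⟩ := hv.norm_iteratedFDeriv_sub_le ρ n hθ0 hθ1
  have hα : ((N : ℝ) + (s - n) * p) - θ * p < N := by nlinarith
  obtain ⟨K, hK0, hK⟩ := exists_setIntegral_le_of_le_rpow hN hΩ hΩR hα
  have hlim : Tendsto (fun k : ℕ => ∫ x in Ω, ∫ y in Ω,
      ‖iteratedFDeriv ℝ n (fun z => ((k : ℝ) + 1) ^ (-ρ) • v k z) x -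
        iteratedFDeriv ℝ n (fun z => ((k : ℝ) + 1) ^ (-ρ) • v k z) y‖ ^ p /
          ‖x - y‖ ^ ((N : ℝ) + (s - n) * p)) atTop (𝓝 0) := by
    refine squeeze_zero_norm (a := fun k : ℕ =>
      (C * ((k : ℝ) + 1) ^ ((n : ℝ) + θ - ρ)) ^ p * K * volume.real Ω) (fun k => ?_) ?_
    · refine norm_setIntegral_le_of_norm_le_const hvol fun x hx => ?_
      refine hK _ (by positivity) x hx _ fun y hy => ?_
      rw [Real.norm_of_nonneg (by positivity)]
      have h := hC k x y (by simpa using hΩR hx) (by simpa using hΩR hy)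
      rcases eq_or_ne x y with rfl | hxy
      · rw [sub_self, norm_zero, Real.zero_rpow hp.ne', zero_div]
        positivity
      have hd : 0 < ‖x - y‖ := norm_pos_iff.2 (sub_ne_zero.2 hxy)
      rw [div_le_iff₀ (by positivity), mul_assoc, ← Real.rpow_add hd]
      calc _ ≤ (C * ((k : ℝ) + 1) ^ ((n : ℝ) + θ - ρ) * ‖x - y‖ ^ θ) ^ p := by gcongr
        _ = _ := by
          rw [Real.mul_rpow (by positivity) (by positivity), ← Real.rpow_mul hd.le]
          congr 2
          ring
    · have h := ((tendsto_natCast_add_one_rpow_zero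
        (show (n : ℝ) + θ - ρ < 0 by linarith)).const_mul C).rpow_const (p := p) (Or.inr hp.le)
      simpa [Real.zero_rpow hp.ne'] using (h.mul_const K).mul_const (volume.real Ω)
  simpa [Real.zero_rpow (inv_pos.2 hp).ne'] using
    hlim.rpow_const (p := 1 / p) (Or.inr (by positivity))

theorem hyperDet_eq_prod_diag {m q : ℕ} (A : (Fin (m + 1) → Fin (q + 1)) → ℝ)
    (hA : ∀ (k : Fin q) (l : Fin m → Fin (q + 1)), (∃ s, l s ≠ k.castSucc) →
      A (Fin.cons k.castSucc l) = 0) :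
    hyperDet A = ∏ k : Fin (q + 1), A fun _ => k := by
  have hcons : ∀ k : Fin (q + 1), (Fin.cons k fun _ => k : Fin (m + 1) → Fin (q + 1)) =
      fun _ => k := by
    intro k
    funext j
    cases j using Fin.cases <;> rfl
  rw [hyperDet, Finset.sum_eq_single 1]
  · simp [hcons]
  · intro τ _ hτ
    obtain ⟨s, hs⟩ : ∃ s, τ s ≠ 1 := by
      by_contra! h
      exact hτ (funext h)
    obtain ⟨k, hk⟩ : ∃ k : Fin q, τ s k.castSucc ≠ k.castSucc := by
      by_contra! h
      refine hs (Equiv.ext fun k => ?_)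
      cases k using Fin.lastCases with
      | cast k => exact h k
      | last =>
        obtain ⟨k, hk⟩ := (τ s).surjective (Fin.last q)
        cases k using Fin.lastCases with
        | cast k =>
          rw [h k] at hk
          exact absurd hk (Fin.castSucc_lt_last k).ne
        | last => exact hk
    rw [Finset.prod_eq_zero (Finset.mem_univ k.castSucc) (hA k _ ⟨s, hk⟩), mul_zero]
  · intro h
    exact absurd (Finset.mem_univ _) h

section PartialDerivatives

variable {N : ℕ}

theorem pderiv'_const_mul (i : Fin N) (a : ℝ) (f : Euc N → ℝ) :
    pderiv' i (fun x => a * f x) = fun x => a * pderiv' i f x := by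
  funext x
  have h : fderiv ℝ (fun y => a * f y) x = a • fderiv ℝ f x :=
    congrFun (fderiv_const_smul_field (f := f) a) x
  simp [pderiv', h]

theorem pderivList_const_mul (l : List (Fin N)) (a : ℝ) (f : Euc N → ℝ) :
    pderivList l (fun x => a * f x) = fun x => a * pderivList l f x := by
  induction l with
  | nil => rfl
  | cons i l ih => rw [pderivList, ih, pderiv'_const_mul]; rfl

theorem hasFDerivAt_coord (i : Fin N) (x : Euc N) :
    HasFDerivAt (fun y : Euc N => y i) (EuclideanSpace.proj i : Euc N →L[ℝ] ℝ) x :=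
  (EuclideanSpace.proj i : Euc N →L[ℝ] ℝ).hasFDerivAt

theorem pderiv'_sin (e i : Fin N) (κ c : ℝ) :
    pderiv' e (fun x => Real.sin (κ * x i + c)) =
      fun x => if e = i then κ * Real.sin (κ * x i + (c + π / 2)) else 0 := by
  funext x
  have h := (((hasFDerivAt_coord i x).const_mul κ).add_const c).sin
  rw [pderiv', h.fderiv, ← add_assoc, Real.sin_add_pi_div_two]
  by_cases hei : e = i
  · subst hei
    simp [mul_comm]
  · simp [hei, Ne.symm hei]

theorem pderivList_sin (l : List (Fin N)) (i : Fin N) (κ c : ℝ) :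
    pderivList l (fun x => Real.sin (κ * x i + c)) = fun x =>
      if ∀ e ∈ l, e = i then κ ^ l.length * Real.sin (κ * x i + (c + l.length * (π / 2)))
      else 0 := by
  induction l with
  | nil => simp [pderivList]
  | cons e l ih =>
    rw [pderivList, ih]
    by_cases hl : ∀ e ∈ l, e = i
    · simp only [List.forall_mem_cons, eq_true hl, and_true, if_true]
      rw [pderiv'_const_mul, pderiv'_sin]
      funext x
      by_cases he : e = i
      · simp only [he, if_true, List.length_cons]
        rw [pow_succ, mul_assoc]
        congr 3
        push_cast
        ring
      · simp [he]
    · simp only [List.forall_mem_cons, hl, and_false, if_false]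
      funext x
      simp [pderiv']

theorem pderiv'_coord_pow_mul (i : Fin N) (n : ℕ) {G : Euc N → ℝ} (hG : Differentiable ℝ G)
    (hGi : pderiv' i G = 0) :
    pderiv' i (fun x => x i ^ n * G x) = fun x => n * (x i ^ (n - 1) * G x) := by
  funext x
  have h := ((hasFDerivAt_coord i x).pow n).mul (hG x).hasFDerivAt
  have h0 : fderiv ℝ G x (EuclideanSpace.single i 1) = 0 := congrFun hGi x
  have hd : fderiv ℝ (fun x => x i ^ n * G x) x = _ := h.fderiv
  rw [pderiv', hd]
  simp [h0]
  ring

theorem pderivList_coord_pow_mul (i : Fin N) (m n : ℕ) {G : Euc N → ℝ}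
    (hG : Differentiable ℝ G) (hGi : pderiv' i G = 0) :
    pderivList (List.replicate n i) (fun x => x i ^ m * G x) =
      fun x => (m.descFactorial n : ℝ) * (x i ^ (m - n) * G x) := by
  induction n with
  | zero => simp [pderivList]
  | succ n ih =>
    rw [List.replicate_succ, pderivList, ih, pderiv'_const_mul, pderiv'_coord_pow_mul i _ hG hGi]
    funext x
    rw [Nat.descFactorial_succ, Nat.sub_sub]
    push_cast
    ring

theorem pderiv'_prod_sin_eq_zero {ι : Type*} (t : Finset ι) (j : ι → Fin N) {i : Fin N}
    (hj : ∀ k ∈ t, j k ≠ i) (κ c : ℝ) :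
    pderiv' i (fun x => ∏ k ∈ t, Real.sin (κ * x (j k) + c)) = 0 := by
  classical
  funext x
  have h := fun k (_ : k ∈ t) =>
    (((hasFDerivAt_coord (j k) x).const_mul κ).add_const c).sin
  rw [pderiv', (HasFDerivAt.finsetProd (g := fun k (x : Euc N) => Real.sin (κ * x (j k) + c)) h).fderiv]
  simp only [_root_.sum_apply, _root_.smul_apply]
  refine Finset.sum_eq_zero fun k hk => ?_
  simp [hj k hk]

end PartialDerivatives

/-- The oscillating map `x ↦ (sin (κ x₁), …, sin (κ x_q), x_{q+1}^m ∏ sin^{(m)} (κ x_k), 0, …)`. -/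
def oscMap {N q : ℕ} (hq : q < N) (m : ℕ) (κ : ℝ) (x : Euc N) (i : Fin N) : ℝ :=
  if i.val < q then Real.sin (κ * x i + 0)
  else if i.val = q then
    x i ^ m * ∏ k : Fin q, Real.sin (κ * x (k.castLE hq.le) + m * (π / 2))
  else 0

theorem isOscBounded_oscMap {N q : ℕ} (hq : q < N) (m : ℕ) (R : ℝ) :
    IsOscBounded R fun (k : ℕ) => oscMap (N := N) hq m ((k : ℝ) + 1) := by
  have hcoord : ∀ (i : Fin N) (c : ℝ),
      IsOscBounded R fun (k : ℕ) (x : Euc N) => Real.sin (((k : ℝ) + 1) * x i + c) :=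
    fun i c => IsOscBounded.sin_comp (EuclideanSpace.proj i : Euc N →L[ℝ] ℝ) c
  have hcomp : ∀ i : Fin N,
      IsOscBounded R fun (k : ℕ) (x : Euc N) => oscMap hq m ((k : ℝ) + 1) x i := by
    intro i
    unfold oscMap
    split_ifs with h1 h2
    · exact hcoord i 0
    · exact (IsOscBounded.of_contDiff (by fun_prop)).mul
        (IsOscBounded.prod _ fun j _ => hcoord _ _)
    · exact IsOscBounded.of_contDiff contDiff_const
  have h := IsOscBounded.sum Finset.univ fun i _ =>
    (hcomp i).clm_comp (ContinuousLinearMap.single ℝ (fun _ : Fin N => ℝ) i)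
  convert h using 2 with k
  funext x
  exact (Finset.univ_sum_single _).symm

theorem jacMinor_smul_oscMap {N q : ℕ} (hq : q + 1 ≤ N) (m : ℕ) (a κ : ℝ) (x : Euc N) :
    jacMinor m (q + 1) (Fin.castLE hq) (fun _ => Fin.castLE hq)
        (fun y => a • oscMap hq m κ y) x =
      a ^ (q + 1) * (κ ^ m) ^ q * m.factorial *
        ∏ k : Fin q, Real.sin (κ * x (k.castLE (Nat.le_of_succ_le hq)) + m * (π / 2)) ^ 2 := by
  have hsin : ∀ (k : Fin q) (l : List (Fin N)),
      pderivList l (fun y => (a • oscMap hq m κ y) (Fin.castLE hq k.castSucc)) x =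
        a * if ∀ e ∈ l, e = Fin.castLE hq k.castSucc then
          κ ^ l.length * Real.sin (κ * x (Fin.castLE hq k.castSucc) +
            (0 + l.length * (π / 2))) else 0 := by
    intro k l
    have : (fun y => (a • oscMap hq m κ y) (Fin.castLE hq k.castSucc)) =
        fun y => a * Real.sin (κ * y (Fin.castLE hq k.castSucc) + 0) := by
      funext y
      simp [oscMap]
    rw [this, pderivList_const_mul, pderivList_sin]
  have hlast : (fun y => (a • oscMap hq m κ y) (Fin.castLE hq (Fin.last q))) = fun y =>
      a * (y (Fin.castLE hq (Fin.last q)) ^ m *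
        ∏ k : Fin q, Real.sin (κ * y (k.castLE (Nat.le_of_succ_le hq)) + m * (π / 2))) := by
    funext y
    simp [oscMap]
  unfold jacMinor
  rw [hyperDet_eq_prod_diag, Fin.prod_univ_castSucc]
  · simp only [hsin, hlast, pderivList_const_mul, List.ofFn_const]
    rw [pderivList_coord_pow_mul _ _ _ (by fun_prop)
      (pderiv'_prod_sin_eq_zero _ _ (fun k _ h => by
        have := congrArg Fin.val h
        simp at this
        omega) _ _)]
    have hrep : ∀ i : Fin N, ∀ e ∈ List.replicate m i, e = i :=
      fun i e he => List.eq_of_mem_replicate he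
    have hidx : ∀ k : Fin q, Fin.castLE hq k.castSucc = k.castLE (Nat.le_of_succ_le hq) :=
      fun k => rfl
    simp only [if_pos (hrep _), List.length_replicate, Nat.descFactorial_self, Nat.sub_self,
      pow_zero, one_mul, zero_add, Finset.prod_mul_distrib, Finset.prod_const,
      Finset.card_univ, Fintype.card_fin, hidx, Finset.prod_pow]
    ring
  · rintro k l ⟨s, hs⟩
    simp only [Fin.cons_zero, Fin.cons_succ]
    rw [hsin, if_neg, mul_zero]
    intro h
    exact hs (Fin.castLE_injective hq (h _ (List.mem_ofFn.2 ⟨s, rfl⟩)))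

theorem integral_sin_sq_mul_add (κ : ℕ) (hκ : κ ≠ 0) (c : ℝ) :
    ∫ t in (-π)..π, Real.sin (κ * t + c) ^ 2 = π := by
  have hκ' : (κ : ℝ) ≠ 0 := by exact_mod_cast hκ
  rw [intervalIntegral.integral_comp_mul_add (fun t => Real.sin t ^ 2) hκ', integral_sin_sq]
  have h : (κ : ℝ) * π + c = κ * -π + c + κ * (2 * π) := by ring
  rw [h, Real.sin_add_nat_mul_two_pi, Real.cos_add_nat_mul_two_pi, smul_eq_mul]
  field_simp
  ring

/-- A smooth cut-off on the line equal to `1` on `[-π, π]`, supported in `[-7, 7]`. -/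
def lineBump : ContDiffBump (0 : ℝ) :=
  ⟨π, 7, Real.pi_pos, by linarith [Real.pi_le_four]⟩

theorem pi_le_integral_mul_lineBump {g : ℝ → ℝ} (hg : Continuous g) (hg0 : ∀ t, 0 ≤ g t)
    (hgπ : π ≤ ∫ t in (-π)..π, g t) : π ≤ ∫ t, g t * lineBump t := by
  have hpi : (-π : ℝ) ≤ π := by linarith [Real.pi_pos]
  have hI : Integrable fun t => g t * lineBump t :=
    (hg.mul lineBump.continuous).integrable_of_hasCompactSupport
      lineBump.hasCompactSupport.mul_left
  calc π ≤ ∫ t in (-π)..π, g t := hgπ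
    _ = ∫ t in Set.Ioc (-π) π, g t * lineBump t := by
        rw [intervalIntegral.integral_of_le hpi]
        refine setIntegral_congr_fun measurableSet_Ioc fun t ht => ?_
        have : t ∈ Metric.closedBall (0 : ℝ) lineBump.rIn := by
          rw [mem_closedBall_zero_iff, Real.norm_eq_abs]
          exact abs_le.2 ⟨ht.1.le, ht.2⟩
        simp [lineBump.one_of_mem_closedBall this]
    _ ≤ ∫ t, g t * lineBump t :=
        setIntegral_le_integral hI
          (Eventually.of_forall fun t => mul_nonneg (hg0 t) lineBump.nonneg)

/-- The tensor product of `N` copies of `lineBump`. -/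
def boxBump (N : ℕ) (x : Euc N) : ℝ := ∏ i, lineBump (x i)

theorem boxBump_eq_zero {N : ℕ} {x : Euc N} {i : Fin N} (hi : 7 ≤ |x i|) : boxBump N x = 0 :=
  Finset.prod_eq_zero (Finset.mem_univ i) (lineBump.zero_of_le_dist (by simpa [lineBump] using hi))

theorem isCinfc_boxBump {N : ℕ} {Ω : Set (Euc N)} (hb : Bornology.IsBounded Ω)
    (hbox : {x : Euc N | ∀ i, |x i| < 8} ⊆ Ω) : IsCinfc Ω (boxBump N) := by
  have hsub : tsupport (boxBump N) ⊆ Ω := by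
    refine (closure_minimal (t := {x : Euc N | ∀ i, |x i| ≤ 7}) (fun x hx i => ?_) ?_).trans
      (fun x hx => hbox fun i => (hx i).trans_lt (by norm_num))
    · by_contra! h
      exact hx (boxBump_eq_zero h.le)
    · simp only [Set.ofPred_forall]
      exact isClosed_iInter fun i => isClosed_le (by fun_prop) continuous_const
  refine ⟨?_, ?_, hsub⟩
  · exact contDiff_prod fun i _ => lineBump.contDiff.comp
      (EuclideanSpace.proj i : Euc N →L[ℝ] ℝ).contDiff
  · exact Metric.isCompact_of_isClosed_isBounded (isClosed_tsupport _) (hb.subset hsub)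

theorem prod_castLE_eq_prod_ite {M : Type*} [CommMonoid M] {N q : ℕ} (hq : q ≤ N)
    (f : Fin N → M) :
    ∏ k : Fin q, f (k.castLE hq) = ∏ i : Fin N, if i.val < q then f i else 1 := by
  obtain ⟨d, rfl⟩ := Nat.exists_eq_add_of_le hq
  rw [Fin.prod_univ_add]
  simp
  rfl

theorem pi_pow_le_integral_prod_sin_sq_mul_boxBump {N q : ℕ} (hq : q ≤ N) (κ : ℕ) (hκ : κ ≠ 0)
    (c : ℝ) :
    π ^ N ≤ ∫ x : Euc N,
      (∏ k : Fin q, Real.sin (κ * x (k.castLE hq) + c) ^ 2) * boxBump N x := by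
  set g : Fin N → ℝ → ℝ := fun i t => if i.val < q then Real.sin (κ * t + c) ^ 2 else 1
  have hfun : ∀ x : Euc N,
      (∏ k : Fin q, Real.sin (κ * x (k.castLE hq) + c) ^ 2) * boxBump N x =
        ∏ i, (g i (x i) * lineBump (x i)) := by
    intro x
    rw [prod_castLE_eq_prod_ite hq fun i => Real.sin (κ * x i + c) ^ 2, boxBump,
      ← Finset.prod_mul_distrib]
  have hI : ∫ x : Euc N, ∏ i, (g i (x i) * lineBump (x i)) =
      ∏ i, ∫ t, g i t * lineBump t := by
    rw [← integral_fintype_prod_volume_eq_prod fun i t => g i t * lineBump t]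
    exact (EuclideanSpace.volume_preserving_symm_measurableEquiv_toLp (Fin N)).integral_comp'
      fun y : Fin N → ℝ => ∏ i, (g i (y i) * lineBump (y i))
  simp_rw [hfun]
  rw [hI]
  calc π ^ N = ∏ _i : Fin N, π := by simp
    _ ≤ _ := Finset.prod_le_prod (fun _ _ => Real.pi_pos.le) fun i _ => ?_
  refine pi_le_integral_mul_lineBump ?_ (fun t => ?_) ?_
  · by_cases hi : i.val < q
    · simp only [g, hi, if_true]
      fun_prop
    · simp only [g, hi, if_false]
      fun_prop
  · by_cases hi : i.val < q
    · simp only [g, hi, if_true]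
      positivity
    · simp [g, hi]
  · by_cases hi : i.val < q
    · simp only [g, hi, if_true]
      exact (integral_sin_sq_mul_add κ hκ c).ge
    · simp only [g, hi, if_false, intervalIntegral.integral_const, smul_eq_mul]
      linarith [Real.pi_pos]

/-- Proposition 4.1: for `1 < r ≤ N`, `p > r` and `0 < s < m - m/r`, there are
`u_k ∈ C^m(Ω̄, ℝ^N)` and `ψ ∈ C_c^∞(Ω)` with `‖u_k‖_{W^{s,p}} → 0` and
`∫_Ω M^{α'}_{α'}(D^m u_k) ψ → ∞`, where `α' = (1,…,r)`. -/
theorem stmt9 (N m r : ℕ) (hN : 2 ≤ N) (hm : 1 ≤ m) (hr1 : 1 < r) (hrN : r ≤ N)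
    (Ω : Set (Euc N)) (hΩ : IsSmoothDomain Ω)
    (hbox : {x : Euc N | ∀ i, |x i| < 8} ⊆ Ω)
    (p s : ℝ) (hp : (r : ℝ) < p) (hs0 : 0 < s) (hs : s < (m : ℝ) - (m : ℝ) / r) :
    ∃ (u : ℕ → Euc N → Fin N → ℝ) (ψ : Euc N → ℝ),
      (∀ k, ContDiffOn ℝ m (u k) (closure Ω)) ∧ IsCinfc Ω ψ ∧
      Tendsto (fun k => sobNorm Ω s p (u k)) atTop (𝓝 0) ∧
      Tendsto
        (fun k => ∫ x in Ω,
          jacMinor m r (Fin.castLE hrN) (fun _ => Fin.castLE hrN) (u k) x * ψ x)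
        atTop atTop := by
  obtain ⟨q, rfl⟩ : ∃ q, r = q + 1 := ⟨r - 1, by omega⟩
  obtain ⟨hΩo, hΩb, -⟩ := hΩ
  obtain ⟨R, hR⟩ := hΩb.subset_closedBall 0
  obtain ⟨ρ, hsρ, hρ⟩ := exists_between hs
  have hosc := isOscBounded_oscMap (N := N) hrN m R
  refine ⟨fun k x => ((k : ℝ) + 1) ^ (-ρ) • oscMap hrN m ((k : ℝ) + 1) x, boxBump N,
    fun k => ?_, isCinfc_boxBump hΩb hbox, ?_, ?_⟩
  · exact (((hosc.1 k).of_le (by exact_mod_cast le_top)).const_smul _).contDiffOn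
  · have hr0 : (0 : ℝ) < ((q + 1 : ℕ) : ℝ) := by positivity
    exact tendsto_sobNorm_smul (by omega) hΩo.measurableSet hR (hr0.trans hp) hs0.le hsρ hosc
  have hexp : 0 < (m : ℝ) * q - ρ * (q + 1) := by
    have hq0 : (0 : ℝ) < (q : ℝ) + 1 := by positivity
    have h : (m : ℝ) - m / ((q + 1 : ℕ) : ℝ) = m * q / ((q : ℝ) + 1) := by
      push_cast
      field_simp
      ring
    rw [h, lt_div_iff₀ hq0] at hρ
    linarith
  have htop : Tendsto (fun k : ℕ => ((k : ℝ) + 1) ^ ((m : ℝ) * q - ρ * (q + 1)) * π ^ N)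
      atTop atTop :=
    ((tendsto_rpow_atTop hexp).comp (tendsto_atTop_add_const_right _ (1 : ℝ)
      (tendsto_natCast_atTop_atTop (R := ℝ)))).atTop_mul_const (by positivity)
  refine tendsto_atTop_mono (fun k => ?_) htop
  have ha : (0 : ℝ) < (k : ℝ) + 1 := by positivity
  have hpow : (((k : ℝ) + 1) ^ (-ρ)) ^ (q + 1) * (((k : ℝ) + 1) ^ m) ^ q =
      ((k : ℝ) + 1) ^ ((m : ℝ) * q - ρ * (q + 1)) := by
    rw [← Real.rpow_natCast (((k : ℝ) + 1) ^ (-ρ)), ← Real.rpow_mul ha.le, ← pow_mul,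
      ← Real.rpow_natCast ((k : ℝ) + 1), ← Real.rpow_add ha]
    congr 1
    push_cast
    ring
  rw [setIntegral_eq_integral_of_forall_compl_eq_zero fun x hx => ?_]
  · simp_rw [jacMinor_smul_oscMap hrN, hpow, mul_assoc]
    rw [integral_const_mul, integral_const_mul]
    gcongr
    have h := pi_pow_le_integral_prod_sin_sq_mul_boxBump (N := N) (Nat.le_of_succ_le hrN)
      (k + 1) k.succ_ne_zero (m * (π / 2))
    push_cast at h
    refine h.trans (le_mul_of_one_le_left ((by positivity : (0 : ℝ) ≤ π ^ N).trans h) ?_)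
    exact_mod_cast m.factorial_pos
  · obtain ⟨i, hi⟩ : ∃ i, 8 ≤ |x i| := by
      by_contra! h
      exact hx (hbox h)
    rw [boxBump_eq_zero (i := i) (by linarith), mul_zero]
end
end

section
/- Let N ≥ 2, m ≥ 1 and 1 < r ≤ N be integers such that s := m − m/r is not an integer, let Ω ⊂ ℝ^N be a smooth bounded open set with (−8,8)^N ⊂ Ω, and let r < p < ∞. Then there exist a sequence {u_k} ⊂ C^m(Ω̄, ℝ^N) and a function ψ ∈ C_c^∞(Ω) such that ‖u_k‖_{W^{s,p}(Ω)} → 0 and ∫_Ω M^{α'}_{𝛂'}(D^m u_k) ψ dx → +∞ as k → ∞, where α' = (1,2,…,r) and 𝛂' = (α',…,α') (m copies). -/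
open MeasureTheory Filter Topology Real

noncomputable section

/-- The profile `y ↦ min (y ^ (1 - σ)) (y ^ (-σ))`, which controls the Gagliardo quotient of an
oscillation of unit frequency. -/
def gagProfile (σ y : ℝ) : ℝ := min (y ^ (1 - σ)) (y ^ (-σ))

lemma gagProfile_nonneg {σ y : ℝ} (hy : 0 ≤ y) : 0 ≤ gagProfile σ y :=
  le_min (rpow_nonneg hy _) (rpow_nonneg hy _)

lemma summable_min_two_rpow {σ : ℝ} (h0 : 0 < σ) (h1 : σ < 1) :
    Summable fun w : ℤ =>
      min ((2 : ℝ) ^ (((w : ℝ) + 1) * (1 - σ))) ((2 : ℝ) ^ (-(w : ℝ) * σ)) := by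
  have hpos : ∀ w : ℤ, 0 ≤
      min ((2 : ℝ) ^ (((w : ℝ) + 1) * (1 - σ))) ((2 : ℝ) ^ (-(w : ℝ) * σ)) :=
    fun w => le_min (by positivity) (by positivity)
  have geo : ∀ ε : ℝ, 0 < ε → Summable fun n : ℕ => ((2 : ℝ) ^ (-ε)) ^ n := fun ε hε =>
    summable_geometric_of_lt_one (by positivity)
      (rpow_lt_one_of_one_lt_of_neg (by norm_num) (by linarith))
  refine Summable.of_nat_of_neg ?_ ?_
  · refine Summable.of_nonneg_of_le (fun n => hpos n) (fun n => (min_le_right _ _).trans ?_)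
      (geo σ h0)
    rw [← rpow_natCast, ← rpow_mul (by norm_num)]
    apply le_of_eq
    congr 1
    push_cast
    ring
  · refine Summable.of_nonneg_of_le (fun n => hpos _) (fun n => (min_le_left _ _).trans ?_)
      ((geo (1 - σ) (by linarith)).mul_left ((2 : ℝ) ^ (1 - σ)))
    rw [← rpow_natCast, ← rpow_mul (by norm_num), ← rpow_add (by norm_num)]
    apply le_of_eq
    congr 1
    push_cast
    ring

/-- Lacunary sums of the profile are bounded, uniformly in the point and the length. -/
lemma exists_sum_gagProfile_le {σ : ℝ} (h0 : 0 < σ) (h1 : σ < 1) :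
    ∃ C : ℝ, 0 ≤ C ∧ ∀ (t : ℝ) (k : ℕ), 0 < t →
      ∑ l ∈ Finset.range k, gagProfile σ (2 ^ l * t) ≤ C := by
  have hs := summable_min_two_rpow h0 h1
  set g : ℤ → ℝ := fun w =>
    min ((2 : ℝ) ^ (((w : ℝ) + 1) * (1 - σ))) ((2 : ℝ) ^ (-(w : ℝ) * σ)) with hg
  have hpos : ∀ w, 0 ≤ g w := fun w => le_min (by positivity) (by positivity)
  refine ⟨∑' w, g w, tsum_nonneg hpos, fun t k ht => ?_⟩
  obtain ⟨z, hz1, hz2⟩ := exists_mem_Ico_zpow ht (one_lt_two)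
  have hinj : Function.Injective fun l : ℕ => (l : ℤ) + z := fun a b h => by
    simpa using h
  have hterm : ∀ l ∈ Finset.range k, gagProfile σ (2 ^ l * t) ≤ g ((l : ℤ) + z) := by
    intro l _
    have e1 : (2 : ℝ) ^ (((l : ℤ) + z : ℤ) : ℝ) ≤ 2 ^ l * t := by
      rw [rpow_intCast, zpow_add₀ (by norm_num), zpow_natCast]
      gcongr
    have e2 : 2 ^ l * t ≤ (2 : ℝ) ^ ((((l : ℤ) + z : ℤ) : ℝ) + 1) := by
      rw [show ((((l : ℤ) + z : ℤ) : ℝ) + 1) = (((l : ℤ) + (z + 1) : ℤ) : ℝ) by push_cast; ring,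
        rpow_intCast, zpow_add₀ (by norm_num), zpow_natCast]
      gcongr
    refine min_le_min ?_ ?_
    · rw [rpow_mul (by norm_num)]
      exact rpow_le_rpow (by positivity) e2 (by linarith)
    · rw [neg_mul, ← mul_neg, rpow_mul (by norm_num)]
      exact rpow_le_rpow_of_nonpos (by positivity) e1 (by linarith)
  refine (Finset.sum_le_sum hterm).trans ?_
  have := hs.sum_le_tsum ((Finset.range k).map ⟨_, hinj⟩) (fun i _ => hpos i)
  simpa using this

lemma integrable_gagProfile_norm {N : ℕ} (hN : 1 ≤ N) {σ : ℝ} (h0 : 0 < σ) (h1 : σ < 1) :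
    Integrable fun z : Euc N => gagProfile σ ‖z‖ * ‖z‖ ^ (-(N : ℝ)) := by
  have : Nonempty (Fin N) := ⟨⟨0, hN⟩⟩
  refine (integrable_fun_norm_addHaar (E := Euc N) volume
    (f := fun y => gagProfile σ y * y ^ (-(N : ℝ)))).2 ?_
  rw [finrank_euclideanSpace_fin, ← Set.Ioc_union_Ioi_eq_Ioi (zero_le_one (α := ℝ))]
  have hmeas : Measurable fun y : ℝ => y ^ (N - 1) • (gagProfile σ y * y ^ (-(N : ℝ))) := by
    unfold gagProfile
    fun_prop
  have key : ∀ y : ℝ, 0 < y → y ^ (N - 1) * y ^ (-(N : ℝ)) = y ^ (-1 : ℝ) := by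
    intro y hy
    rw [← rpow_natCast, ← rpow_add hy, Nat.cast_sub hN]
    congr 1
    push_cast
    ring
  have nn : ∀ y : ℝ, 0 < y → 0 ≤ y ^ (N - 1) • (gagProfile σ y * y ^ (-(N : ℝ))) := by
    intro y hy
    have := gagProfile_nonneg (σ := σ) hy.le
    rw [smul_eq_mul]
    positivity
  refine IntegrableOn.union ?_ ?_
  · have i1 : IntegrableOn (fun y : ℝ => y ^ (-σ)) (Set.Ioc 0 1) :=
      (intervalIntegrable_iff_integrableOn_Ioc_of_le zero_le_one).1
        (intervalIntegral.intervalIntegrable_rpow' (by linarith))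
    refine Integrable.mono' i1 hmeas.aestronglyMeasurable ?_
    refine (ae_restrict_iff' measurableSet_Ioc).2 (ae_of_all _ fun y hy => ?_)
    rw [norm_of_nonneg (nn y hy.1), smul_eq_mul, mul_left_comm, key y hy.1]
    calc gagProfile σ y * y ^ (-1 : ℝ) ≤ y ^ (1 - σ) * y ^ (-1 : ℝ) := by
          have := rpow_nonneg hy.1.le (-1 : ℝ)
          gcongr
          exact min_le_left _ _
      _ = y ^ (-σ) := by
          rw [← rpow_add hy.1]
          congr 1
          ring
  · have i1 : IntegrableOn (fun y : ℝ => y ^ (-1 - σ)) (Set.Ioi 1) :=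
      integrableOn_Ioi_rpow_of_lt (by linarith) one_pos
    refine Integrable.mono' i1 hmeas.aestronglyMeasurable ?_
    refine (ae_restrict_iff' measurableSet_Ioi).2 (ae_of_all _ fun y hy => ?_)
    have hy0 : (0 : ℝ) < y := one_pos.trans hy
    rw [norm_of_nonneg (nn y hy0), smul_eq_mul, mul_left_comm, key y hy0]
    calc gagProfile σ y * y ^ (-1 : ℝ) ≤ y ^ (-σ) * y ^ (-1 : ℝ) := by
          have := rpow_nonneg hy0.le (-1 : ℝ)
          gcongr
          exact min_le_right _ _
      _ = y ^ (-1 - σ) := by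
          rw [← rpow_add hy0]
          congr 1
          ring

lemma integrable_gagProfile_scaled {N : ℕ} (hN : 1 ≤ N) {σ : ℝ} (h0 : 0 < σ) (h1 : σ < 1)
    {n : ℝ} (hn : 0 < n) :
    Integrable (fun z : Euc N => gagProfile σ (n * ‖z‖) * ‖z‖ ^ (-(N : ℝ))) ∧
      ∫ z : Euc N, gagProfile σ (n * ‖z‖) * ‖z‖ ^ (-(N : ℝ)) =
        ∫ z : Euc N, gagProfile σ ‖z‖ * ‖z‖ ^ (-(N : ℝ)) := by
  have hI := integrable_gagProfile_norm hN h0 h1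
  have e : (fun z : Euc N => gagProfile σ (n * ‖z‖) * ‖z‖ ^ (-(N : ℝ))) =
      fun z => n ^ N * (fun w : Euc N => gagProfile σ ‖w‖ * ‖w‖ ^ (-(N : ℝ))) (n • z) := by
    funext z
    simp only [norm_smul, norm_of_nonneg hn.le]
    rw [mul_rpow hn.le (norm_nonneg z), rpow_neg hn.le, rpow_natCast]
    field_simp
  rw [e]
  refine ⟨(hI.comp_smul hn.ne').const_mul _, ?_⟩
  rw [integral_const_mul, Measure.integral_comp_smul volume
    (fun w : Euc N => gagProfile σ ‖w‖ * ‖w‖ ^ (-(N : ℝ))), finrank_euclideanSpace_fin,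
    abs_of_pos (by positivity), smul_eq_mul]
  field_simp

/-- Gagliardo energy of a kernel dominated by a lacunary sum of oscillations: it grows only
linearly in the number of frequencies. -/
lemma exists_gagliardo_le {N : ℕ} (hN : 1 ≤ N) {σ : ℝ} (h0 : 0 < σ) (h1 : σ < 1) {p : ℝ}
    (hp : 1 ≤ p) {Ω : Set (Euc N)} (hΩm : MeasurableSet Ω) (hΩ : volume Ω ≠ ⊤) :
    ∃ A : ℝ, 0 ≤ A ∧ ∀ (k : ℕ) (B : ℝ) (D : Euc N → Euc N → ℝ), 0 ≤ B →
      (∀ x y, 0 ≤ D x y) →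
      (∀ x ∈ Ω, ∀ y ∈ Ω, D x y ≤
        B * ∑ l ∈ Finset.range k, ((2 : ℝ) ^ l) ^ (-σ) * min 2 (2 ^ l * ‖x - y‖)) →
      ∫ x in Ω, ∫ y in Ω, D x y ^ p / ‖x - y‖ ^ ((N : ℝ) + σ * p) ≤ A * (B ^ p * k) := by
  obtain ⟨C, hC0, hC⟩ := exists_sum_gagProfile_le h0 h1
  set I : ℝ := ∫ z : Euc N, gagProfile σ ‖z‖ * ‖z‖ ^ (-(N : ℝ)) with hI
  have hI0 : 0 ≤ I := integral_nonneg fun z => by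
    have := gagProfile_nonneg (σ := σ) (norm_nonneg z)
    positivity
  refine ⟨volume.real Ω * (2 ^ p * C ^ (p - 1) * I), by positivity, fun k B D hB hD0 hD => ?_⟩
  set G : Euc N → ℝ := fun z => ((2 * B) ^ p * C ^ (p - 1)) *
    ∑ l ∈ Finset.range k, gagProfile σ (2 ^ l * ‖z‖) * ‖z‖ ^ (-(N : ℝ)) with hG
  have hGi : Integrable G := (integrable_finsetSum _ fun l _ =>
    (integrable_gagProfile_scaled hN h0 h1 (by positivity)).1).const_mul _
  have hG0 : ∀ z, 0 ≤ G z := fun z => mul_nonneg (by positivity) <| Finset.sum_nonneg fun l _ =>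
    mul_nonneg (gagProfile_nonneg (by positivity)) (by positivity)
  have hGint : ∫ z, G z = (2 * B) ^ p * C ^ (p - 1) * (k * I) := by
    rw [hG, integral_const_mul, integral_finsetSum _ fun l _ =>
      (integrable_gagProfile_scaled hN h0 h1 (by positivity)).1]
    congr 1
    rw [Finset.sum_congr rfl fun l _ =>
      (integrable_gagProfile_scaled hN h0 h1 (n := 2 ^ l) (by positivity)).2]
    simp [hI]
  have hpt : ∀ x ∈ Ω, ∀ y ∈ Ω, D x y ^ p / ‖x - y‖ ^ ((N : ℝ) + σ * p) ≤ G (x - y) := by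
    intro x hx y hy
    have hDxy := hD x hx y hy
    rcases (norm_nonneg (x - y)).eq_or_lt with h | h
    · have hD' : D x y = 0 := by
        refine le_antisymm (hDxy.trans (le_of_eq ?_)) (hD0 x y)
        rw [← h]
        simp
      rw [hD', zero_rpow (by linarith), zero_div]
      exact hG0 _
    · set t := ‖x - y‖ with ht
      have hsum : D x y / t ^ σ ≤ 2 * B * ∑ l ∈ Finset.range k, gagProfile σ (2 ^ l * t) := by
        rw [div_le_iff₀ (by positivity)]
        refine hDxy.trans ?_
        rw [mul_comm 2 B, mul_assoc, mul_assoc]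
        gcongr
        rw [Finset.sum_mul, Finset.mul_sum]
        refine Finset.sum_le_sum fun l _ => ?_
        have hn : (0 : ℝ) < 2 ^ l := by positivity
        have e1 : (2 ^ l * t) ^ (-σ) * t ^ σ = ((2 : ℝ) ^ l) ^ (-σ) := by
          rw [mul_rpow hn.le h.le, mul_assoc, ← rpow_add h]
          simp
        have e2 : (2 ^ l * t) ^ (1 - σ) = (2 ^ l * t) ^ (-σ) * (2 ^ l * t) := by
          rw [sub_eq_neg_add, rpow_add (by positivity), rpow_one]
        have e3 : gagProfile σ (2 ^ l * t) = (2 ^ l * t) ^ (-σ) * min (2 ^ l * t) 1 := by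
          rw [gagProfile, e2, mul_min_of_nonneg _ _ (by positivity), mul_one]
        rw [e3, ← e1]
        have : min 2 (2 ^ l * t) ≤ 2 * min (2 ^ l * t) 1 := by
          rcases le_total (2 ^ l * t) 1 with h' | h'
          · rw [min_eq_left h']
            exact (min_le_right _ _).trans (by nlinarith [mul_pos hn h])
          · rw [min_eq_right h', mul_one]
            exact min_le_left _ _
        calc (2 ^ l * t) ^ (-σ) * t ^ σ * min 2 (2 ^ l * t)
            ≤ (2 ^ l * t) ^ (-σ) * t ^ σ * (2 * min (2 ^ l * t) 1) := by gcongr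
          _ = _ := by ring
      set S := ∑ l ∈ Finset.range k, gagProfile σ (2 ^ l * t) with hS
      have hS0 : 0 ≤ S := Finset.sum_nonneg fun l _ => gagProfile_nonneg (by positivity)
      have hSC : S ≤ C := hC t k h
      have hSp : S ^ p ≤ C ^ (p - 1) * S := by
        rcases hS0.eq_or_lt with h' | h'
        · rw [← h', zero_rpow (by linarith), mul_zero]
        · calc S ^ p = S ^ (p - 1) * S := by
                rw [← rpow_add_one h'.ne', sub_add_cancel]
            _ ≤ C ^ (p - 1) * S := by
                gcongr
      calc D x y ^ p / t ^ ((N : ℝ) + σ * p) = (D x y / t ^ σ) ^ p * t ^ (-(N : ℝ)) := by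
            rw [div_rpow (hD0 x y) (by positivity), rpow_add h, rpow_mul h.le, rpow_neg h.le]
            field_simp
        _ ≤ (2 * B * S) ^ p * t ^ (-(N : ℝ)) := by
            have := hD0 x y
            gcongr
        _ ≤ (2 * B) ^ p * (C ^ (p - 1) * S) * t ^ (-(N : ℝ)) := by
            rw [mul_rpow (by positivity) hS0]
            gcongr
        _ = G (x - y) := by
            rw [hG]
            simp only [← ht]
            rw [← Finset.sum_mul]
            ring
  have hinner : ∀ x ∈ Ω, ∫ y in Ω, D x y ^ p / ‖x - y‖ ^ ((N : ℝ) + σ * p) ≤ ∫ z, G z := by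
    intro x hx
    have hGx : Integrable fun y => G (x - y) := hGi.comp_sub_left x
    calc ∫ y in Ω, D x y ^ p / ‖x - y‖ ^ ((N : ℝ) + σ * p) ≤ ∫ y in Ω, G (x - y) := by
          refine integral_mono_of_nonneg (ae_of_all _ fun y => ?_) hGx.integrableOn
            ((ae_restrict_iff' hΩm).2 (ae_of_all _ fun y hy => hpt x hx y hy))
          have := hD0 x y
          positivity
      _ ≤ ∫ y, G (x - y) := setIntegral_le_integral hGx (ae_of_all _ fun y => hG0 _)
      _ = ∫ z, G z := integral_sub_left_eq_self G volume x
  calc ∫ x in Ω, ∫ y in Ω, D x y ^ p / ‖x - y‖ ^ ((N : ℝ) + σ * p)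
      ≤ ∫ x in Ω, ∫ z, G z := by
        refine integral_mono_of_nonneg (ae_of_all _ fun x => integral_nonneg fun y => ?_)
          (integrableOn_const hΩ) ((ae_restrict_iff' hΩm).2 (ae_of_all _ hinner))
        have := hD0 x y
        positivity
    _ = volume.real Ω * (2 ^ p * C ^ (p - 1) * I) * (B ^ p * k) := by
        rw [setIntegral_const, hGint, smul_eq_mul, mul_rpow (by norm_num) hB]
        ring

lemma sum_two_pow_rpow_le {σ : ℝ} (h0 : 0 < σ) (k : ℕ) :
    ∑ l ∈ Finset.range k, ((2 : ℝ) ^ l) ^ (-σ) ≤ ∑' l : ℕ, ((2 : ℝ) ^ (-σ)) ^ l := by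
  have e : ∀ l : ℕ, ((2 : ℝ) ^ l) ^ (-σ) = ((2 : ℝ) ^ (-σ)) ^ l := fun l => by
    rw [← rpow_natCast, ← rpow_mul (by norm_num), ← rpow_natCast, ← rpow_mul (by norm_num),
      mul_comm]
  simp_rw [e]
  exact (summable_geometric_of_lt_one (by positivity)
    (rpow_lt_one_of_one_lt_of_neg (by norm_num) (by linarith))).sum_le_tsum _
      fun i _ => by positivity

/-- A lacunary series of oscillations `f l` of frequency `2 ^ l`, normalized in `W^{s,∞}`, has
fractional Sobolev norm growing at most like the `ℓ^p` norm of its coefficients. -/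
lemma exists_sobNorm_lacunary_le {N : ℕ} (hN : 1 ≤ N) {F : Type*} [NormedAddCommGroup F]
    [NormedSpace ℝ F] {Ω : Set (Euc N)} (hΩm : MeasurableSet Ω) {R : ℝ}
    (hΩ : Ω ⊆ Metric.ball 0 R) {s : ℝ} (hs : 0 ≤ s) (hns : ¬∃ k : ℕ, s = k) {p : ℝ}
    (hp : 1 ≤ p) {f : ℕ → Euc N → F} (hf : ∀ l, ContDiff ℝ (⊤ : ℕ∞) (f l)) {C : ℝ}
    (hC0 : 0 ≤ C)
    (hC : ∀ l, ∀ j ≤ ⌊s⌋₊ + 1, ∀ x ∈ Metric.ball (0 : Euc N) R,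
      ‖iteratedFDeriv ℝ j (f l) x‖ ≤ C * ((2 : ℝ) ^ l) ^ j) :
    ∃ A : ℝ, ∀ (k : ℕ) (c : ℝ), 1 ≤ k → 0 ≤ c →
      sobNorm Ω s p (fun x => ∑ l ∈ Finset.range k, (c * ((2 : ℝ) ^ l) ^ (-s)) • f l x) ≤
        A * (c * (k : ℝ) ^ (1 / p)) := by
  set d := ⌊s⌋₊ with hd
  set σ : ℝ := s - d with hσ
  have hp0 : 0 < p := by linarith
  have hσ0 : 0 < σ := by
    refine lt_of_le_of_ne (sub_nonneg.2 (Nat.floor_le hs)) fun h => hns ⟨d, ?_⟩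
    linarith
  have hσ1 : σ < 1 := by
    have := Nat.lt_floor_add_one s
    linarith
  have hvol : volume Ω ≠ ⊤ := ((measure_mono hΩ).trans_lt measure_ball_lt_top).ne
  obtain ⟨A, hA0, hA⟩ := exists_gagliardo_le hN hσ0 hσ1 hp hΩm hvol
  set T : ℝ := ∑' l : ℕ, ((2 : ℝ) ^ (-σ)) ^ l with hT
  have hT0 : 0 ≤ T := tsum_nonneg fun l => by positivity
  refine ⟨(d + 1) * (volume.real Ω ^ (1 / p) * (C * T)) + A ^ (1 / p) * C,
    fun k c hk hc => ?_⟩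
  set u : Euc N → F := fun x => ∑ l ∈ Finset.range k, (c * ((2 : ℝ) ^ l) ^ (-s)) • f l x with hu
  have hder : ∀ j x, iteratedFDeriv ℝ j u x =
      ∑ l ∈ Finset.range k, (c * ((2 : ℝ) ^ l) ^ (-s)) • iteratedFDeriv ℝ j (f l) x := by
    intro j x
    have hcd : ∀ l, ContDiff ℝ j (f l) := fun l => (hf l).of_le (by exact_mod_cast le_top)
    rw [hu, iteratedFDeriv_sum (fun l _ => (hcd l).const_smul _), Finset.sum_apply]
    exact Finset.sum_congr rfl fun l _ => iteratedFDeriv_const_smul_apply' (hcd l).contDiffAt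
  have hpow : ∀ l : ℕ, ((2 : ℝ) ^ l) ^ (-s) * (2 ^ l) ^ d = ((2 : ℝ) ^ l) ^ (-σ) := by
    intro l
    rw [← rpow_natCast ((2 : ℝ) ^ l) d, ← rpow_add (by positivity)]
    congr 1
    rw [hσ]
    ring
  have hsup : ∀ j ≤ d, ∀ x ∈ Ω, ‖iteratedFDeriv ℝ j u x‖ ≤ c * (C * T) := by
    intro j hj x hx
    rw [hder]
    calc ‖∑ l ∈ Finset.range k, (c * ((2 : ℝ) ^ l) ^ (-s)) • iteratedFDeriv ℝ j (f l) x‖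
        ≤ ∑ l ∈ Finset.range k, c * C * ((2 : ℝ) ^ l) ^ (-σ) := by
          refine norm_sum_le_of_le _ fun l _ => ?_
          rw [norm_smul, norm_of_nonneg (by positivity), ← hpow l]
          calc c * ((2 : ℝ) ^ l) ^ (-s) * ‖iteratedFDeriv ℝ j (f l) x‖
              ≤ c * ((2 : ℝ) ^ l) ^ (-s) * (C * (2 ^ l) ^ d) := by
                gcongr
                refine (hC l j (by omega) x (hΩ hx)).trans ?_
                gcongr
                exact one_le_pow₀ (by norm_num)
            _ = _ := by ring
      _ ≤ c * C * T := by
          rw [← Finset.mul_sum]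
          gcongr
          exact sum_two_pow_rpow_le hσ0 k
      _ = _ := by ring
  have hint : intSobNorm Ω d p u ≤ (d + 1) * (volume.real Ω ^ (1 / p) * (C * T)) * c := by
    have : ∀ j ∈ Finset.range (d + 1), (∫ x in Ω, ‖iteratedFDeriv ℝ j u x‖ ^ p) ^ (1 / p) ≤
        volume.real Ω ^ (1 / p) * (C * T) * c := by
      intro j hj
      have hj' : j ≤ d := Nat.lt_succ_iff.1 (Finset.mem_range.1 hj)
      have h1 : ∫ x in Ω, ‖iteratedFDeriv ℝ j u x‖ ^ p ≤ ∫ _ in Ω, (c * (C * T)) ^ p := by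
        refine integral_mono_of_nonneg (ae_of_all _ fun x => by positivity)
          (integrableOn_const hvol) ((ae_restrict_iff' hΩm).2 (ae_of_all _ fun x hx => ?_))
        have := hsup j hj' x hx
        dsimp only
        gcongr
      rw [setIntegral_const, smul_eq_mul] at h1
      calc (∫ x in Ω, ‖iteratedFDeriv ℝ j u x‖ ^ p) ^ (1 / p)
          ≤ (volume.real Ω * (c * (C * T)) ^ p) ^ (1 / p) :=
            rpow_le_rpow (integral_nonneg fun x => by positivity) h1 (by positivity)
        _ = _ := by
            rw [mul_rpow (by positivity) (by positivity), ← rpow_mul (by positivity),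
              mul_one_div_cancel hp0.ne', rpow_one]
            ring
    refine (Finset.sum_le_sum this).trans (le_of_eq ?_)
    simp
    ring
  have hgag : (∫ x in Ω, ∫ y in Ω, ‖iteratedFDeriv ℝ d u x - iteratedFDeriv ℝ d u y‖ ^ p /
      ‖x - y‖ ^ ((N : ℝ) + σ * p)) ^ (1 / p) ≤ A ^ (1 / p) * C * (c * (k : ℝ) ^ (1 / p)) := by
    have h1 := hA k (c * C) (fun x y => ‖iteratedFDeriv ℝ d u x - iteratedFDeriv ℝ d u y‖)
      (by positivity) (fun x y => norm_nonneg _) ?_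
    · calc (∫ x in Ω, ∫ y in Ω, ‖iteratedFDeriv ℝ d u x - iteratedFDeriv ℝ d u y‖ ^ p /
            ‖x - y‖ ^ ((N : ℝ) + σ * p)) ^ (1 / p)
          ≤ (A * ((c * C) ^ p * k)) ^ (1 / p) :=
            rpow_le_rpow (integral_nonneg fun x => integral_nonneg fun y => by positivity) h1
              (by positivity)
        _ = _ := by
            rw [mul_rpow hA0 (by positivity), mul_rpow (by positivity) (by positivity),
              ← rpow_mul (by positivity), mul_one_div_cancel hp0.ne', rpow_one]
            ring
    · intro x hx y hy
      rw [hder, hder, ← Finset.sum_sub_distrib, Finset.mul_sum]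
      refine norm_sum_le_of_le _ fun l _ => ?_
      rw [← smul_sub, norm_smul, norm_of_nonneg (by positivity), ← hpow l]
      have hn : (0 : ℝ) ≤ (2 ^ l) ^ d := by positivity
      have hdiff : ‖iteratedFDeriv ℝ d (f l) x - iteratedFDeriv ℝ d (f l) y‖ ≤
          C * (2 ^ l) ^ d * min 2 (2 ^ l * ‖x - y‖) := by
        rw [mul_min_of_nonneg _ _ (by positivity)]
        refine le_min ?_ ?_
        · have h1 := hC l d (by omega) x (hΩ hx)
          have h2 := hC l d (by omega) y (hΩ hy)
          have := norm_sub_le (iteratedFDeriv ℝ d (f l) x) (iteratedFDeriv ℝ d (f l) y)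
          linarith
        · have := (convex_ball (0 : Euc N) R).norm_image_sub_le_of_norm_fderiv_le (𝕜 := ℝ)
            (f := iteratedFDeriv ℝ d (f l)) (C := C * (2 ^ l) ^ (d + 1))
            (fun z _ => ((hf l).differentiable_iteratedFDeriv (m := d)
              (by exact_mod_cast ENat.natCast_lt_top d)) z)
            (fun z hz => by
              rw [norm_fderiv_iteratedFDeriv]
              exact hC l (d + 1) le_rfl z hz) (hΩ hy) (hΩ hx)
          refine this.trans (le_of_eq ?_)
          ring
      calc c * ((2 : ℝ) ^ l) ^ (-s) * ‖iteratedFDeriv ℝ d (f l) x - iteratedFDeriv ℝ d (f l) y‖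
          ≤ c * ((2 : ℝ) ^ l) ^ (-s) * (C * (2 ^ l) ^ d * min 2 (2 ^ l * ‖x - y‖)) := by gcongr
        _ = _ := by ring
  have hk1 : c ≤ c * (k : ℝ) ^ (1 / p) :=
    le_mul_of_one_le_right hc (one_le_rpow (by exact_mod_cast hk) (by positivity))
  have hE0 : 0 ≤ (d + 1) * (volume.real Ω ^ (1 / p) * (C * T)) := by positivity
  rw [sobNorm, if_neg hns, add_mul]
  exact add_le_add (hint.trans (mul_le_mul_of_nonneg_left hk1 hE0)) hgag

/-- The family `f l` oscillates at frequency at most `2 ^ l`: its derivatives up to order `J` are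
bounded on `ball 0 R` by the corresponding powers of `2 ^ l`. -/
def HasFreqBound {N : ℕ} (R : ℝ) (J : ℕ) {F : Type*} [NormedAddCommGroup F] [NormedSpace ℝ F]
    (f : ℕ → Euc N → F) : Prop :=
  (∀ l, ContDiff ℝ (⊤ : ℕ∞) (f l)) ∧ ∃ C : ℝ, 0 ≤ C ∧
    ∀ l, ∀ j ≤ J, ∀ x ∈ Metric.ball (0 : Euc N) R,
      ‖iteratedFDeriv ℝ j (f l) x‖ ≤ C * ((2 : ℝ) ^ l) ^ j

namespace HasFreqBound

variable {N : ℕ} {R : ℝ} {J : ℕ}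

lemma const {F : Type*} [NormedAddCommGroup F] [NormedSpace ℝ F] {g : Euc N → F}
    (hg : ContDiff ℝ (⊤ : ℕ∞) g) : HasFreqBound R J fun _ => g := by
  refine ⟨fun _ => hg, ?_⟩
  have h : ∀ j : ℕ, ∃ C : ℝ, ∀ x ∈ Metric.closedBall (0 : Euc N) R,
      ‖iteratedFDeriv ℝ j g x‖ ≤ C := fun j =>
    (isCompact_closedBall (0 : Euc N) R).exists_bound_of_continuousOn
      (hg.continuous_iteratedFDeriv (m := j) (by exact_mod_cast le_top)).continuousOn
  choose C hC using h
  refine ⟨∑ j ∈ Finset.range (J + 1), |C j|, Finset.sum_nonneg fun _ _ => abs_nonneg _,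
    fun l j hj x hx => ?_⟩
  have h1 := hC j x (Metric.ball_subset_closedBall hx)
  have h2 : |C j| ≤ ∑ j ∈ Finset.range (J + 1), |C j| :=
    Finset.single_le_sum (f := fun j => |C j|) (fun _ _ => abs_nonneg _)
      (Finset.mem_range.2 (by omega))
  have h3 : (1 : ℝ) ≤ ((2 : ℝ) ^ l) ^ j := one_le_pow₀ (one_le_pow₀ (by norm_num))
  have h4 := le_abs_self (C j)
  nlinarith [abs_nonneg (C j)]

lemma mul {f g : ℕ → Euc N → ℝ} (hf : HasFreqBound R J f) (hg : HasFreqBound R J g) :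
    HasFreqBound R J fun l x => f l x * g l x := by
  obtain ⟨hf, Cf, hf0, hCf⟩ := hf
  obtain ⟨hg, Cg, hg0, hCg⟩ := hg
  refine ⟨fun l => (hf l).mul (hg l), 2 ^ J * (Cf * Cg), by positivity, fun l j hj x hx => ?_⟩
  calc ‖iteratedFDeriv ℝ j (fun x => f l x * g l x) x‖
      ≤ ∑ i ∈ Finset.range (j + 1), (j.choose i : ℝ) * ‖iteratedFDeriv ℝ i (f l) x‖ *
          ‖iteratedFDeriv ℝ (j - i) (g l) x‖ :=
        norm_iteratedFDeriv_mul_le (hf l) (hg l) x (by exact_mod_cast le_top)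
    _ ≤ ∑ i ∈ Finset.range (j + 1), (j.choose i : ℝ) * (Cf * Cg * ((2 : ℝ) ^ l) ^ j) := by
        refine Finset.sum_le_sum fun i hi => ?_
        have hij : i ≤ j := Nat.lt_succ_iff.1 (Finset.mem_range.1 hi)
        rw [mul_assoc]
        refine mul_le_mul_of_nonneg_left ?_ (Nat.cast_nonneg _)
        calc ‖iteratedFDeriv ℝ i (f l) x‖ * ‖iteratedFDeriv ℝ (j - i) (g l) x‖
            ≤ (Cf * ((2 : ℝ) ^ l) ^ i) * (Cg * ((2 : ℝ) ^ l) ^ (j - i)) := by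
              gcongr
              · exact hCf l i (by omega) x hx
              · exact hCg l (j - i) (by omega) x hx
          _ = Cf * Cg * (((2 : ℝ) ^ l) ^ i * ((2 : ℝ) ^ l) ^ (j - i)) := by ring
          _ = _ := by rw [← pow_add, Nat.add_sub_cancel' hij]
    _ = 2 ^ j * (Cf * Cg * ((2 : ℝ) ^ l) ^ j) := by
        rw [← Finset.sum_mul]
        congr 1
        exact_mod_cast Nat.sum_range_choose j
    _ ≤ 2 ^ J * (Cf * Cg * ((2 : ℝ) ^ l) ^ j) := by
        gcongr
        norm_num
    _ = _ := by ring

lemma finset_prod {ι : Type*} {f : ι → ℕ → Euc N → ℝ} (t : Finset ι)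
    (hf : ∀ i ∈ t, HasFreqBound R J (f i)) : HasFreqBound R J fun l x => ∏ i ∈ t, f i l x := by
  classical
  induction t using Finset.induction_on with
  | empty => simpa using const (N := N) (R := R) (J := J) (g := fun _ => (1 : ℝ)) contDiff_const
  | insert a t ha ih =>
    simp only [Finset.prod_insert ha]
    exact (hf a (by simp)).mul (ih fun i hi => hf i (by simp [hi]))

lemma pi {f : Fin N → ℕ → Euc N → ℝ} (hf : ∀ i, HasFreqBound R J (f i)) :
    HasFreqBound R J fun l x i => f i l x := by
  choose h C hC0 hC using hf
  refine ⟨fun l => contDiff_pi.2 fun i => h i l,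
    ∑ i, ‖ContinuousLinearMap.single ℝ (fun _ : Fin N => ℝ) i‖ * C i,
    Finset.sum_nonneg fun i _ => mul_nonneg (norm_nonneg _) (hC0 i), fun l j hj x hx => ?_⟩
  have e : (fun x i => f i l x) = fun x =>
      ∑ i, (ContinuousLinearMap.single ℝ (fun _ : Fin N => ℝ) i ∘ f i l) x := by
    funext x
    simp only [Function.comp_apply, ContinuousLinearMap.single_apply]
    exact (Finset.univ_sum_single _).symm
  have hcd : ∀ i, ContDiff ℝ j (f i l) := fun i => (h i l).of_le (by exact_mod_cast le_top)
  beta_reduce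
  rw [e, iteratedFDeriv_sum fun i _ => (ContinuousLinearMap.contDiff _).comp (hcd i),
    Finset.sum_apply, Finset.sum_mul]
  refine norm_sum_le_of_le _ fun i _ => ?_
  refine (ContinuousLinearMap.norm_iteratedFDeriv_comp_left _ (hcd i).contDiffAt le_rfl).trans ?_
  rw [mul_assoc]
  gcongr
  exact hC i l j hj x hx

lemma cos_coord (i : Fin N) (θ : ℝ) :
    HasFreqBound R J fun l (x : Euc N) => cos (2 ^ l * x i - θ) := by
  refine ⟨fun l => by fun_prop, 1, zero_le_one, fun l j _ x _ => ?_⟩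
  set L : Euc N →L[ℝ] ℝ := ((2 : ℝ) ^ l) • EuclideanSpace.proj i with hL
  have hLn : ‖L‖ ≤ 2 ^ l := by
    refine ContinuousLinearMap.opNorm_le_bound _ (by positivity) fun x => ?_
    have := PiLp.norm_apply_le x i
    rw [hL, smul_apply, norm_smul, norm_of_nonneg (by positivity : (0 : ℝ) ≤ 2 ^ l)]
    exact mul_le_mul_of_nonneg_left this (by positivity)
  have hc : ContDiff ℝ (⊤ : ℕ∞) fun t : ℝ => cos (t - θ) := by fun_prop
  have e : (fun x : Euc N => cos (2 ^ l * x i - θ)) = (fun t : ℝ => cos (t - θ)) ∘ L := by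
    funext x
    simp [hL]
  have hcos : ∀ t, ‖iteratedFDeriv ℝ j (fun t : ℝ => cos (t - θ)) t‖ ≤ 1 := by
    intro t
    rw [norm_iteratedFDeriv_eq_norm_iteratedDeriv, iteratedDeriv_comp_sub_const]
    exact abs_iteratedDeriv_cos_le_one j _
  beta_reduce
  rw [e, L.iteratedFDeriv_comp_right hc x (by exact_mod_cast le_top)]
  refine (ContinuousMultilinearMap.norm_compContinuousLinearMap_le _ _).trans ?_
  rw [Finset.prod_const, Finset.card_univ, Fintype.card_fin]
  gcongr
  exact hcos _

end HasFreqBound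

/-- A smooth cutoff whose translates by `2πℤ` form a partition of unity. -/
def periodCutoff (t : ℝ) : ℝ := smoothTransition (t + 2 * π) - smoothTransition t

lemma contDiff_periodCutoff : ContDiff ℝ (⊤ : ℕ∞) periodCutoff :=
  (smoothTransition.contDiff.comp (contDiff_id.add contDiff_const)).sub smoothTransition.contDiff

lemma periodCutoff_support : Function.support periodCutoff ⊆ Set.Ioc (-(2 * π)) 1 := by
  intro t ht
  by_contra h
  apply ht
  rw [Set.mem_Ioc, not_and_or, not_lt, not_le] at h
  have hpi := pi_pos
  rcases h with h | h
  · rw [periodCutoff, smoothTransition.zero_of_nonpos (by linarith),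
      smoothTransition.zero_of_nonpos (by linarith), sub_zero]
  · rw [periodCutoff, smoothTransition.one_of_one_le (by linarith),
      smoothTransition.one_of_one_le h.le, sub_self]

lemma integrable_mul_periodCutoff {g : ℝ → ℝ} (hg : Continuous g) :
    Integrable fun t => g t * periodCutoff t := by
  refine (hg.mul contDiff_periodCutoff.continuous).integrable_of_hasCompactSupport ?_
  refine HasCompactSupport.intro (isCompact_Icc (a := -(2 * π)) (b := 1)) fun t ht => ?_
  have : periodCutoff t = 0 := by
    by_contra h
    exact ht (Set.Ioc_subset_Icc_self (periodCutoff_support h))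
  rw [Pi.mul_apply, this, mul_zero]

/-- Integrating a periodic function against the cutoff yields its integral over one period. -/
lemma integral_mul_periodCutoff {g : ℝ → ℝ} (hg : Continuous g)
    (hper : Function.Periodic g (2 * π)) :
    ∫ t, g t * periodCutoff t = ∫ t in (0 : ℝ)..(2 * π), g t := by
  have hθ : Continuous smoothTransition := smoothTransition.continuous
  have hsupp : Function.support (fun t => g t * periodCutoff t) ⊆ Set.Ioc (-(2 * π)) 1 :=
    (Function.support_mul_subset_right _ _).trans periodCutoff_support
  rw [← intervalIntegral.integral_eq_integral_of_support_subset hsupp]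
  have hc : Continuous fun t => g t * smoothTransition t := by fun_prop
  have hc' : Continuous fun t => g (t + 2 * π) * smoothTransition (t + 2 * π) := by fun_prop
  have e : (fun t => g t * periodCutoff t) = fun t =>
      g (t + 2 * π) * smoothTransition (t + 2 * π) - g t * smoothTransition t := by
    funext t
    rw [hper t, periodCutoff, mul_sub]
  have hpi := pi_pos
  have hzero : ∫ t in -(2 * π)..0, g t * smoothTransition t = 0 := by
    rw [intervalIntegral.integral_congr (g := fun _ => (0 : ℝ)), intervalIntegral.integral_zero]
    intro t ht
    rw [Set.uIcc_of_le (by linarith)] at ht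
    simp only [smoothTransition.zero_of_nonpos ht.2, mul_zero]
  have hone : ∫ t in (1 : ℝ)..(1 + 2 * π), g t * smoothTransition t =
      ∫ t in (1 : ℝ)..(1 + 2 * π), g t := by
    refine intervalIntegral.integral_congr fun t ht => ?_
    rw [Set.uIcc_of_le (by linarith)] at ht
    simp only [smoothTransition.one_of_one_le ht.1, mul_one]
  rw [e, intervalIntegral.integral_sub (hc'.intervalIntegrable _ _)
      (hc.intervalIntegrable _ _),
    intervalIntegral.integral_comp_add_right (fun t => g t * smoothTransition t),
    neg_add_cancel,
    ← intervalIntegral.integral_add_adjacent_intervals (hc.intervalIntegrable (-(2 * π)) 0)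
      (hc.intervalIntegrable 0 1), hzero,
    ← intervalIntegral.integral_add_adjacent_intervals (hc.intervalIntegrable 0 1)
      (hc.intervalIntegrable 1 (1 + 2 * π)), hone, hper.intervalIntegral_add_eq 1 0]
  simp

lemma integral_cos_int_mul (n : ℤ) :
    ∫ t in (0 : ℝ)..(2 * π), cos (n * t) = if n = 0 then 2 * π else 0 := by
  split_ifs with h
  · simp [h]
  · have hn : (n : ℝ) ≠ 0 := by exact_mod_cast h
    rw [intervalIntegral.integral_comp_mul_left (fun t => cos t) hn, integral_cos]
    have : sin ((n : ℝ) * (2 * π)) = 0 := by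
      rw [show (n : ℝ) * (2 * π) = ((2 * n : ℤ) : ℝ) * π by push_cast; ring]
      exact sin_int_mul_pi _
    simp [this]

lemma integral_cos_two_pow_mul_cos_two_pow (i l : ℕ) :
    ∫ t in (0 : ℝ)..(2 * π), cos (2 ^ i * t) * cos (2 ^ l * t) = if i = l then π else 0 := by
  have e : ∀ t : ℝ, cos (2 ^ i * t) * cos (2 ^ l * t) =
      (cos (((2 ^ i - 2 ^ l : ℤ) : ℝ) * t) + cos (((2 ^ i + 2 ^ l : ℤ) : ℝ) * t)) / 2 := by
    intro t
    push_cast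
    rw [sub_mul, add_mul, cos_sub, cos_add]
    ring
  have h2 : (2 ^ i + 2 ^ l : ℤ) ≠ 0 := by positivity
  simp_rw [e]
  rw [intervalIntegral.integral_div, intervalIntegral.integral_add
    (Continuous.intervalIntegrable (by fun_prop) _ _)
    (Continuous.intervalIntegrable (by fun_prop) _ _), integral_cos_int_mul,
    integral_cos_int_mul, if_neg h2]
  by_cases h : i = l
  · simp [h]
  · have : (2 ^ i - 2 ^ l : ℤ) ≠ 0 := fun h' =>
      h (Int.pow_right_injective (a := 2) (by norm_num) (sub_eq_zero.1 h'))
    simp [h, this]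

lemma periodic_cos_two_pow (l : ℕ) : Function.Periodic (fun t => cos (2 ^ l * t)) (2 * π) := by
  intro t
  have := cos_add_nat_mul_two_pi (2 ^ l * t) (2 ^ l)
  push_cast at this
  simp only [mul_add]
  exact this

lemma integral_lacunary_mul_cos {K l : ℕ} (hl : l < K) (b : ℕ → ℝ) :
    ∫ t, (∑ i ∈ Finset.range K, b i * cos (2 ^ i * t)) * cos (2 ^ l * t) * periodCutoff t =
      b l * π := by
  rw [integral_mul_periodCutoff (g := fun t =>
    (∑ i ∈ Finset.range K, b i * cos (2 ^ i * t)) * cos (2 ^ l * t)) (by fun_prop)]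
  · simp_rw [Finset.sum_mul, mul_assoc]
    rw [intervalIntegral.integral_finsetSum fun i _ =>
      Continuous.intervalIntegrable (by fun_prop) _ _]
    simp_rw [intervalIntegral.integral_const_mul, integral_cos_two_pow_mul_cos_two_pow]
    simp [hl]
  · intro t
    simp only [fun i => periodic_cos_two_pow i t]

lemma integral_periodCutoff : ∫ t, periodCutoff t = 2 * π := by
  have := integral_mul_periodCutoff (g := fun _ => 1) continuous_const fun _ => rfl
  simpa using this

lemma integral_euc_prod {N : ℕ} (F : Fin N → ℝ → ℝ) :
    ∫ x : Euc N, ∏ i, F i (x i) = ∏ i, ∫ t, F i t := by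
  rw [← integral_fintype_prod_volume_eq_prod]
  exact (EuclideanSpace.volume_preserving_symm_measurableEquiv_toLp (Fin N)).integral_comp'
    (fun y : Fin N → ℝ => ∏ i, F i (y i))

lemma integrable_euc_prod {N : ℕ} {F : Fin N → ℝ → ℝ} (hF : ∀ i, Integrable (F i)) :
    Integrable fun x : Euc N => ∏ i, F i (x i) :=
  ((EuclideanSpace.volume_preserving_symm_measurableEquiv_toLp (Fin N)).integrable_comp_emb
    (MeasurableEquiv.measurableEmbedding _)).2 (Integrable.fintype_prod hF)

section PartialDerivatives

variable {N : ℕ}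

lemma pderiv'_coord (i j : Fin N) {g : ℝ → ℝ} (hg : Differentiable ℝ g) :
    pderiv' j (fun x : Euc N => g (x i)) = fun x => if j = i then deriv g (x i) else 0 := by
  funext x
  have h1 : HasFDerivAt (fun x : Euc N => x i) (EuclideanSpace.proj i : Euc N →L[ℝ] ℝ) x :=
    (EuclideanSpace.proj i : Euc N →L[ℝ] ℝ).hasFDerivAt
  have h2 := (hg (x i)).hasDerivAt.comp_hasFDerivAt x h1
  rw [pderiv', show (fun x : Euc N => g (x i)) = g ∘ fun x => x i from rfl, h2.fderiv]
  by_cases h : j = i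
  · simp [h]
  · simp [h, Ne.symm h]

lemma pderiv'_zero (j : Fin N) : pderiv' j (fun _ => 0) = fun _ : Euc N => (0 : ℝ) := by
  funext x
  simp [pderiv']

lemma pderivList_coord (i : Fin N) {g : ℝ → ℝ} (hg : ContDiff ℝ (⊤ : ℕ∞) g) (L : List (Fin N)) :
    pderivList L (fun x : Euc N => g (x i)) =
      fun x => if ∀ j ∈ L, j = i then iteratedDeriv L.length g (x i) else 0 := by
  induction L with
  | nil => simp [pderivList]
  | cons j L ih =>
    rw [pderivList, ih]
    by_cases h : ∀ j ∈ L, j = i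
    · simp only [if_pos h]
      rw [pderiv'_coord i j (hg.differentiable_iteratedDeriv L.length
        (by exact_mod_cast ENat.natCast_lt_top _))]
      simp only [List.forall_mem_cons, and_iff_left h, List.length_cons, iteratedDeriv_succ]
    · simp only [if_neg h]
      rw [pderiv'_zero]
      have : ¬∀ j' ∈ j :: L, j' = i := fun h' => h fun a ha => h' a (by simp [ha])
      simp only [if_neg this]

lemma iteratedDeriv_sum_cos (K : ℕ) (a w : ℕ → ℝ) (θ : ℝ) (n : ℕ) :
    iteratedDeriv n (fun t => ∑ l ∈ Finset.range K, a l * cos (w l * t - θ)) =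
      fun t => ∑ l ∈ Finset.range K, a l * w l ^ n * cos (w l * t - θ + n * (π / 2)) := by
  induction n with
  | zero => simp
  | succ n ih =>
    rw [iteratedDeriv_succ, ih]
    funext t
    refine HasDerivAt.deriv (HasDerivAt.fun_sum fun l _ => ?_)
    have h1 : HasDerivAt (fun t => w l * t - θ + n * (π / 2)) (w l) t := by
      simpa using (((hasDerivAt_id t).const_mul (w l)).sub_const θ).add_const (n * (π / 2))
    refine (h1.cos.const_mul (a l * w l ^ n)).congr_deriv ?_
    rw [show w l * t - θ + ((n + 1 : ℕ) : ℝ) * (π / 2) =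
      (w l * t - θ + n * (π / 2)) + π / 2 by push_cast; ring, cos_add_pi_div_two]
    ring

lemma pderivList_replicate_coord_pow_mul (i : Fin N) (m : ℕ) {g : Euc N → ℝ}
    (hg : Differentiable ℝ g)
    (hgi : ∀ x (t : ℝ), g (x + t • EuclideanSpace.single i 1) = g x) (n : ℕ) :
    pderivList (List.replicate n i) (fun x : Euc N => x i ^ m * g x) =
      fun x => (m.descFactorial n : ℝ) * x i ^ (m - n) * g x := by
  induction n with
  | zero => simp [pderivList]
  | succ n ih =>
    rw [List.replicate_succ, pderivList, ih]
    funext x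
    have hg0 : fderiv ℝ g x (EuclideanSpace.single i 1) = 0 := by
      rw [← (hg x).lineDeriv_eq_fderiv, lineDeriv]
      simp [hgi]
    have h1 : HasFDerivAt (fun x : Euc N => x i) (EuclideanSpace.proj i : Euc N →L[ℝ] ℝ) x :=
      (EuclideanSpace.proj i : Euc N →L[ℝ] ℝ).hasFDerivAt
    have h2 := ((h1.pow (m - n)).const_mul (m.descFactorial n : ℝ)).mul (hg x).hasFDerivAt
    have h3 : fderiv ℝ (fun x : Euc N => (m.descFactorial n : ℝ) * x i ^ (m - n) * g x) x = _ :=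
      h2.fderiv
    rw [pderiv', h3]
    simp [hg0, Nat.descFactorial_succ, Nat.sub_sub]
    ring

end PartialDerivatives

/-- The product of the values of `h` at the first `q` coordinates of `x`. -/
def coordProd {N : ℕ} (q : ℕ) (h : ℝ → ℝ) (x : Euc N) : ℝ :=
  ∏ j : Fin N, if j.val < q then h (x j) else 1

/-- The `i`-th component of the elementary oscillation of frequency `2 ^ l`: its first `q`
components are plane waves, and component `q` carries the product of the waves. -/
def oscComp {N : ℕ} (m q : ℕ) (i : Fin N) (l : ℕ) (x : Euc N) : ℝ :=
  if i.val < q then cos (2 ^ l * x i - m * (π / 2))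
  else if i.val = q then x i ^ m * coordProd q (fun t => cos (2 ^ l * t)) x else 0

lemma hasFreqBound_oscComp {N : ℕ} (R : ℝ) (J m q : ℕ) (i : Fin N) :
    HasFreqBound R J (oscComp m q i) := by
  unfold oscComp
  by_cases h : i.val < q
  · simp only [h, if_true]
    exact HasFreqBound.cos_coord i _
  · by_cases h' : i.val = q
    · simp only [if_neg h, if_pos h']
      refine (HasFreqBound.const (g := fun x : Euc N => x i ^ m) (by fun_prop)).mul
        (HasFreqBound.finset_prod _ fun j _ => ?_)
      by_cases hj : j.val < q
      · simp only [hj, if_true]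
        simpa using HasFreqBound.cos_coord (R := R) (J := J) j 0
      · simp only [hj, if_false]
        exact HasFreqBound.const contDiff_const
    · simp only [h, h', if_false]
      exact HasFreqBound.const contDiff_const

lemma prod_fin_castLE {N q : ℕ} (hq : q ≤ N) (F : Fin N → ℝ) :
    ∏ k : Fin q, F (Fin.castLE hq k) = ∏ j : Fin N, if j.val < q then F j else 1 := by
  obtain ⟨d, rfl⟩ := Nat.exists_eq_add_of_le hq
  rw [Fin.prod_univ_add]
  simp
  rfl

lemma contDiff_coordProd {N : ℕ} (q : ℕ) {h : ℝ → ℝ} (hh : ContDiff ℝ (⊤ : ℕ∞) h) :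
    ContDiff ℝ (⊤ : ℕ∞) (coordProd (N := N) q h) := by
  refine contDiff_prod fun j _ => ?_
  split_ifs
  · exact hh.comp (EuclideanSpace.proj j : Euc N →L[ℝ] ℝ).contDiff
  · exact contDiff_const

/-- For lacunary sums of the elementary oscillations only the identity permutations contribute to
the Jacobian minor. -/
lemma jacMinor_lacunary {N m q : ℕ} (hq : q + 1 ≤ N) (K : ℕ) (a : ℕ → ℝ)
    (x : Euc N) :
    jacMinor m (q + 1) (Fin.castLE hq) (fun _ => Fin.castLE hq)
        (fun y i => ∑ l ∈ Finset.range K, a l * oscComp m q i l y) x =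
      coordProd q (fun t => ∑ l ∈ Finset.range K, a l * (2 ^ l) ^ m * cos (2 ^ l * t)) x *
        (m.factorial * ∑ l ∈ Finset.range K, a l * coordProd q (fun t => cos (2 ^ l * t)) x) := by
  set g : ℝ → ℝ := fun t => ∑ l ∈ Finset.range K, a l * cos (2 ^ l * t - m * (π / 2)) with hg
  have hgc : ContDiff ℝ (⊤ : ℕ∞) g := by fun_prop
  have hlow : ∀ (k : Fin q) (L : List (Fin N)),
      pderivList L (fun y : Euc N => ∑ l ∈ Finset.range K,
        a l * oscComp m q (Fin.castLE hq k.castSucc) l y) =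
      fun y => if ∀ j ∈ L, j = Fin.castLE hq k.castSucc then
        iteratedDeriv L.length g (y (Fin.castLE hq k.castSucc)) else 0 := by
    intro k L
    rw [← pderivList_coord _ hgc]
    congr 1
    funext y
    simp [hg, oscComp]
  have hgm : iteratedDeriv m g =
      fun t => ∑ l ∈ Finset.range K, a l * (2 ^ l) ^ m * cos (2 ^ l * t) := by
    rw [hg, iteratedDeriv_sum_cos]
    simp
  set P : Euc N → ℝ := fun y =>
    ∑ l ∈ Finset.range K, a l * coordProd q (fun t => cos (2 ^ l * t)) y with hP
  have hPc : ContDiff ℝ (⊤ : ℕ∞) P := ContDiff.sum fun l _ =>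
    contDiff_const.mul (contDiff_coordProd q (by fun_prop))
  have hlast : pderivList (List.replicate m (Fin.castLE hq (Fin.last q)))
      (fun y : Euc N => ∑ l ∈ Finset.range K,
        a l * oscComp m q (Fin.castLE hq (Fin.last q)) l y) =
      fun y => (m.factorial : ℝ) * P y := by
    have e : (fun y : Euc N => ∑ l ∈ Finset.range K,
        a l * oscComp m q (Fin.castLE hq (Fin.last q)) l y) =
        fun y => y (Fin.castLE hq (Fin.last q)) ^ m * P y := by
      funext y
      rw [hP, Finset.mul_sum]
      refine Finset.sum_congr rfl fun l _ => ?_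
      simp [oscComp]
      ring
    rw [e, pderivList_replicate_coord_pow_mul _ m (hPc.differentiable (by simp))]
    · simp [Nat.descFactorial_self]
    · intro y t
      refine Finset.sum_congr rfl fun l _ => ?_
      congr 1
      refine Finset.prod_congr rfl fun j _ => ?_
      split_ifs with hj
      · have : j ≠ Fin.castLE hq (Fin.last q) := fun h => by
          rw [h] at hj
          simp at hj
        simp [this]
      · rfl
  simp only [jacMinor, hyperDet, Fin.cons_zero, Fin.cons_succ]
  rw [Finset.sum_eq_single (fun _ => 1)]
  · simp only [Equiv.Perm.sign_one, Units.val_one, Int.cast_one, Finset.prod_const_one, one_mul,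
      Equiv.Perm.one_apply, List.ofFn_const]
    rw [Fin.prod_univ_castSucc, hlast]
    congr 1
    rw [coordProd, ← prod_fin_castLE (by omega : q ≤ N) fun j =>
      ∑ l ∈ Finset.range K, a l * (2 ^ l) ^ m * cos (2 ^ l * x j)]
    refine Finset.prod_congr rfl fun k _ => ?_
    rw [hlow]
    simp only [List.length_replicate, hgm]
    rw [if_pos fun j hj => List.eq_of_mem_replicate hj]
    rfl
  · intro τ _ hτ
    obtain ⟨k, s, hks⟩ : ∃ (k : Fin q) (s : Fin m), τ s k.castSucc ≠ k.castSucc := by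
      by_contra! h
      refine hτ (funext fun s => Equiv.ext fun k => ?_)
      induction k using Fin.lastCases with
      | cast k => exact h k s
      | last =>
        by_contra hne
        obtain ⟨j, hj⟩ := Fin.exists_castSucc_eq.2 hne
        have := (τ s).injective ((h j s).trans hj)
        exact (Fin.castSucc_lt_last j).ne this
    refine mul_eq_zero_of_right _ (Finset.prod_eq_zero (Finset.mem_univ k.castSucc) ?_)
    rw [hlow]
    refine if_neg fun h => hks ?_
    exact Fin.castLE_injective hq (h _ (List.mem_ofFn.2 ⟨s, rfl⟩))
  · simp

/-- The cutoff `x ↦ ∏ i, periodCutoff (x i)`. -/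
def boxCutoff {N : ℕ} (x : Euc N) : ℝ := ∏ i, periodCutoff (x i)

lemma boxCutoff_tsupport_subset {N : ℕ} :
    tsupport (boxCutoff (N := N)) ⊆ {x | ∀ i, |x i| < 8} := by
  have hcl : IsClosed {x : Euc N | ∀ i, x i ∈ Set.Icc (-(2 * π)) 1} := by
    simp only [Set.ofPred_forall]
    exact isClosed_iInter fun i => isClosed_Icc.preimage (EuclideanSpace.proj i).continuous
  refine (closure_minimal (fun x hx i => ?_) hcl).trans fun x hx i => ?_
  · exact Set.Ioc_subset_Icc_self
      (periodCutoff_support (Finset.prod_ne_zero_iff.1 hx i (Finset.mem_univ i)))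
  · have := hx i
    have hpi := pi_lt_four
    rw [abs_lt]
    constructor <;> linarith [this.1, this.2]

lemma isCinfc_boxCutoff {N : ℕ} {Ω : Set (Euc N)} (hΩ : Bornology.IsBounded Ω)
    (hbox : {x : Euc N | ∀ i, |x i| < 8} ⊆ Ω) : IsCinfc Ω (boxCutoff (N := N)) := by
  have hsub := (boxCutoff_tsupport_subset (N := N)).trans hbox
  refine ⟨contDiff_prod fun i _ =>
    contDiff_periodCutoff.comp (EuclideanSpace.proj i : Euc N →L[ℝ] ℝ).contDiff, ?_, hsub⟩
  exact Metric.isCompact_of_isClosed_isBounded (isClosed_tsupport _) (hΩ.subset hsub)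

lemma prod_ite_val_lt_const {N q : ℕ} (hq : q ≤ N) (a b : ℝ) :
    (∏ j : Fin N, if j.val < q then a else b) = a ^ q * b ^ (N - q) := by
  obtain ⟨d, rfl⟩ := Nat.exists_eq_add_of_le hq
  rw [Fin.prod_univ_add]
  simp

/-- Orthogonality of the frequencies: the minor of a lacunary sum, tested against the cutoff. -/
lemma integral_jacMinor_lacunary {N m q : ℕ} (hq : q + 1 ≤ N) {Ω : Set (Euc N)}
    (hbox : {x : Euc N | ∀ i, |x i| < 8} ⊆ Ω) (K : ℕ) (a : ℕ → ℝ) :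
    ∫ x in Ω, jacMinor m (q + 1) (Fin.castLE hq) (fun _ => Fin.castLE hq)
        (fun y i => ∑ l ∈ Finset.range K, a l * oscComp m q i l y) x * boxCutoff x =
      m.factorial * π ^ q * (2 * π) ^ (N - q) *
        ∑ l ∈ Finset.range K, a l * (a l * (2 ^ l) ^ m) ^ q := by
  set G : ℝ → ℝ := fun t => ∑ l ∈ Finset.range K, a l * (2 ^ l) ^ m * cos (2 ^ l * t) with hG
  have hGc : Continuous G := by fun_prop
  set Φ : ℕ → Fin N → ℝ → ℝ := fun l j t =>
    (if j.val < q then G t * cos (2 ^ l * t) else 1) * periodCutoff t with hΦ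
  have hΦi : ∀ l j, Integrable (Φ l j) := by
    intro l j
    refine integrable_mul_periodCutoff ?_
    split_ifs <;> fun_prop
  have hΦint : ∀ l ∈ Finset.range K, ∫ x : Euc N, ∏ j, Φ l j (x j) =
      (a l * (2 ^ l) ^ m) ^ q * (π ^ q * (2 * π) ^ (N - q)) := by
    intro l hl
    rw [integral_euc_prod]
    have : ∀ j : Fin N, ∫ t, Φ l j t =
        if j.val < q then a l * (2 ^ l) ^ m * π else 2 * π := by
      intro j
      by_cases hj : j.val < q
      · simp only [hΦ, if_pos hj]
        exact integral_lacunary_mul_cos (Finset.mem_range.1 hl) fun l => a l * (2 ^ l) ^ m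
      · simp only [hΦ, if_neg hj, one_mul]
        exact integral_periodCutoff
    simp_rw [this]
    rw [prod_ite_val_lt_const (by omega), mul_pow]
    ring
  have hpt : ∀ x : Euc N, jacMinor m (q + 1) (Fin.castLE hq) (fun _ => Fin.castLE hq)
        (fun y i => ∑ l ∈ Finset.range K, a l * oscComp m q i l y) x * boxCutoff x =
      m.factorial * ∑ l ∈ Finset.range K, a l * ∏ j, Φ l j (x j) := by
    intro x
    have e : ∀ l, ∏ j, Φ l j (x j) =
        coordProd q G x * coordProd q (fun t => cos (2 ^ l * t)) x * boxCutoff x := by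
      intro l
      rw [coordProd, coordProd, boxCutoff, ← Finset.prod_mul_distrib, ← Finset.prod_mul_distrib]
      refine Finset.prod_congr rfl fun j _ => ?_
      simp only [hΦ]
      split_ifs <;> simp
    rw [jacMinor_lacunary hq]
    simp_rw [e, Finset.mul_sum, Finset.sum_mul]
    refine Finset.sum_congr rfl fun l _ => ?_
    ring
  rw [setIntegral_eq_integral_of_forall_compl_eq_zero]
  · simp_rw [hpt]
    rw [integral_const_mul, integral_finsetSum _ fun l _ =>
      (integrable_euc_prod (hΦi l)).const_mul (a l)]
    simp_rw [integral_const_mul]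
    rw [Finset.sum_congr rfl fun l hl => by rw [hΦint l hl], Finset.mul_sum, Finset.mul_sum]
    refine Finset.sum_congr rfl fun l _ => ?_
    ring
  · intro x hx
    rw [image_eq_zero_of_notMem_tsupport fun h => hx (hbox (boxCutoff_tsupport_subset h)),
      mul_zero]

/-- Proposition 4.2: for `1 < r ≤ N`, `p > r` and `s = m - m/r` non-integer, there are
`u_k ∈ C^m(Ω̄, ℝ^N)` and `ψ ∈ C_c^∞(Ω)` with `‖u_k‖_{W^{s,p}} → 0` and
`∫_Ω M^{α'}_{α'}(D^m u_k) ψ → ∞`, where `α' = (1,…,r)`. -/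
theorem stmt10 (N m r : ℕ) (hN : 2 ≤ N) (hm : 1 ≤ m) (hr1 : 1 < r) (hrN : r ≤ N)
    (hni : ¬∃ k : ℕ, (m : ℝ) - (m : ℝ) / r = k)
    (Ω : Set (Euc N)) (hΩ : IsSmoothDomain Ω)
    (hbox : {x : Euc N | ∀ i, |x i| < 8} ⊆ Ω)
    (p : ℝ) (hp : (r : ℝ) < p) :
    ∃ (u : ℕ → Euc N → Fin N → ℝ) (ψ : Euc N → ℝ),
      (∀ k, ContDiffOn ℝ m (u k) (closure Ω)) ∧ IsCinfc Ω ψ ∧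
      Tendsto (fun k => sobNorm Ω ((m : ℝ) - (m : ℝ) / r) p (u k)) atTop (𝓝 0) ∧
      Tendsto
        (fun k => ∫ x in Ω,
          jacMinor m r (Fin.castLE hrN) (fun _ => Fin.castLE hrN) (u k) x * ψ x)
        atTop atTop := by

  obtain ⟨q, rfl⟩ : ∃ q, r = q + 1 := ⟨r - 1, by omega⟩
  set s : ℝ := (m : ℝ) - (m : ℝ) / (q + 1 : ℕ) with hs
  have hr0 : (0 : ℝ) < ((q + 1 : ℕ) : ℝ) := by positivity
  have hr1' : (1 : ℝ) < ((q + 1 : ℕ) : ℝ) := by exact_mod_cast hr1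
  have hs0 : 0 ≤ s := sub_nonneg.2 (div_le_self (by positivity) hr1'.le)
  have hp1 : 1 < p := hr1'.trans hp
  obtain ⟨hΩo, hΩb, -⟩ := hΩ
  obtain ⟨R, hR⟩ := hΩb.subset_ball 0
  obtain ⟨hf, C, hC0, hC⟩ := HasFreqBound.pi
    fun i : Fin N => hasFreqBound_oscComp R (⌊s⌋₊ + 1) m q i
  obtain ⟨A, hA⟩ := exists_sobNorm_lacunary_le (by omega) hΩo.measurableSet hR hs0 hni hp1.le
    hf hC0 hC
  set b : ℝ := 2 / (p + (q + 1 : ℕ)) with hb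
  set c : ℕ → ℝ := fun k => ((k + 1 : ℕ) : ℝ) ^ (-b) with hc
  set u : ℕ → Euc N → Fin N → ℝ := fun k x =>
    ∑ l ∈ Finset.range (k + 1), (c k * ((2 : ℝ) ^ l) ^ (-s)) • fun i => oscComp m q i l x with hu
  have hu' : ∀ k, u k = fun x i =>
      ∑ l ∈ Finset.range (k + 1), c k * ((2 : ℝ) ^ l) ^ (-s) * oscComp m q i l x := by
    intro k
    funext x i
    simp [hu, Finset.sum_apply]
  have hc0 : ∀ k, 0 ≤ c k := fun k => by positivity
  have hcast : Tendsto (fun k : ℕ => ((k + 1 : ℕ) : ℝ)) atTop atTop :=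
    tendsto_natCast_atTop_atTop.comp (tendsto_add_atTop_nat 1)
  refine ⟨u, boxCutoff, fun k => ?_, isCinfc_boxCutoff hΩb hbox, ?_, ?_⟩
  · have hcd : ∀ l, ContDiff ℝ m (fun x (i : Fin N) => oscComp m q i l x) := fun l =>
      (hf l).of_le (by exact_mod_cast le_top)
    exact (ContDiff.sum fun l _ => (hcd l).const_smul _).contDiffOn
  · have hexp : 0 < b - 1 / p := by
      rw [hb, div_sub_div _ _ (by positivity) (by positivity)]
      apply div_pos <;> nlinarith
    have hlim : Tendsto (fun k : ℕ => A * ((k + 1 : ℕ) : ℝ) ^ (-(b - 1 / p))) atTop (𝓝 0) := by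
      simpa using ((tendsto_rpow_neg_atTop hexp).comp hcast).const_mul A
    refine squeeze_zero (fun k => ?_) (fun k => ?_) hlim
    · rw [sobNorm, if_neg hni, intSobNorm]
      have h1 : ∀ v : Euc N → ℝ, (∀ x, 0 ≤ v x) → 0 ≤ (∫ x in Ω, v x) ^ (1 / p) :=
        fun v hv => rpow_nonneg (integral_nonneg hv) _
      exact add_nonneg (Finset.sum_nonneg fun j _ => h1 _ fun x => by positivity)
        (h1 _ fun x => integral_nonneg fun y => by positivity)
    · refine (hA (k + 1) (c k) (by omega) (hc0 k)).trans (le_of_eq ?_)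
      rw [hc]
      dsimp only
      rw [← rpow_add (by positivity)]
      congr 2
      ring
  · have hexp : 0 < 1 - b * (q + 1 : ℕ) := by
      rw [hb, div_mul_eq_mul_div, sub_pos, div_lt_one (by positivity)]
      linarith
    set κ : ℝ := m.factorial * π ^ q * (2 * π) ^ (N - q) with hκ
    have hκ0 : 0 < κ := by positivity
    refine (((tendsto_rpow_atTop hexp).comp hcast).const_mul_atTop hκ0).congr fun k => ?_
    rw [hu' k, integral_jacMinor_lacunary hrN hbox]
    have hterm : ∀ l : ℕ, c k * ((2 : ℝ) ^ l) ^ (-s) *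
        (c k * ((2 : ℝ) ^ l) ^ (-s) * (2 ^ l) ^ m) ^ q = c k ^ (q + 1) := by
      intro l
      have h2 : (0 : ℝ) < 2 ^ l := by positivity
      have h3 : ((2 : ℝ) ^ l) ^ (-s) * (((2 : ℝ) ^ l) ^ (-s) * (2 ^ l) ^ m) ^ q = 1 := by
        rw [← rpow_natCast ((2 : ℝ) ^ l) m, ← rpow_add h2, ← rpow_natCast _ q,
          ← rpow_mul h2.le, ← rpow_add h2]
        have : -s + (-s + m) * q = 0 := by
          rw [hs]
          push_cast
          field_simp
          ring
        rw [this, rpow_zero]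
      calc _ = c k ^ (q + 1) *
            (((2 : ℝ) ^ l) ^ (-s) * (((2 : ℝ) ^ l) ^ (-s) * (2 ^ l) ^ m) ^ q) := by ring
        _ = _ := by rw [h3, mul_one]
    simp_rw [hterm]
    rw [Finset.sum_const, Finset.card_range, nsmul_eq_mul, Function.comp_apply, hc]
    dsimp only
    rw [← rpow_natCast _ (q + 1), ← rpow_mul (by positivity), sub_eq_add_neg,
      rpow_add (by positivity), rpow_one, neg_mul]
end
end

section
/- Let N ≥ 2, n ≥ 1, m ≥ 1 and r be integers with 1 < r ≤ min{n,N}, let 1 < p ≤ r and s > 0 satisfy s + m/r < m + N/p − N/r, and let Ω ⊂ ℝ^N be a smooth bounded open set containing the closed unit ball B(0,1). Suppose there exist g ∈ C_c^∞(B(0,1), ℝ^n), β ∈ I(r,n) and 𝛂 = (α^1,…,α^m) with α^j ∈ I(r,N) such that ∫_{B(0,1)} M^β_𝛂(D^m g(x)) |x|^m dx ≠ 0. Then there exist a sequence {u_k} ⊂ C^m(Ω̄, ℝ^n) and a function ψ ∈ C_c^∞(Ω) such that ‖u_k‖_{W^{s,p}(Ω)} → 0 and ∫_Ω M^β_𝛂(D^m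 u_k) ψ dx → +∞ as k → ∞. -/
open MeasureTheory Filter Topology Real

noncomputable section

/-- The linear form `x ↦ ∑ i, ζ i * x i` on Euclidean space. -/
def linForm {N : ℕ} (ζ : Fin N → ℝ) : Euc N →L[ℝ] ℝ :=
  ∑ i, ζ i • (EuclideanSpace.proj i : Euc N →L[ℝ] ℝ)

lemma linForm_apply {N : ℕ} (ζ : Fin N → ℝ) (x : Euc N) : linForm ζ x = ∑ i, ζ i * x i := by
  simp [linForm]

lemma linForm_single {N : ℕ} (ζ : Fin N → ℝ) (i : Fin N) :
    linForm ζ (EuclideanSpace.single i 1) = ζ i := by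
  simp [linForm_apply]

lemma linForm_sum {N : ℕ} {ι : Type*} (t : Finset ι) (ζ : ι → Fin N → ℝ) (x : Euc N) :
    linForm (∑ k ∈ t, ζ k) x = ∑ k ∈ t, linForm (ζ k) x := by
  simp only [linForm_apply, Finset.sum_apply, Finset.sum_mul]
  exact Finset.sum_comm

lemma linForm_add {N : ℕ} (ζ ξ : Fin N → ℝ) (x : Euc N) :
    linForm (ζ + ξ) x = linForm ζ x + linForm ξ x := by
  simp [linForm_apply, add_mul, Finset.sum_add_distrib]

lemma linForm_smul {N : ℕ} (t : ℝ) (ζ : Fin N → ℝ) (x : Euc N) :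
    linForm (t • ζ) x = t * linForm ζ x := by
  simp [linForm_apply, Finset.mul_sum, mul_assoc]

lemma contDiff_pderiv' {N : ℕ} (i : Fin N) {f : Euc N → ℝ} (hf : ContDiff ℝ (⊤ : ℕ∞) f) :
    ContDiff ℝ (⊤ : ℕ∞) (pderiv' i f) :=
  (hf.fderiv_right (m := ((⊤ : ℕ∞) : WithTop ℕ∞)) (by simp)).clm_apply contDiff_const

lemma contDiff_pderivList {N : ℕ} (l : List (Fin N)) {f : Euc N → ℝ}
    (hf : ContDiff ℝ (⊤ : ℕ∞) f) : ContDiff ℝ (⊤ : ℕ∞) (pderivList l f) := by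
  induction l with
  | nil => exact hf
  | cons i l ih => exact contDiff_pderiv' i ih

lemma tsupport_pderivList_subset {N : ℕ} (l : List (Fin N)) (f : Euc N → ℝ) :
    tsupport (pderivList l f) ⊆ tsupport f := by
  induction l with
  | nil => exact subset_rfl
  | cons i l ih => exact (tsupport_fderiv_apply_subset ℝ _).trans ih

lemma hasCompactSupport_pderivList {N : ℕ} (l : List (Fin N)) {f : Euc N → ℝ}
    (hf : HasCompactSupport f) : HasCompactSupport (pderivList l f) :=
  hf.mono' ((subset_tsupport _).trans (tsupport_pderivList_subset l f))

lemma pderivList_congr {N : ℕ} (l : List (Fin N)) {f h : Euc N → ℝ} {x : Euc N}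
    (hfh : f =ᶠ[𝓝 x] h) : pderivList l f =ᶠ[𝓝 x] pderivList l h := by
  induction l with
  | nil => exact hfh
  | cons i l ih =>
    filter_upwards [ih.fderiv (𝕜 := ℝ)] with y hy
    simp only [pderivList, pderiv', hy]

lemma pderivList_exp {N : ℕ} (l : List (Fin N)) (ζ : Fin N → ℝ) :
    pderivList l (fun x => Real.exp (linForm ζ x)) =
      fun x => (l.map ζ).prod * Real.exp (linForm ζ x) := by
  induction l with
  | nil => simp [pderivList]
  | cons i l ih =>
    ext x
    have h : HasFDerivAt (fun x : Euc N => (l.map ζ).prod * Real.exp (linForm ζ x))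
        ((l.map ζ).prod • (Real.exp (linForm ζ x) • linForm ζ)) x :=
      ((linForm ζ).hasFDerivAt.exp).const_mul _
    simp only [pderivList, ih, pderiv', h.fderiv, List.map_cons, List.prod_cons]
    simp only [smul_apply, linForm_single, smul_eq_mul]
    ring

lemma pderivList_scale {N : ℕ} (l : List (Fin N)) {f : Euc N → ℝ} (a c : ℝ)
    (hf : ContDiff ℝ (⊤ : ℕ∞) f) :
    pderivList l (fun x => a * f (c • x)) =
      fun x => a * c ^ l.length * pderivList l f (c • x) := by
  induction l with
  | nil => simp [pderivList]
  | cons i l ih =>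
    ext x
    have hd : DifferentiableAt ℝ (pderivList l f) (c • x) :=
      (contDiff_pderivList l hf).differentiable (by simp) _
    have h2 : DifferentiableAt ℝ (fun y => pderivList l f (c • y)) x :=
      DifferentiableAt.comp x hd (differentiableAt_id.const_smul c)
    have := fderiv_const_mul h2 (a * c ^ l.length)
    simp only [pderivList, ih, pderiv', this, List.length_cons]
    rw [fderiv_comp_smul (𝕜 := ℝ)]
    simp only [smul_apply, smul_eq_mul]
    ring

/-- Repeated integration by parts against an exponential. -/
lemma integral_pderivList_mul_exp {N : ℕ} (l : List (Fin N)) {f : Euc N → ℝ}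
    (hf : ContDiff ℝ (⊤ : ℕ∞) f) (hc : HasCompactSupport f) (ζ : Fin N → ℝ) :
    ∫ x, pderivList l f x * Real.exp (linForm ζ x) =
      (-1) ^ l.length * (l.map ζ).prod * ∫ x, f x * Real.exp (linForm ζ x) := by
  induction l with
  | nil => simp [pderivList]
  | cons i l ih =>
    have hF := contDiff_pderivList l hf
    have hFc := hasCompactSupport_pderivList l hc
    have hE : Continuous fun x : Euc N => Real.exp (linForm ζ x) := by fun_prop
    have hE' : ∀ x : Euc N, HasFDerivAt (fun x : Euc N => Real.exp (linForm ζ x))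
        (Real.exp (linForm ζ x) • linForm ζ) x := fun x => (linForm ζ).hasFDerivAt.exp
    have hv : ∀ x : Euc N, fderiv ℝ (fun x : Euc N => Real.exp (linForm ζ x)) x
        (EuclideanSpace.single i 1) = ζ i * Real.exp (linForm ζ x) := by
      intro x
      rw [(hE' x).fderiv]
      simp only [smul_apply, linForm_single, smul_eq_mul]
      ring
    have h1 : Integrable fun x => pderivList (i :: l) f x * Real.exp (linForm ζ x) :=
      ((contDiff_pderivList (i :: l) hf).continuous.mul hE).integrable_of_hasCompactSupport
        (hasCompactSupport_pderivList (i :: l) hc).mul_right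
    have h2 : Integrable fun x => pderivList l f x * Real.exp (linForm ζ x) :=
      (hF.continuous.mul hE).integrable_of_hasCompactSupport hFc.mul_right
    have h3 : Integrable fun x => pderivList l f x * fderiv ℝ
        (fun x : Euc N => Real.exp (linForm ζ x)) x (EuclideanSpace.single i 1) := by
      simp only [hv]
      exact (hF.continuous.mul (continuous_const.mul hE)).integrable_of_hasCompactSupport
        hFc.mul_right
    have key := integral_mul_fderiv_eq_neg_fderiv_mul_of_integrable
      (f := pderivList l f) (v := EuclideanSpace.single i 1) h1 h3 h2
      (fun x _ => hF.differentiable (by simp) x) (fun x _ => (hE' x).differentiableAt)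
    have key' : ∫ x, pderivList (i :: l) f x * Real.exp (linForm ζ x) =
        -∫ x, pderivList l f x * (ζ i * Real.exp (linForm ζ x)) := by
      simp only [← hv, key, neg_neg]
      rfl
    have : (fun x => pderivList l f x * (ζ i * Real.exp (linForm ζ x))) =
        fun x => ζ i * (pderivList l f x * Real.exp (linForm ζ x)) := by
      ext x; ring
    rw [key', this, integral_const_mul, ih]
    simp only [List.length_cons, List.map_cons, List.prod_cons]
    ring

/-- The map whose component `β k₀` is `φ`, whose components `β k`, `k ≠ k₀`, are the truncated
exponentials `χ x * exp (ξ k ⬝ x)`, and whose other components vanish. -/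
def expMap {N n r : ℕ} (β : Fin r → Fin n) (ξ : Fin r → Fin N → ℝ) (k₀ : Fin r)
    (φ χ : Euc N → ℝ) (x : Euc N) : Fin n → ℝ :=
  Function.extend β
    (fun k => if k = k₀ then φ x else χ x * Real.exp (linForm (ξ k) x)) 0

section ExpMap

variable {N n m r : ℕ} {β : Fin r → Fin n} {ξ : Fin r → Fin N → ℝ} {k₀ : Fin r}
  {φ χ : Euc N → ℝ}

lemma expMap_apply (hβ : Function.Injective β) (k : Fin r) (x : Euc N) :
    expMap β ξ k₀ φ χ x (β k) =
      if k = k₀ then φ x else χ x * Real.exp (linForm (ξ k) x) :=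
  hβ.extend_apply _ _ k

lemma contDiff_expMap (hβ : Function.Injective β) (hφ : ContDiff ℝ (⊤ : ℕ∞) φ)
    (hχ : ContDiff ℝ (⊤ : ℕ∞) χ) : ContDiff ℝ (⊤ : ℕ∞) (expMap β ξ k₀ φ χ) := by
  refine contDiff_pi.2 fun b => ?_
  by_cases hb : ∃ k, β k = b
  · obtain ⟨k, rfl⟩ := hb
    simp only [expMap_apply hβ]
    split_ifs
    · exact hφ
    · exact hχ.mul (linForm (ξ k)).contDiff.exp
  · have : ∀ x, expMap β ξ k₀ φ χ x b = 0 := fun x => Function.extend_apply' _ _ _ hb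
    simp only [this]
    exact contDiff_const

lemma expMap_eq_zero {x : Euc N} (hφ : φ x = 0) (hχ : χ x = 0) : expMap β ξ k₀ φ χ x = 0 := by
  ext b
  by_cases hb : ∃ k, β k = b
  · obtain ⟨k, rfl⟩ := hb
    by_cases hβ : Function.FactorsThrough
        (fun k => if k = k₀ then φ x else χ x * Real.exp (linForm (ξ k) x)) β
    · rw [expMap, hβ.extend_apply]
      simp [hφ, hχ]
    · exact absurd (fun k l _ => by simp [hφ, hχ]) hβ
  · exact Function.extend_apply' _ _ _ hb

lemma jacMinor_expMap (hβ : Function.Injective β) (α : Fin m → Fin r → Fin N)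
    (hχ : ∀ x ∈ tsupport φ, χ =ᶠ[𝓝 x] 1) (x : Euc N) :
    jacMinor m r β α (expMap β ξ k₀ φ χ) x =
      ∑ τ : Fin m → Equiv.Perm (Fin r),
        (∏ s, ((Equiv.Perm.sign (τ s) : ℤ) : ℝ)) *
          ((∏ k ∈ Finset.univ.erase k₀, ∏ s, ξ k (α s (τ s k))) *
            (pderivList (List.ofFn fun s => α s (τ s k₀)) φ x *
              Real.exp (linForm (∑ k ∈ Finset.univ.erase k₀, ξ k) x))) := by
  unfold jacMinor hyperDet
  refine Finset.sum_congr rfl fun τ _ => ?_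
  congr 1
  simp only [Fin.cons_zero, Fin.cons_succ, expMap_apply hβ]
  rw [← Finset.mul_prod_erase _ _ (Finset.mem_univ k₀)]
  simp only [if_true]
  by_cases hx : x ∈ tsupport φ
  · have hk : ∀ k ∈ Finset.univ.erase k₀,
        pderivList (List.ofFn fun s => α s (τ s k))
          (fun y => if k = k₀ then φ y else χ y * Real.exp (linForm (ξ k) y)) x =
        (∏ s, ξ k (α s (τ s k))) * Real.exp (linForm (ξ k) x) := by
      intro k hk
      simp only [if_neg (Finset.ne_of_mem_erase hk)]
      have h : (fun y => χ y * Real.exp (linForm (ξ k) y)) =ᶠ[𝓝 x]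
          fun y => Real.exp (linForm (ξ k) y) := by
        filter_upwards [hχ x hx] with y hy
        simp [hy]
      rw [(pderivList_congr _ h).eq_of_nhds, pderivList_exp]
      simp [List.map_ofFn, List.prod_ofFn]
    rw [Finset.prod_congr rfl hk, Finset.prod_mul_distrib, linForm_sum, Real.exp_sum]
    change pderivList _ φ x * _ = _
    ring
  · have : pderivList (List.ofFn fun s => α s (τ s k₀)) φ x = 0 :=
      image_eq_zero_of_notMem_tsupport fun h => hx (tsupport_pderivList_subset _ _ h)
    change pderivList _ φ x * _ = _
    simp [this]

/-- The exponential moments of the Jacobian minor of `expMap`. -/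
lemma integral_jacMinor_expMap (hβ : Function.Injective β)
    (α : Fin m → Fin r → Fin N) (hφ : ContDiff ℝ (⊤ : ℕ∞) φ) (hφc : HasCompactSupport φ)
    (hχ : ∀ x ∈ tsupport φ, χ =ᶠ[𝓝 x] 1) (t : ℝ) :
    ∫ x, jacMinor m r β α (expMap β ξ k₀ φ χ) x * Real.exp (t * linForm (ξ k₀) x) =
      (-t) ^ m * (∏ s, (Matrix.of fun k l => ξ k (α s l)).det) *
        ∫ x, φ x * Real.exp (linForm (∑ k ∈ Finset.univ.erase k₀, ξ k + t • ξ k₀) x) := by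
  set σ := ∑ k ∈ Finset.univ.erase k₀, ξ k with hσ
  set ζ := σ + t • ξ k₀ with hζ
  have h1 : ∀ x, jacMinor m r β α (expMap β ξ k₀ φ χ) x * Real.exp (t * linForm (ξ k₀) x) =
      ∑ τ : Fin m → Equiv.Perm (Fin r),
        ((∏ s, ((Equiv.Perm.sign (τ s) : ℤ) : ℝ)) *
          (∏ k ∈ Finset.univ.erase k₀, ∏ s, ξ k (α s (τ s k)))) *
            (pderivList (List.ofFn fun s => α s (τ s k₀)) φ x * Real.exp (linForm ζ x)) := by
    intro x
    rw [jacMinor_expMap hβ α hχ, Finset.sum_mul]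
    refine Finset.sum_congr rfl fun τ _ => ?_
    rw [hζ, linForm_add, linForm_smul, Real.exp_add]
    ring
  have hint : ∀ l : List (Fin N), Integrable fun x =>
      pderivList l φ x * Real.exp (linForm ζ x) := fun l =>
    ((contDiff_pderivList l hφ).continuous.mul
      (by fun_prop)).integrable_of_hasCompactSupport
        (hasCompactSupport_pderivList l hφc).mul_right
  have hdet : ∀ s, ∑ υ : Equiv.Perm (Fin r), ((Equiv.Perm.sign υ : ℤ) : ℝ) *
      ((∏ k ∈ Finset.univ.erase k₀, ξ k (α s (υ k))) * ζ (α s (υ k₀))) =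
      t * (Matrix.of fun k l => ξ k (α s l)).det := by
    intro s
    set A : Matrix (Fin r) (Fin r) ℝ := Matrix.of fun k l => ξ k (α s l) with hA
    have hrow : (∑ k, (if k = k₀ then t else 1 : ℝ) • A k) = fun l => ζ (α s l) := by
      ext l
      rw [← Finset.add_sum_erase _ _ (Finset.mem_univ k₀),
        Finset.sum_congr rfl (g := fun k => A k)
          (fun k hk => by simp [Finset.ne_of_mem_erase hk])]
      have h : (∑ k ∈ Finset.univ.erase k₀, A k) l = ∑ k ∈ Finset.univ.erase k₀, ξ k (α s l) :=
        Finset.sum_apply _ _ _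
      rw [Pi.add_apply, h]
      simp [hζ, hσ, hA, add_comm]
    have hd := A.det_updateRow_sum k₀ (fun k => if k = k₀ then t else 1)
    rw [hrow, if_pos rfl, smul_eq_mul] at hd
    rw [← hd, ← Matrix.det_transpose, Matrix.det_apply]
    refine Finset.sum_congr rfl fun υ _ => ?_
    rw [← Finset.mul_prod_erase _ _ (Finset.mem_univ k₀)]
    have : ∀ k ∈ Finset.univ.erase k₀,
        (A.updateRow k₀ fun l => ζ (α s l)).transpose (υ k) k = ξ k (α s (υ k)) := by
      intro k hk
      simp [Matrix.updateRow_ne (Finset.ne_of_mem_erase hk), hA]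
    rw [Finset.prod_congr rfl this]
    simp [Units.smul_def, mul_comm]
  simp only [h1]
  rw [integral_finsetSum _ fun τ _ => (hint _).const_mul _]
  simp only [integral_const_mul, integral_pderivList_mul_exp _ hφ hφc, List.length_ofFn]
  have h2 : ∀ τ : Fin m → Equiv.Perm (Fin r),
      ((∏ s, ((Equiv.Perm.sign (τ s) : ℤ) : ℝ)) *
          (∏ k ∈ Finset.univ.erase k₀, ∏ s, ξ k (α s (τ s k)))) *
        ((-1) ^ m * ((List.ofFn fun s => α s (τ s k₀)).map ζ).prod *
          ∫ x, φ x * Real.exp (linForm ζ x)) =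
      (∏ s, ((Equiv.Perm.sign (τ s) : ℤ) : ℝ) *
      ((∏ k ∈ Finset.univ.erase k₀, ξ k (α s (τ s k))) * ζ (α s (τ s k₀)))) *
        ((-1) ^ m * ∫ x, φ x * Real.exp (linForm ζ x)) := by
    intro τ
    rw [Finset.prod_comm]
    simp only [List.map_ofFn, List.prod_ofFn, Function.comp_apply, Finset.prod_mul_distrib]
    ring
  simp only [h2]
  rw [← Finset.sum_mul]
  have h3 := Finset.prod_univ_sum (fun _ : Fin m => (Finset.univ : Finset (Equiv.Perm (Fin r))))
    (fun s υ => ((Equiv.Perm.sign υ : ℤ) : ℝ) *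
      ((∏ k ∈ Finset.univ.erase k₀, ξ k (α s (υ k))) * ζ (α s (υ k₀))))
  rw [Fintype.piFinset_univ] at h3
  rw [← h3]
  simp only [hdet, Finset.prod_mul_distrib, Finset.prod_const, Finset.card_univ, Fintype.card_fin]
  rw [neg_pow t]
  ring

end ExpMap

lemma contDiff_jacMinor {N n m r : ℕ} (β : Fin r → Fin n) (α : Fin m → Fin r → Fin N)
    {g : Euc N → Fin n → ℝ} (hg : ContDiff ℝ (⊤ : ℕ∞) g) :
    ContDiff ℝ (⊤ : ℕ∞) (jacMinor m r β α g) := by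
  unfold jacMinor hyperDet
  refine ContDiff.sum fun τ _ => contDiff_const.mul ?_
  refine contDiff_prod fun k _ => contDiff_pderivList _ ?_
  exact contDiff_pi.1 hg _

lemma jacMinor_eq_zero {N n m r : ℕ} (hr : 0 < r) (β : Fin r → Fin n)
    (α : Fin m → Fin r → Fin N) {g : Euc N → Fin n → ℝ} {x : Euc N} (hx : x ∉ tsupport g) :
    jacMinor m r β α g x = 0 := by
  unfold jacMinor hyperDet
  refine Finset.sum_eq_zero fun τ _ => mul_eq_zero_of_right _ ?_
  refine Finset.prod_eq_zero (Finset.mem_univ (⟨0, hr⟩ : Fin r)) ?_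
  refine image_eq_zero_of_notMem_tsupport fun h => hx ?_
  refine closure_mono ?_ (tsupport_pderivList_subset _ _ h)
  intro y hy hgy
  exact hy (by simp [hgy])

lemma jacMinor_scale {N n m r : ℕ} (β : Fin r → Fin n) (α : Fin m → Fin r → Fin N)
    {g : Euc N → Fin n → ℝ} (hg : ContDiff ℝ (⊤ : ℕ∞) g) (a c : ℝ) (x : Euc N) :
    jacMinor m r β α (fun y => a • g (c • y)) x =
      (a * c ^ m) ^ r * jacMinor m r β α g (c • x) := by
  unfold jacMinor hyperDet
  rw [Finset.mul_sum]
  refine Finset.sum_congr rfl fun τ _ => ?_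
  have : ∀ k : Fin r, ∀ l : List (Fin N), pderivList l (fun y => (a • g (c • y)) (β k)) x =
      a * c ^ l.length * pderivList l (fun y => g y (β k)) (c • x) := by
    intro k l
    exact congrFun (pderivList_scale l a c (contDiff_pi.1 hg (β k))) x
  simp only [this, List.length_ofFn, Finset.prod_mul_distrib, Finset.prod_const,
    Finset.card_univ, Fintype.card_fin, Fin.cons_zero]
  ring

/-- If the moments of order at most `m` of `J` along `ℓ` vanish, then the exponential moment
of parameter `t` is `O(t ^ (m + 1))`. -/
lemma exists_abs_integral_mul_exp_le {N : ℕ} (m : ℕ) {J : Euc N → ℝ} (hJ : Continuous J)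
    (hJ0 : ∀ x, 1 < ‖x‖ → J x = 0) (ℓ : Euc N →L[ℝ] ℝ)
    (h0 : ∀ j ≤ m, ∫ x, J x * ℓ x ^ j = 0) :
    ∃ C : ℝ, 0 ≤ C ∧ ∃ δ > 0, ∀ t, 0 < t → t ≤ δ →
      |∫ x, J x * Real.exp (t * ℓ x)| ≤ C * t ^ (m + 1) := by
  have hJc : HasCompactSupport J := by
    refine HasCompactSupport.intro (isCompact_closedBall (0 : Euc N) 1) fun x hx => hJ0 x ?_
    simpa using hx
  have hint : ∀ f : Euc N → ℝ, Continuous f → Integrable fun x => J x * f x := fun f hf =>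
    (hJ.mul hf).integrable_of_hasCompactSupport hJc.mul_right
  set A := ‖ℓ‖ + 1 with hA
  have hA0 : 0 < A := by positivity
  set c : ℝ := ((m + 1).succ / (((m + 1).factorial : ℝ) * ((m + 1 : ℕ) : ℝ))) with hc
  have hc0 : 0 ≤ c := by positivity
  refine ⟨(∫ x, |J x|) * (A ^ (m + 1) * c), ?_, A⁻¹, by positivity, fun t ht htA => ?_⟩
  · exact mul_nonneg (integral_nonneg fun x => abs_nonneg _) (by positivity)
  have htA' : t * A ≤ 1 := by
    calc t * A ≤ A⁻¹ * A := by gcongr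
      _ = 1 := inv_mul_cancel₀ hA0.ne'
  have hsum : ∫ x, J x * ∑ j ∈ Finset.range (m + 1), (t * ℓ x) ^ j / (j.factorial : ℝ) = 0 := by
    have : ∀ x, J x * ∑ j ∈ Finset.range (m + 1), (t * ℓ x) ^ j / (j.factorial : ℝ) =
        ∑ j ∈ Finset.range (m + 1), (t ^ j / (j.factorial : ℝ)) * (J x * ℓ x ^ j) := by
      intro x
      rw [Finset.mul_sum]
      refine Finset.sum_congr rfl fun j _ => ?_
      rw [mul_pow]; ring
    simp only [this]
    rw [integral_finsetSum _ fun j _ => (hint _ (by fun_prop)).const_mul _]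
    refine Finset.sum_eq_zero fun j hj => ?_
    rw [integral_const_mul, h0 j (by simpa [Nat.lt_succ_iff] using hj), mul_zero]
  have hdiff : ∫ x, J x * Real.exp (t * ℓ x) = ∫ x, J x * (Real.exp (t * ℓ x) -
      ∑ j ∈ Finset.range (m + 1), (t * ℓ x) ^ j / (j.factorial : ℝ)) := by
    simp only [mul_sub]
    rw [integral_sub (hint _ (by fun_prop)) (hint _ (by fun_prop)), hsum, sub_zero]
  rw [hdiff]
  have hbound : ∀ x, |J x * (Real.exp (t * ℓ x) -
      ∑ j ∈ Finset.range (m + 1), (t * ℓ x) ^ j / (j.factorial : ℝ))| ≤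
      |J x| * ((t * A) ^ (m + 1) * c) := by
    intro x
    rcases lt_or_ge 1 ‖x‖ with hx | hx
    · simp [hJ0 x hx]
    rw [abs_mul]
    have h1 : |t * ℓ x| ≤ t * A := by
      rw [abs_mul, abs_of_pos ht]
      gcongr
      calc |ℓ x| ≤ ‖ℓ‖ * ‖x‖ := ℓ.le_opNorm x
        _ ≤ ‖ℓ‖ * 1 := by gcongr
        _ ≤ A := by simp [hA]
    gcongr
    refine (Real.exp_bound (h1.trans htA') (Nat.succ_pos m)).trans ?_
    gcongr
  calc _ ≤ ∫ x, |J x| * ((t * A) ^ (m + 1) * c) := by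
        rw [← Real.norm_eq_abs]
        exact norm_integral_le_of_norm_le
          ((hJ.abs.integrable_of_hasCompactSupport hJc.abs).mul_const _)
          (Eventually.of_forall hbound)
    _ = (∫ x, |J x|) * (A ^ (m + 1) * c) * t ^ (m + 1) := by
        rw [integral_mul_const, mul_pow]; ring

/-- There is a test map some moment of order at most `m` of whose Jacobian minor is nonzero. -/
lemma exists_moment_ne_zero {N n m r : ℕ} (hr : 0 < r) {β : Fin r → Fin n}
    (hβ : Function.Injective β) {α : Fin m → Fin r → Fin N}
    (hα : ∀ s, Function.Injective (α s)) :
    ∃ g : Euc N → Fin n → ℝ, ContDiff ℝ (⊤ : ℕ∞) g ∧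
      tsupport g ⊆ Metric.closedBall 0 (1 / 2) ∧
      ∃ (ℓ : Euc N →L[ℝ] ℝ) (j : ℕ), j ≤ m ∧ ∫ x, jacMinor m r β α g x * ℓ x ^ j ≠ 0 := by
  let χ : ContDiffBump (0 : Euc N) := ⟨1 / 4, 1 / 2, by norm_num, by norm_num⟩
  let φ : ContDiffBump (0 : Euc N) := ⟨1 / 16, 1 / 8, by norm_num, by norm_num⟩
  let k₀ : Fin r := ⟨0, hr⟩
  let ξ : Fin r → Fin N → ℝ := fun k i => (i : ℝ) ^ (k : ℕ)
  have hφ0 : ∀ x : Euc N, 1 / 8 ≤ ‖x‖ → φ x = 0 := fun x hx =>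
    φ.zero_of_le_dist (by rwa [dist_zero_right])
  have hχ0 : ∀ x : Euc N, 1 / 2 ≤ ‖x‖ → χ x = 0 := fun x hx =>
    χ.zero_of_le_dist (by rwa [dist_zero_right])
  have hχ1 : ∀ x ∈ tsupport φ, (χ : Euc N → ℝ) =ᶠ[𝓝 x] 1 := by
    intro x hx
    rw [φ.tsupport_eq] at hx
    refine χ.eventuallyEq_one_of_mem_ball ?_
    exact Metric.closedBall_subset_ball (by change (1 / 8 : ℝ) < 1 / 4; norm_num) hx
  have hφs := φ.contDiff (n := (⊤ : ℕ∞))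
  set g := expMap β ξ k₀ φ χ with hg
  have hgs : ContDiff ℝ (⊤ : ℕ∞) g := contDiff_expMap hβ hφs χ.contDiff
  have hsupp : tsupport g ⊆ Metric.closedBall 0 (1 / 2) := by
    refine closure_minimal (fun x hx => ?_) Metric.isClosed_closedBall
    by_contra hx'
    have hx'' : 1 / 2 < ‖x‖ := by simpa using hx'
    exact hx (expMap_eq_zero (hφ0 x (by linarith)) (hχ0 x hx''.le))
  refine ⟨g, hgs, hsupp, linForm (ξ k₀), ?_⟩
  by_contra! hcon
  obtain ⟨C, hC, δ, hδ, hle⟩ := exists_abs_integral_mul_exp_le m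
    (contDiff_jacMinor β α hgs).continuous (fun x hx => jacMinor_eq_zero hr β α fun h => by
      have := hsupp h
      simp only [Metric.mem_closedBall, dist_zero_right] at this
      linarith) (linForm (ξ k₀)) hcon
  set V := ∏ s, (Matrix.of fun k l => ξ k (α s l)).det with hV
  have hV0 : V ≠ 0 := by
    refine Finset.prod_ne_zero_iff.2 fun s _ => ?_
    have : (Matrix.of fun k l => ξ k (α s l)) =
        (Matrix.vandermonde fun l => ((α s l : ℕ) : ℝ)).transpose := by
      ext k l
      simp [ξ, Matrix.vandermonde]
    rw [this, Matrix.det_transpose, Matrix.det_vandermonde_ne_zero_iff]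
    exact Nat.cast_injective.comp (Fin.val_injective.comp (hα s))
  set σ := ∑ k ∈ Finset.univ.erase k₀, ξ k with hσ
  set B := ‖linForm σ‖ + ‖linForm (ξ k₀)‖ with hB
  have hB0 : 0 ≤ B := by positivity
  set E := Real.exp (-B) * ∫ x, φ x with hE
  have hφint : Integrable fun x => φ x := φ.continuous.integrable_of_hasCompactSupport
    φ.hasCompactSupport
  have hE0 : 0 < E := mul_pos (Real.exp_pos _) φ.integral_pos
  have hlow : ∀ t : ℝ, 0 < t → t ≤ 1 → E ≤ ∫ x, φ x * Real.exp (linForm (σ + t • ξ k₀) x) := by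
    intro t ht ht1
    rw [hE, mul_comm, ← integral_mul_const]
    refine integral_mono (hφint.mul_const _) ((φ.continuous.mul
      (by fun_prop)).integrable_of_hasCompactSupport φ.hasCompactSupport.mul_right) fun x => ?_
    rcases le_or_gt (1 / 8) ‖x‖ with hx | hx
    · simp [hφ0 x hx]
    refine mul_le_mul_of_nonneg_left (Real.exp_le_exp.2 ?_) φ.nonneg
    have h1 := (abs_le.1 ((linForm σ).le_opNorm x)).1
    have h2 := (abs_le.1 ((linForm (ξ k₀)).le_opNorm x)).1
    rw [linForm_add, linForm_smul]
    have h3 : ‖linForm σ‖ * ‖x‖ ≤ ‖linForm σ‖ * 1 := by gcongr; linarith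
    have h4 : ‖linForm (ξ k₀)‖ * ‖x‖ ≤ ‖linForm (ξ k₀)‖ * 1 := by gcongr; linarith
    have h5 : t * (-‖linForm (ξ k₀)‖) ≤ t * linForm (ξ k₀) x := by gcongr; linarith
    nlinarith [norm_nonneg (linForm (ξ k₀))]
  have hmain : ∀ t : ℝ, 0 < t → t ≤ δ → t ≤ 1 → |V| * E ≤ C * t := by
    intro t ht htδ ht1
    have h := hle t ht htδ
    rw [hg, integral_jacMinor_expMap hβ α hφs φ.hasCompactSupport hχ1, abs_mul, abs_mul,
      abs_pow, abs_neg, abs_of_pos ht, pow_succ] at h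
    have h6 := (hlow t ht ht1).trans (le_abs_self _)
    have h7 : t ^ m * (|V| * E) ≤ t ^ m * (C * t) := by
      calc t ^ m * (|V| * E) = t ^ m * |V| * E := by ring
        _ ≤ _ := mul_le_mul_of_nonneg_left h6 (by positivity)
        _ ≤ _ := h
        _ = _ := by ring
    exact le_of_mul_le_mul_left h7 (by positivity)
  have hVE : 0 < |V| * E := mul_pos (abs_pos.2 hV0) hE0
  set t := min (min δ 1) (|V| * E / (2 * (C + 1))) with ht
  have ht0 : 0 < t := by positivity
  have h8 := hmain t ht0 ((min_le_left _ _).trans (min_le_left _ _))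
    ((min_le_left _ _).trans (min_le_right _ _))
  have h9 : t ≤ |V| * E / (2 * (C + 1)) := min_le_right _ _
  rw [le_div_iff₀ (by positivity)] at h9
  nlinarith

lemma lintegral_comp_smul_euc {N : ℕ} (f : Euc N → ENNReal) {c : ℝ} (hc : 0 < c) :
    ∫⁻ x, f (c • x) = ENNReal.ofReal ((c ^ N)⁻¹) * ∫⁻ x, f x := by
  have h := (Homeomorph.smulOfNeZero (α := Euc N) c hc.ne').measurableEmbedding.lintegral_map
    (μ := volume) f
  change ∫⁻ a, f a ∂(Measure.map (c • ·) volume) = ∫⁻ a, f (c • a) at h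
  rw [← h, Measure.map_addHaar_smul _ hc.ne', lintegral_smul_measure, finrank_euclideanSpace_fin,
    abs_of_pos (by positivity), smul_eq_mul]

lemma integrable_min_norm_rpow_div {N : ℕ} (hN : 0 < N) {p θ : ℝ} (hp : 0 < p) (hθ0 : 0 < θ)
    (hθ1 : θ < 1) :
    Integrable fun z : Euc N => (min ‖z‖ 1) ^ p / ‖z‖ ^ ((N : ℝ) + θ * p) := by
  have : Nonempty (Fin N) := ⟨⟨0, hN⟩⟩
  have : Nontrivial (Euc N) := inferInstance
  rw [integrable_fun_norm_addHaar volume (f := fun y : ℝ => (min y 1) ^ p / y ^ ((N : ℝ) + θ * p)),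
    finrank_euclideanSpace_fin, ← Set.Ioc_union_Ioi_eq_Ioi (zero_le_one' ℝ)]
  have hpow : ∀ y : ℝ, 0 < y → y ^ (N - 1) = y ^ ((N : ℝ) - 1) := by
    intro y hy
    rw [← Real.rpow_natCast, Nat.cast_sub hN, Nat.cast_one]
  refine IntegrableOn.union ?_ ?_
  · have h : IntegrableOn (fun y : ℝ => y ^ (p - 1 - θ * p)) (Set.Ioc 0 1) := by
      rw [← intervalIntegrable_iff_integrableOn_Ioc_of_le zero_le_one]
      exact intervalIntegral.intervalIntegrable_rpow' (by nlinarith)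
    refine h.congr_fun (fun y hy => ?_) measurableSet_Ioc
    simp only [smul_eq_mul]
    rw [min_eq_left hy.2, hpow y hy.1, ← Real.rpow_sub hy.1, ← Real.rpow_add hy.1]
    congr 1
    ring
  · have h : IntegrableOn (fun y : ℝ => y ^ (-1 - θ * p)) (Set.Ioi 1) :=
      integrableOn_Ioi_rpow_of_lt (by nlinarith) one_pos
    refine h.congr_fun (fun y hy => ?_) measurableSet_Ioi
    have hy0 : 0 < y := one_pos.trans hy
    simp only [smul_eq_mul]
    rw [min_eq_right (le_of_lt hy), hpow y hy0, Real.one_rpow, one_div, ← Real.rpow_neg hy0.le,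
      ← Real.rpow_add hy0]
    congr 1
    ring

/-- The Gagliardo seminorm of a compactly supported Lipschitz function is finite. -/
lemma lintegral_gagliardo_lt_top {N : ℕ} (hN : 0 < N) {W : Type*} [NormedAddCommGroup W]
    {p θ : ℝ} (hp : 0 < p) (hθ0 : 0 < θ) (hθ1 : θ < 1) {G : Euc N → W} {K : NNReal}
    (hK : LipschitzWith K G) {A : ℝ} (hA : ∀ x, ‖G x‖ ≤ A) (h0 : ∀ x, 1 < ‖x‖ → G x = 0) :
    ∫⁻ x, ∫⁻ y, ‖‖G x - G y‖ ^ p / ‖x - y‖ ^ ((N : ℝ) + θ * p)‖ₑ < ⊤ := by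
  set M : ℝ := max K (2 * A) with hM
  have hM0 : 0 ≤ M := K.2.trans (le_max_left _ _)
  set F : Euc N → ENNReal := fun z =>
    ‖M ^ p * ((min ‖z‖ 1) ^ p / ‖z‖ ^ ((N : ℝ) + θ * p))‖ₑ with hF
  have hFint := (integrable_min_norm_rpow_div hN hp hθ0 hθ1).const_mul (M ^ p)
  have hFfin : ∫⁻ z, F z < ⊤ := hFint.2
  have hFm : Measurable F := by
    simp only [hF]
    fun_prop
  set B : Set (Euc N) := Metric.closedBall 0 1 with hB
  have hBm : MeasurableSet B := measurableSet_closedBall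
  have hpt : ∀ x y, ‖‖G x - G y‖ ^ p / ‖x - y‖ ^ ((N : ℝ) + θ * p)‖ₑ ≤ F (x - y) := by
    intro x y
    have h1 : ‖G x - G y‖ ≤ M * min ‖x - y‖ 1 := by
      rcases le_total ‖x - y‖ 1 with h | h
      · rw [min_eq_left h]
        exact (hK.norm_sub_le x y).trans (by gcongr; exact le_max_left _ _)
      · rw [min_eq_right h, mul_one]
        calc ‖G x - G y‖ ≤ ‖G x‖ + ‖G y‖ := norm_sub_le _ _
          _ ≤ 2 * A := by linarith [hA x, hA y]
          _ ≤ M := le_max_right _ _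
    have h2 : ‖G x - G y‖ ^ p ≤ M ^ p * (min ‖x - y‖ 1) ^ p := by
      rw [← Real.mul_rpow hM0 (by positivity)]
      gcongr
    simp only [hF]
    rw [Real.enorm_of_nonneg (by positivity), Real.enorm_of_nonneg (by positivity),
      ← mul_div_assoc]
    gcongr
  have hpt' : ∀ x y, ‖‖G x - G y‖ ^ p / ‖x - y‖ ^ ((N : ℝ) + θ * p)‖ₑ ≤
      B.indicator 1 x * F (x - y) + B.indicator 1 y * F (x - y) := by
    intro x y
    by_cases hx : x ∈ B
    · refine (hpt x y).trans ?_
      simp [hx]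
    by_cases hy : y ∈ B
    · refine (hpt x y).trans ?_
      simp [hy]
    have hx' : G x = 0 := h0 x (by simpa [hB] using hx)
    have hy' : G y = 0 := h0 y (by simpa [hB] using hy)
    simp [hx', hy', Real.zero_rpow hp.ne']
  have hBi : Measurable (B.indicator (1 : Euc N → ENNReal)) := measurable_one.indicator hBm
  have hBv : ∫⁻ x, B.indicator (1 : Euc N → ENNReal) x = volume B := lintegral_indicator_one hBm
  have hBfin : volume B < ⊤ := measure_closedBall_lt_top
  have e1 : ∫⁻ x, ∫⁻ y, B.indicator 1 x * F (x - y) = volume B * ∫⁻ z, F z := by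
    have : ∀ x, ∫⁻ y, B.indicator 1 x * F (x - y) = B.indicator 1 x * ∫⁻ z, F z := by
      intro x
      rw [lintegral_const_mul _ (by fun_prop), lintegral_sub_left_eq_self]
    simp only [this]
    rw [lintegral_mul_const _ hBi, hBv]
  have e2 : ∫⁻ x, ∫⁻ y, B.indicator 1 y * F (x - y) = volume B * ∫⁻ z, F z := by
    rw [lintegral_lintegral_swap (by fun_prop)]
    have : ∀ y, ∫⁻ x, B.indicator 1 y * F (x - y) = B.indicator 1 y * ∫⁻ z, F z := by
      intro y
      rw [lintegral_const_mul _ (by fun_prop), lintegral_sub_right_eq_self]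
    simp only [this]
    rw [lintegral_mul_const _ hBi, hBv]
  calc _ ≤ ∫⁻ x, ∫⁻ y, (B.indicator 1 x * F (x - y) + B.indicator 1 y * F (x - y)) :=
        lintegral_mono fun x => lintegral_mono fun y => hpt' x y
    _ = ∫⁻ x, ((∫⁻ y, B.indicator 1 x * F (x - y)) + ∫⁻ y, B.indicator 1 y * F (x - y)) := by
        refine lintegral_congr fun x => lintegral_add_left (by fun_prop) _
    _ = (∫⁻ x, ∫⁻ y, B.indicator 1 x * F (x - y)) +
          ∫⁻ x, ∫⁻ y, B.indicator 1 y * F (x - y) := by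
        refine lintegral_add_left ?_ _
        exact Measurable.lintegral_prod_right' (f := fun q : Euc N × Euc N =>
          B.indicator 1 q.1 * F (q.1 - q.2)) (by fun_prop)
    _ < ⊤ := by
        rw [e1, e2]
        exact ENNReal.add_lt_top.2 ⟨ENNReal.mul_lt_top hBfin hFfin,
          ENNReal.mul_lt_top hBfin hFfin⟩

section Scaling

variable {N : ℕ} {F : Type*} [NormedAddCommGroup F] [NormedSpace ℝ F]

lemma iteratedFDeriv_scale {g : Euc N → F} (hg : ContDiff ℝ (⊤ : ℕ∞) g) (a c : ℝ) (j : ℕ)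
    (x : Euc N) :
    iteratedFDeriv ℝ j (fun y => a • g (c • y)) x =
      (a * c ^ j) • iteratedFDeriv ℝ j g (c • x) := by
  have hgj : ContDiff ℝ j g := hg.of_le (by exact_mod_cast le_top)
  have h : ContDiffAt ℝ j (fun y => g (c • y)) x :=
    (hgj.comp (contDiff_const_smul c)).contDiffAt
  rw [iteratedFDeriv_const_smul_apply' h, iteratedFDeriv_comp_const_smul c hgj, smul_smul]

lemma sobNorm_nonneg (Ω : Set (Euc N)) (s p : ℝ) (u : Euc N → F) : 0 ≤ sobNorm Ω s p u := by
  have h : ∀ k, 0 ≤ intSobNorm Ω k p u := fun k =>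
    Finset.sum_nonneg fun j _ => Real.rpow_nonneg (integral_nonneg fun x => by positivity) _
  unfold sobNorm
  split_ifs
  · exact h _
  · refine add_nonneg (h _) (Real.rpow_nonneg ?_ _)
    exact integral_nonneg fun x => integral_nonneg fun y => by positivity

lemma integral_norm_iteratedFDeriv_scale_le (Ω : Set (Euc N)) {p : ℝ} (hp : 0 < p)
    {g : Euc N → F} (hg : ContDiff ℝ (⊤ : ℕ∞) g) (hc : HasCompactSupport g) (j : ℕ)
    {a c : ℝ} (ha : 0 ≤ a) (hc0 : 0 < c) :
    (∫ x in Ω, ‖iteratedFDeriv ℝ j (fun y => a • g (c • y)) x‖ ^ p) ^ (1 / p) ≤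
      (∫ x, ‖iteratedFDeriv ℝ j g x‖ ^ p) ^ (1 / p) * (a * c ^ ((j : ℝ) - N / p)) := by
  set I := ∫ x, ‖iteratedFDeriv ℝ j g x‖ ^ p with hI
  have hI0 : 0 ≤ I := integral_nonneg fun x => by positivity
  have hcont : Continuous fun x => ‖iteratedFDeriv ℝ j g x‖ ^ p :=
    ((hg.continuous_iteratedFDeriv (by exact_mod_cast le_top)).norm).rpow_const
      fun _ => Or.inr hp.le
  have hcs : HasCompactSupport fun x => ‖iteratedFDeriv ℝ j g x‖ ^ p :=
    (hc.iteratedFDeriv (𝕜 := ℝ) j).comp_left (g := fun v => ‖v‖ ^ p)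
      (by simp [Real.zero_rpow hp.ne'])
  have hint := hcont.integrable_of_hasCompactSupport hcs (μ := volume)
  have hpt : ∀ x, ‖iteratedFDeriv ℝ j (fun y => a • g (c • y)) x‖ ^ p =
      (a * c ^ j) ^ p * ‖iteratedFDeriv ℝ j g (c • x)‖ ^ p := by
    intro x
    rw [iteratedFDeriv_scale hg, norm_smul, Real.norm_of_nonneg (by positivity),
      Real.mul_rpow (by positivity) (by positivity)]
  have h1 : ∫ x in Ω, ‖iteratedFDeriv ℝ j (fun y => a • g (c • y)) x‖ ^ p ≤
      (a * c ^ j) ^ p * ((c ^ N)⁻¹ * I) := by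
    simp only [hpt]
    have hint' : Integrable fun x => ‖iteratedFDeriv ℝ j g (c • x)‖ ^ p :=
      hint.comp_smul hc0.ne'
    refine (setIntegral_le_integral (hint'.const_mul _)
      (Eventually.of_forall fun x => by positivity)).trans_eq ?_
    rw [integral_const_mul, Measure.integral_comp_smul_of_nonneg volume
      (fun x => ‖iteratedFDeriv ℝ j g x‖ ^ p) c (hR := hc0.le), finrank_euclideanSpace_fin,
      smul_eq_mul]
  calc _ ≤ ((a * c ^ j) ^ p * ((c ^ N)⁻¹ * I)) ^ (1 / p) := by
        refine Real.rpow_le_rpow (integral_nonneg fun x => by positivity) h1 (by positivity)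
    _ = _ := by
        rw [Real.mul_rpow (by positivity) (by positivity), Real.mul_rpow (by positivity) hI0,
          ← Real.rpow_mul (by positivity), mul_one_div_cancel hp.ne', Real.rpow_one,
          ← Real.rpow_natCast c N, ← Real.rpow_neg hc0.le, ← Real.rpow_mul hc0.le,
          Real.rpow_sub hc0, ← Real.rpow_natCast c j,
          show -(N : ℝ) * (1 / p) = -(N / p) by ring, Real.rpow_neg hc0.le]
        ring

lemma gagliardo_scale_le (Ω : Set (Euc N)) (hN : 0 < N) {p θ : ℝ} (hp : 0 < p) (hθ0 : 0 < θ)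
    (hθ1 : θ < 1) {g : Euc N → F} (hg : ContDiff ℝ (⊤ : ℕ∞) g) (h0 : tsupport g ⊆
      Metric.closedBall 0 1) (j : ℕ) :
    ∃ C : ℝ, 0 ≤ C ∧ ∀ a c : ℝ, 0 ≤ a → 0 < c →
      (∫ x in Ω, ∫ y in Ω, ‖iteratedFDeriv ℝ j (fun y => a • g (c • y)) x -
          iteratedFDeriv ℝ j (fun y => a • g (c • y)) y‖ ^ p /
            ‖x - y‖ ^ ((N : ℝ) + θ * p)) ^ (1 / p) ≤
      C * (a * c ^ ((j : ℝ) + θ - N / p)) := by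
  have hc : HasCompactSupport g :=
    (isCompact_closedBall (0 : Euc N) 1).of_isClosed_subset (isClosed_tsupport g) h0
  set G := iteratedFDeriv ℝ j g with hG
  have hGc : HasCompactSupport G := hc.iteratedFDeriv j
  have hGs : ContDiff ℝ 1 G := hg.iteratedFDeriv_right (by exact_mod_cast le_top)
  obtain ⟨K, hK⟩ := hGs.lipschitzWith_of_hasCompactSupport hGc one_ne_zero
  obtain ⟨A, hA⟩ := hGc.exists_bound_of_continuous hGs.continuous
  have hG0 : ∀ x, 1 < ‖x‖ → G x = 0 := fun x hx =>
    image_eq_zero_of_notMem_tsupport fun h => by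
      have := h0 (tsupport_iteratedFDeriv_subset j h)
      simp only [Metric.mem_closedBall, dist_zero_right] at this
      linarith
  set e : ℝ := (N : ℝ) + θ * p with he
  set Φ : Euc N → Euc N → ℝ := fun x y => ‖G x - G y‖ ^ p / ‖x - y‖ ^ e with hΦ
  set D := ∫⁻ x, ∫⁻ y, ‖Φ x y‖ₑ with hD
  have hDfin : D < ⊤ := lintegral_gagliardo_lt_top hN hp hθ0 hθ1 hK hA hG0
  refine ⟨D.toReal ^ (1 / p), by positivity, fun a c ha hc0 => ?_⟩
  set κ := (a * c ^ j) ^ p * c ^ e with hκ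
  have hκ0 : 0 ≤ κ := by positivity
  have hpt : ∀ x y, ‖iteratedFDeriv ℝ j (fun y => a • g (c • y)) x -
      iteratedFDeriv ℝ j (fun y => a • g (c • y)) y‖ ^ p / ‖x - y‖ ^ e =
      κ * Φ (c • x) (c • y) := by
    intro x y
    simp only [hΦ, hG]
    rw [iteratedFDeriv_scale hg, iteratedFDeriv_scale hg, ← smul_sub, ← smul_sub, norm_smul,
      norm_smul, Real.norm_of_nonneg hc0.le, Real.norm_of_nonneg (by positivity),
      Real.mul_rpow (by positivity) (by positivity), Real.mul_rpow hc0.le (by positivity), hκ]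
    have : c ^ e ≠ 0 := (Real.rpow_pos_of_pos hc0 _).ne'
    field_simp
  simp only [hpt]
  have hle : ∫ x in Ω, ∫ y in Ω, κ * Φ (c • x) (c • y) ≤
      κ * ((c ^ N)⁻¹ * ((c ^ N)⁻¹ * D.toReal)) := by
    have h1 : ‖∫ x in Ω, ∫ y in Ω, κ * Φ (c • x) (c • y)‖ₑ ≤
        ENNReal.ofReal κ * (ENNReal.ofReal ((c ^ N)⁻¹) * (ENNReal.ofReal ((c ^ N)⁻¹) * D)) := by
      calc _ ≤ ∫⁻ x in Ω, ∫⁻ y in Ω, ‖κ * Φ (c • x) (c • y)‖ₑ :=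
            (enorm_integral_le_lintegral_enorm _).trans
              (lintegral_mono fun x => enorm_integral_le_lintegral_enorm _)
        _ ≤ ∫⁻ x, ∫⁻ y, ‖κ * Φ (c • x) (c • y)‖ₑ :=
            (setLIntegral_le_lintegral _ _).trans
              (lintegral_mono fun x => setLIntegral_le_lintegral _ _)
        _ = _ := by
            simp only [enorm_mul, Real.enorm_of_nonneg hκ0]
            simp only [lintegral_const_mul' _ _ ENNReal.ofReal_ne_top]
            congr 1
            have h2 : ∀ x, ∫⁻ y, ‖Φ (c • x) (c • y)‖ₑ =
                ENNReal.ofReal ((c ^ N)⁻¹) * ∫⁻ y, ‖Φ (c • x) y‖ₑ := fun x =>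
              lintegral_comp_smul_euc (fun y => ‖Φ (c • x) y‖ₑ) hc0
            simp only [h2]
            rw [lintegral_const_mul' _ _ ENNReal.ofReal_ne_top,
              lintegral_comp_smul_euc (fun x => ∫⁻ y, ‖Φ x y‖ₑ) hc0]
    have h3 := ENNReal.toReal_mono (by finiteness) h1
    rw [toReal_enorm] at h3
    refine (le_abs_self _).trans (h3.trans_eq ?_)
    simp only [ENNReal.toReal_mul]
    rw [ENNReal.toReal_ofReal hκ0, ENNReal.toReal_ofReal (by positivity)]
  calc _ ≤ (κ * ((c ^ N)⁻¹ * ((c ^ N)⁻¹ * D.toReal))) ^ (1 / p) := by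
        refine Real.rpow_le_rpow ?_ hle (by positivity)
        exact integral_nonneg fun x => integral_nonneg fun y => by positivity
    _ = ((a * c ^ ((j : ℝ) + θ - N / p)) ^ p * D.toReal) ^ (1 / p) := by
        congr 1
        rw [hκ, Real.mul_rpow ha (by positivity), Real.mul_rpow ha (by positivity),
          ← Real.rpow_natCast c j, ← Real.rpow_natCast c N, ← Real.rpow_mul hc0.le,
          ← Real.rpow_mul hc0.le, ← Real.rpow_neg hc0.le]
        have : ((j : ℝ) + θ - N / p) * p = j * p + e + -N + -N := by
          rw [he]; field_simp; ring
        rw [this, Real.rpow_add hc0 (j * p + e + -N) (-N), Real.rpow_add hc0 (j * p + e) (-N),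
          Real.rpow_add hc0 (j * p) e]
        ring
    _ = _ := by
        rw [Real.mul_rpow (by positivity) (by positivity), ← Real.rpow_mul (by positivity),
          mul_one_div_cancel hp.ne', Real.rpow_one, mul_comm]

lemma sobNorm_scale_le (Ω : Set (Euc N)) (hN : 0 < N) {s p : ℝ} (hs : 0 < s) (hp : 0 < p)
    {g : Euc N → F} (hg : ContDiff ℝ (⊤ : ℕ∞) g)
    (h0 : tsupport g ⊆ Metric.closedBall 0 1) :
    ∃ C : ℝ, 0 ≤ C ∧ ∀ a c : ℝ, 0 ≤ a → 1 ≤ c →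
      sobNorm Ω s p (fun x => a • g (c • x)) ≤ C * (a * c ^ (s - N / p)) := by
  have hc : HasCompactSupport g :=
    (isCompact_closedBall (0 : Euc N) 1).of_isClosed_subset (isClosed_tsupport g) h0
  set C₁ := ∑ j ∈ Finset.range (⌊s⌋₊ + 1), (∫ x, ‖iteratedFDeriv ℝ j g x‖ ^ p) ^ (1 / p) with hC₁
  have hI : ∀ j : ℕ, 0 ≤ (∫ x, ‖iteratedFDeriv ℝ j g x‖ ^ p) ^ (1 / p) := fun j =>
    Real.rpow_nonneg (integral_nonneg fun x => by positivity) _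
  have hC₁0 : 0 ≤ C₁ := Finset.sum_nonneg fun j _ => hI j
  have hint : ∀ a c : ℝ, 0 ≤ a → 1 ≤ c →
      intSobNorm Ω ⌊s⌋₊ p (fun x => a • g (c • x)) ≤ C₁ * (a * c ^ (s - N / p)) := by
    intro a c ha hc1
    have hc0 : 0 < c := by linarith
    rw [intSobNorm, hC₁, Finset.sum_mul]
    refine Finset.sum_le_sum fun j hj => ?_
    refine (integral_norm_iteratedFDeriv_scale_le Ω hp hg hc j ha hc0).trans ?_
    have hjs : (j : ℝ) ≤ s :=
      (Nat.cast_le.2 (Nat.lt_succ_iff.1 (Finset.mem_range.1 hj))).trans (Nat.floor_le hs.le)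
    have := hI j
    gcongr
  unfold sobNorm
  by_cases hk : ∃ k : ℕ, s = k
  · simp only [if_pos hk]
    exact ⟨C₁, hC₁0, hint⟩
  · simp only [if_neg hk]
    have hθ0 : 0 < s - ⌊s⌋₊ := sub_pos.2
      (lt_of_le_of_ne (Nat.floor_le hs.le) fun h => hk ⟨_, h.symm⟩)
    have hθ1 : s - ⌊s⌋₊ < 1 := by linarith [Nat.lt_floor_add_one s]
    obtain ⟨C₂, hC₂, h₂⟩ := gagliardo_scale_le Ω hN hp hθ0 hθ1 hg h0 ⌊s⌋₊
    refine ⟨C₁ + C₂, by positivity, fun a c ha hc1 => ?_⟩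
    have h := h₂ a c ha (by linarith)
    rw [add_sub_cancel] at h
    rw [add_mul]
    exact add_le_add (hint a c ha hc1) h

end Scaling

/-- Scaling of the Jacobian minor tested against a homogeneous polynomial. -/
lemma setIntegral_jacMinor_scale {N n m r : ℕ} (hr : 0 < r) (β : Fin r → Fin n)
    (α : Fin m → Fin r → Fin N) {g : Euc N → Fin n → ℝ} (hg : ContDiff ℝ (⊤ : ℕ∞) g)
    (hsupp : tsupport g ⊆ Metric.closedBall 0 (1 / 2)) {Ω : Set (Euc N)}
    (hΩ : Metric.closedBall (0 : Euc N) 1 ⊆ Ω) {η : Euc N → ℝ}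
    (hη : ∀ x ∈ Metric.closedBall (0 : Euc N) (1 / 2), η x = 1) (ℓ : Euc N →L[ℝ] ℝ) (j : ℕ)
    (b a : ℝ) {c : ℝ} (hc : 1 ≤ c) :
    ∫ x in Ω, jacMinor m r β α (fun y => a • g (c • y)) x * (b * (η x * ℓ x ^ j)) =
      (a * c ^ m) ^ r * (c ^ N)⁻¹ * (c ^ j)⁻¹ *
        (b * ∫ x, jacMinor m r β α g x * ℓ x ^ j) := by
  have hc0 : 0 < c := by linarith
  have hJ0 : ∀ x, 1 / 2 < ‖x‖ → jacMinor m r β α g (c • x) = 0 := by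
    intro x hx
    refine jacMinor_eq_zero hr β α fun h => ?_
    have h' := hsupp h
    rw [Metric.mem_closedBall, dist_zero_right, norm_smul, Real.norm_of_nonneg hc0.le] at h'
    nlinarith [norm_nonneg x]
  have hpt : ∀ x, jacMinor m r β α (fun y => a • g (c • y)) x * (b * (η x * ℓ x ^ j)) =
      ((a * c ^ m) ^ r * (c ^ j)⁻¹ * b) * (jacMinor m r β α g (c • x) * ℓ (c • x) ^ j) := by
    intro x
    rw [jacMinor_scale β α hg]
    rcases lt_or_ge (1 / 2) ‖x‖ with hx | hx
    · simp [hJ0 x hx]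
    · rw [hη x (by simpa using hx), map_smul, smul_eq_mul, mul_pow c (ℓ x) j]
      field_simp
  rw [setIntegral_eq_integral_of_forall_compl_eq_zero]
  · simp only [hpt]
    rw [integral_const_mul, Measure.integral_comp_smul_of_nonneg volume
      (fun x => jacMinor m r β α g x * ℓ x ^ j) c (hR := hc0.le), finrank_euclideanSpace_fin,
      smul_eq_mul]
    ring
  · intro x hx
    have hx' : 1 < ‖x‖ := by
      by_contra! h
      exact hx (hΩ (by simpa using h))
    rw [hpt, hJ0 x (by linarith)]
    simp

/-- Proposition 4.3: if `1 < p ≤ r`, `s + m/r < m + N/p - N/r` and there is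
`g ∈ C_c^∞(B(0,1), ℝ^n)` with `∫_{B(0,1)} M^β_α(D^m g) |x|^m dx ≠ 0`, then there are
`u_k ∈ C^m(Ω̄, ℝ^n)` and `ψ ∈ C_c^∞(Ω)` with `‖u_k‖_{W^{s,p}} → 0` and
`∫_Ω M^β_α(D^m u_k) ψ → ∞`. -/
theorem stmt11 (N n m r : ℕ) (hN : 2 ≤ N) (hn : 1 ≤ n) (hm : 1 ≤ m)
    (hr1 : 1 < r) (hr : r ≤ min n N)
    (Ω : Set (Euc N)) (hΩ : IsSmoothDomain Ω)
    (hball : Metric.closedBall (0 : Euc N) 1 ⊆ Ω)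
    (p s : ℝ) (hp1 : 1 < p) (hpr : p ≤ r) (hs0 : 0 < s)
    (hs : s + (m : ℝ) / r < (m : ℝ) + (N : ℝ) / p - (N : ℝ) / r)
    (β : Fin r → Fin n) (hβ : StrictMono β)
    (α : Fin m → Fin r → Fin N) (hα : ∀ j, StrictMono (α j))
    (g : Euc N → Fin n → ℝ) (hg : ContDiff ℝ (⊤ : ℕ∞) g)
    (hgc : HasCompactSupport g) (hgs : tsupport g ⊆ Metric.ball (0 : Euc N) 1)
    (hgnz : (∫ x in Metric.ball (0 : Euc N) 1,
      jacMinor m r β α g x * ‖x‖ ^ m) ≠ 0) :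
    ∃ (u : ℕ → Euc N → Fin n → ℝ) (ψ : Euc N → ℝ),
      (∀ k, ContDiffOn ℝ m (u k) (closure Ω)) ∧ IsCinfc Ω ψ ∧
      Tendsto (fun k => sobNorm Ω s p (u k)) atTop (𝓝 0) ∧
      Tendsto (fun k => ∫ x in Ω, jacMinor m r β α (u k) x * ψ x) atTop atTop := by
  have hr0 : 0 < r := by omega
  have hrr : (0 : ℝ) < r := by exact_mod_cast hr0
  obtain ⟨G, hG, hGs, ℓ, j, hjm, hI⟩ :=
    exists_moment_ne_zero (m := m) hr0 hβ.injective fun i => (hα i).injective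
  set I := ∫ x, jacMinor m r β α G x * ℓ x ^ j with hIdef
  obtain ⟨ρ, hρ1, hρ2⟩ : ∃ ρ : ℝ, (N : ℝ) / r + (m : ℝ) / r - m < ρ ∧ ρ < (N : ℝ) / p - s :=
    exists_between (by linarith)
  let η : ContDiffBump (0 : Euc N) := ⟨1 / 2, 1, by norm_num, by norm_num⟩
  have hη : ∀ x ∈ Metric.closedBall (0 : Euc N) (1 / 2), η x = 1 := fun x hx =>
    η.one_of_mem_closedBall hx
  obtain ⟨C, hC, hsob⟩ := sobNorm_scale_le Ω (by omega : 0 < N) hs0 (by linarith : 0 < p) hG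
    (hGs.trans (Metric.closedBall_subset_closedBall (by norm_num)))
  let c : ℕ → ℝ := fun k => (k : ℝ) + 1
  have hc1 : ∀ k, 1 ≤ c k := fun k => by simp [c]
  have hc0 : ∀ k, 0 < c k := fun k => by linarith [hc1 k]
  have hclim : Tendsto c atTop atTop :=
    tendsto_atTop_add_const_right _ _ tendsto_natCast_atTop_atTop
  refine ⟨fun k x => c k ^ ρ • G (c k • x), fun x => I * (η x * ℓ x ^ j), fun k => ?_, ?_, ?_, ?_⟩
  · refine ContDiff.contDiffOn ?_
    have h : ContDiff ℝ m G := hG.of_le (by exact_mod_cast le_top)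
    exact (h.comp (contDiff_const_smul (c k))).const_smul _
  · have hsub : tsupport (fun x => I * (η x * ℓ x ^ j)) ⊆ Metric.closedBall (0 : Euc N) 1 := by
      rw [← η.tsupport_eq]
      refine closure_mono fun x hx hx' => hx ?_
      simp [hx']
    refine ⟨contDiff_const.mul (η.contDiff.mul (ℓ.contDiff.pow j)), ?_, hsub.trans hball⟩
    exact (isCompact_closedBall (0 : Euc N) 1).of_isClosed_subset (isClosed_tsupport _) hsub
  · have hlim : Tendsto (fun k => C * c k ^ (-((N : ℝ) / p - s - ρ))) atTop (𝓝 0) := by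
      have := ((tendsto_rpow_neg_atTop (by linarith : 0 < (N : ℝ) / p - s - ρ)).comp
        hclim).const_mul C
      simpa using this
    refine squeeze_zero (fun k => sobNorm_nonneg _ _ _ _) (fun k => ?_) hlim
    refine (hsob (c k ^ ρ) (c k) (Real.rpow_nonneg (hc0 k).le _) (hc1 k)).trans_eq ?_
    rw [← Real.rpow_add (hc0 k)]
    congr 2
    ring
  · have hexp : 0 < r * (ρ + m) - N - j := by
      have h1 : (r : ℝ) * ((N : ℝ) / r + (m : ℝ) / r - m) < r * ρ := by gcongr
      have h2 : (r : ℝ) * ((N : ℝ) / r + (m : ℝ) / r - m) = N + m - r * m := by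
        field_simp
      have h3 : (j : ℝ) ≤ m := by exact_mod_cast hjm
      nlinarith
    have hlim := ((tendsto_rpow_atTop hexp).comp hclim).atTop_mul_const (mul_self_pos.2 hI)
    refine hlim.congr fun k => ?_
    rw [setIntegral_jacMinor_scale hr0 β α hG hGs hball hη ℓ j I _ (hc1 k), ← hIdef]
    congr 1
    have h := hc0 k
    rw [Function.comp_apply, ← Real.rpow_natCast (c k) m, ← Real.rpow_add h,
      ← Real.rpow_natCast (_ ^ _) r, ← Real.rpow_mul h.le, ← Real.rpow_natCast (c k) N,
      ← Real.rpow_natCast (c k) j, ← Real.rpow_neg h.le, ← Real.rpow_neg h.le,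
      ← Real.rpow_add h, ← Real.rpow_add h]
    congr 1
    ring
end
end
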